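/- Let k ≥ 4 be an even integer. The functions q ↦ G^{1/2}_{r,s}(q) on the open unit disc, for r+s=k with r,s ≥ 1 odd, are linearly independent over ℂ: if complex numbers c_{r,s} (r+s=k, r,s odd) satisfy ∑ c_{r,s}·G^{1/2}_{r,s}(q) = 0 for all |q|<1, then all c_{r,s}=0. -/

import Mathlib

open Complex UpperHalfPlane Finset

noncomputable section

/-- The zeta value `ζ(k) = ∑_{n ≥ 1} n^{-k}`. -/
def zetaVal (k : ℕ) : ℂ := ∑' n : ℕ, 1 / ((n : ℂ) + 1) ^ k

/-- The double zeta value `ζ(r,s) = ∑_{0 < n < m} n^{-r} m^{-s}`. -/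
def doubleZeta (r s : ℕ) : ℂ :=
  ∑' p : ℕ × ℕ, 1 / (((p.1 : ℂ) + 1) ^ r * ((p.1 : ℂ) + (p.2 : ℂ) + 2) ^ s)

/-- `ζ̃(k) = ζ(k)/(2πi)^k` for `k ≥ 2`, and `ζ̃(1) = 0`. -/
def zetaTilde (k : ℕ) : ℂ :=
  if 2 ≤ k then zetaVal k / (2 * (Real.pi : ℂ) * Complex.I) ^ k else 0

/-- `ζ̃(r,s) = ζ(r,s)/(2πi)^{r+s}` for `s ≥ 2`;
`ζ̃(r,1) = -ζ̃(1,r) - ζ̃(r+1)` for `r ≥ 2`; `ζ̃(1,1) = -(1/2)ζ̃(2)`. -/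
def doubleZetaTilde (r s : ℕ) : ℂ :=
  if 2 ≤ s then doubleZeta r s / (2 * (Real.pi : ℂ) * Complex.I) ^ (r + s)
  else if 2 ≤ r then
    -(doubleZeta 1 r / (2 * (Real.pi : ℂ) * Complex.I) ^ (1 + r)) - zetaTilde (r + 1)
  else -(1 / 2) * zetaTilde 2

/-- `g_h(q) = ((-1)^h/(h-1)!) ∑_{c,d>0} c^{h-1} q^{cd}`. -/
def gSeries (h : ℕ) (q : ℂ) : ℂ :=
  ((-1 : ℂ) ^ h / (Nat.factorial (h - 1) : ℂ)) *
    ∑' p : ℕ × ℕ, ((p.1 : ℂ) + 1) ^ (h - 1) * q ^ ((p.1 + 1) * (p.2 + 1))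

/-- `g_{r,s}(q) = ((-1)^{r+s}/((r-1)!(s-1)!)) ∑_{0<d₁<d₂, c₁,c₂>0} c₁^{r-1} c₂^{s-1}
q^{c₁d₁+c₂d₂}`, where we parametrize `c₁ = p.1+1`, `c₂ = p.2.1+1`, `d₁ = p.2.2.1+1`,
`d₂ = d₁ + p.2.2.2 + 1`. -/
def gDoubleSeries (r s : ℕ) (q : ℂ) : ℂ :=
  ((-1 : ℂ) ^ (r + s) / ((Nat.factorial (r - 1) : ℂ) * (Nat.factorial (s - 1) : ℂ))) *
    ∑' p : ℕ × ℕ × ℕ × ℕ,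
      ((p.1 : ℂ) + 1) ^ (r - 1) * ((p.2.1 : ℂ) + 1) ^ (s - 1) *
        q ^ ((p.1 + 1) * (p.2.2.1 + 1) + (p.2.1 + 1) * (p.2.2.1 + 1 + p.2.2.2 + 1))

/-- `g*_k(q) = ((-1)^k/k!) ∑_{c,d>0} d c^k q^{cd}`. -/
def gStar (k : ℕ) (q : ℂ) : ℂ :=
  ((-1 : ℂ) ^ k / (Nat.factorial k : ℂ)) *
    ∑' p : ℕ × ℕ, ((p.2 : ℂ) + 1) * ((p.1 : ℂ) + 1) ^ k * q ^ ((p.1 + 1) * (p.2 + 1))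

/-- `ε_{s,r}(q) = δ_{s,2} g*_r(q) - δ_{s,1} g*_{r-1}(q) + δ_{r,1}(g*_{s-1}(q) + g_r(q))
 + δ_{r,1} δ_{s,1} g_2(q)`. -/
def epsSeries (s r : ℕ) (q : ℂ) : ℂ :=
  (if s = 2 then gStar r q else 0) - (if s = 1 then gStar (r - 1) q else 0)
    + (if r = 1 then gStar (s - 1) q + gSeries r q else 0)
    + (if r = 1 ∧ s = 1 then gSeries 2 q else 0)

/-- The divisor sum `σ_k(n) = ∑_{d ∣ n} d^k`. -/
def sigmaFn (k n : ℕ) : ℕ := ∑ d ∈ n.divisors, d ^ k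

/-- The Eisenstein `q`-series `G_k(q) = ζ̃(k) + ((-1)^k/(k-1)!) ∑_{n>0} σ_{k-1}(n) q^n`. -/
def Gq (k : ℕ) (q : ℂ) : ℂ :=
  zetaTilde k + ((-1 : ℂ) ^ k / (Nat.factorial (k - 1) : ℂ)) *
    ∑' n : ℕ, (sigmaFn (k - 1) (n + 1) : ℂ) * q ^ (n + 1)

/-- `C^p_{r,s} = δ_{r,p} + (-1)^r C(p-1,r-1) + (-1)^{p-s} C(p-1,s-1)`
(note `(-1)^{p-s} = (-1)^{p+s}`). -/
def Ccoef (r s p : ℕ) : ℤ :=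
  (if r = p then 1 else 0) + (-1 : ℤ) ^ r * (Nat.choose (p - 1) (r - 1))
    + (-1 : ℤ) ^ (p + s) * (Nat.choose (p - 1) (s - 1))

/-- The double Eisenstein `q`-series
`G_{r,s}(q) = ζ̃(r,s) + ∑_{h+p=r+s} C^p_{r,s} g_h(q) ζ̃(p) + g_{r,s}(q) + (1/2)ε_{r,s}(q)`. -/
def Gdouble (r s : ℕ) (q : ℂ) : ℂ :=
  doubleZetaTilde r s
    + ∑ p ∈ Finset.Icc 1 (r + s - 1), (Ccoef r s p : ℂ) * gSeries (r + s - p) q * zetaTilde p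
    + gDoubleSeries r s q + (1 / 2) * epsSeries r s q

/-- `G^{1/2}_{r,s}(q) = G_{r,s}(q) + (1/2) G_{r+s}(q)`. -/
def Ghalf (r s : ℕ) (q : ℂ) : ℂ := Gdouble r s q + (1 / 2) * Gq (r + s) q

/-- `G'_k(q) = q (d/dq) G_k(q)`. -/
def Gderiv (k : ℕ) (q : ℂ) : ℂ := q * deriv (Gq k) q

/-- `P_{r,s}(q) = G_r(q) G_s(q) + (δ_{r,2} + δ_{s,2}) G'_{r+s-2}(q) / (2(r+s-2))`. -/
def Pseries (r s : ℕ) (q : ℂ) : ℂ :=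
  Gq r q * Gq s q +
    ((if r = 2 then (1 : ℂ) else 0) + (if s = 2 then (1 : ℂ) else 0)) *
      Gderiv (r + s - 2) q / (2 * ((r : ℂ) + (s : ℂ) - 2))

/-- The completed `L`-function `L*_f(s) = ∫₀^∞ f(it) t^{s-1} dt`. -/
def Lstar (f : UpperHalfPlane → ℂ) (s : ℝ) : ℂ :=
  ∫ t in Set.Ioi (0 : ℝ),
    (if ht : 0 < t then f ⟨Complex.I * t, by simpa using ht⟩ else 0) * (t : ℂ) ^ ((s : ℂ) - 1)

/-- `q_{i,j}(f) = ∑_{r+s=k, r,s odd} (-1)^{(s-1)/2} L*_f(s) C(i-1,s-1)`. -/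
def qcoef (k : ℕ) (f : UpperHalfPlane → ℂ) (i j : ℕ) : ℂ :=
  ∑ s ∈ Finset.Icc 1 (k - 1),
    if Odd s ∧ Odd (k - s) then
      (-1 : ℂ) ^ ((s - 1) / 2) * Lstar f (s : ℝ) * (Nat.choose (i - 1) (s - 1) : ℂ)
    else 0

/-- `q = e^{2πiτ}`. -/
def qexp (τ : UpperHalfPlane) : ℂ := Complex.exp (2 * (Real.pi : ℂ) * Complex.I * (τ : ℂ))

/-- `f` is a normalized Hecke eigenform of weight `k`: its Fourier coefficients `a n`
satisfy `a 1 = 1`, multiplicativity on coprime arguments, and the Hecke recursion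
at prime powers. -/
def IsNormalizedHeckeEigenform (k : ℕ) (f : UpperHalfPlane → ℂ) : Prop :=
  ∃ a : ℕ → ℂ,
    (∀ τ : UpperHalfPlane,
      f τ = ∑' n : ℕ, a (n + 1) * Complex.exp (2 * (Real.pi : ℂ) * Complex.I * ((n : ℂ) + 1) * (τ : ℂ))) ∧
    a 1 = 1 ∧
    (∀ m n : ℕ, Nat.Coprime m n → a (m * n) = a m * a n) ∧
    (∀ p n : ℕ, p.Prime → 1 ≤ n →
      a (p ^ (n + 1)) = a p * a (p ^ n) - (p : ℂ) ^ (k - 1) * a (p ^ (n - 1)))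


/-- The even homogeneous polynomial with coefficients `a`. -/
def PP (m : ℕ) (a : ℕ → ℝ) (x y : ℝ) : ℝ :=
  ∑ j ∈ range (m + 1), a j * x ^ (2 * j) * y ^ (2 * (m - j))

/-- Its antisymmetrization. -/
def AA (m : ℕ) (a : ℕ → ℝ) (x y : ℝ) : ℝ := PP m a x y - PP m a y x

lemma PP_neg_left (m a x y) : PP m a (-x) y = PP m a x y := by
  simp [PP]

lemma PP_neg_right (m a x y) : PP m a x (-y) = PP m a x y := by
  simp [PP]

lemma AA_neg_left (m a x y) : AA m a (-x) y = AA m a x y := by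
  simp [AA, PP_neg_left, PP_neg_right]

lemma AA_neg_right (m a x y) : AA m a x (-y) = AA m a x y := by
  simp [AA, PP_neg_left, PP_neg_right]

lemma AA_swap (m a x y) : AA m a y x = - AA m a x y := by
  simp [AA]

lemma PP_smul (m a) (t x y : ℝ) : PP m a (t * x) (t * y) = t ^ (2 * m) * PP m a x y := by
  unfold PP
  rw [mul_sum]
  refine sum_congr rfl fun j hj => ?_
  have hj' : j ≤ m := by simp at hj; omega
  have : t ^ (2 * m) = t ^ (2 * j) * t ^ (2 * (m - j)) := by
    rw [← pow_add]; congr 1; omega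
  rw [this, mul_pow, mul_pow]; ring

lemma AA_smul (m a) (t x y : ℝ) : AA m a (t * x) (t * y) = t ^ (2 * m) * AA m a x y := by
  simp only [AA, PP_smul]; ring

lemma AA_sub_comm (m a) (x y z : ℝ) : AA m a x (y - z) = AA m a x (z - y) := by
  rw [← AA_neg_right, neg_sub]

lemma AA_sub_comm' (m a) (x y z : ℝ) : AA m a (y - z) x = AA m a (z - y) x := by
  rw [← AA_neg_left, neg_sub]

/-- polynomial version of `PP` along two lines -/
def PPpoly (m : ℕ) (a : ℕ → ℝ) (p q : Polynomial ℝ) : Polynomial ℝ :=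
  ∑ j ∈ range (m + 1), Polynomial.C (a j) * p ^ (2 * j) * q ^ (2 * (m - j))

lemma PPpoly_eval (m a p q) (x : ℝ) :
    (PPpoly m a p q).eval x = PP m a (p.eval x) (q.eval x) := by
  simp [PPpoly, PP, Polynomial.eval_finsetSum]

lemma periodic_poly_const (p : Polynomial ℝ) (h : ∀ x, p.eval (x - 1) = p.eval x) (x : ℝ) :
    p.eval x = p.eval 0 := by
  have h1 : ∀ n : ℕ, p.eval (n : ℝ) = p.eval 0 := by
    intro n
    induction n with
    | zero => simp
    | succ n ih => rw [← ih, ← h]; simp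
  have : p = Polynomial.C (p.eval 0) := by
    apply Polynomial.eq_of_infinite_eval_eq
    apply Set.infinite_of_injective_forall_mem (f := fun n : ℕ => (n : ℝ)) Nat.cast_injective
    intro n; simp [h1]
  conv_lhs => rw [this]
  simp

theorem three_term (m : ℕ) (a : ℕ → ℝ)
    (h : ∀ x y, 2 * PP m a x y = AA m a x (x + y) + AA m a x (x - y)) (x y : ℝ) :
    AA m a x y = AA m a x (x + y) + AA m a (x + y) y := by
  set A := AA m a with hA
  have sw : ∀ x y, A y x = - A x y := AA_swap m a
  have nl : ∀ x y, A (-x) y = A x y := AA_neg_left m a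
  have nr : ∀ x y, A x (-y) = A x y := AA_neg_right m a
  let C : ℝ → ℝ → ℝ := fun x y => A x y + A (x - y) x + A y (x - y)
  have hC1 : ∀ x y, C y x = - C x y := by
    intro x y
    simp only [C]
    have e1 : A (y - x) y = A (x - y) y := AA_sub_comm' m a _ _ _
    have e2 : A x (y - x) = A x (x - y) := AA_sub_comm m a _ _ _
    rw [e1, e2, sw x y, sw (x-y) x, sw y (x-y)]
    ring
  have hC2 : ∀ x y, C x (-y) = - C x y := by
    intro x y
    have e1 := h x y
    have e2 := h y x
    have e3 : A x y = PP m a x y - PP m a y x := rfl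
    simp only [C]
    rw [nr, nl, sub_neg_eq_add]
    have e4 : A y (y - x) = A y (x - y) := AA_sub_comm m a _ _ _
    rw [e4, add_comm y x] at e2
    rw [sw x (x-y), sw x (x+y)]
    linarith
  have hC3 : ∀ x y, C x (x - y) = - C x y := by
    intro x y
    simp only [C, sub_sub_cancel]
    rw [sw x y, sw x (x-y), sw y (x-y)]; ring
  have hC4 : ∀ x y, C x (y - x) = C x y := by
    intro x y
    have := hC2 x (x - y)
    rw [neg_sub] at this
    rw [this, hC3]; ring
  have hC5 : ∀ x, C x 0 = 0 := by
    intro x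
    have := hC2 x 0
    rw [neg_zero] at this; linarith
  have hC6 : ∀ y, C 1 y = 0 := by
    intro y
    let p : Polynomial ℝ := (PPpoly m a 1 .X - PPpoly m a .X 1)
      + (PPpoly m a (1 - .X) 1 - PPpoly m a 1 (1 - .X))
      + (PPpoly m a .X (1 - .X) - PPpoly m a (1 - .X) .X)
    have hp : ∀ x, p.eval x = C 1 x := by
      intro x
      simp [p, C, PPpoly_eval, hA, AA]
    rw [← hp, periodic_poly_const p, hp, hC5]
    intro x; rw [hp, hp, hC4]
  have hC7 : ∀ t x y, C (t * x) (t * y) = t ^ (2 * m) * C x y := by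
    intro t x y
    simp only [C, hA, ← mul_sub, AA_smul]; ring
  have hC8 : ∀ x y, C x y = 0 := by
    intro x y
    by_cases hx : x = 0
    · rw [hx, hC1 y 0, hC5]; simp
    · have := hC7 x 1 (y / x)
      rw [hC6, mul_one, mul_div_cancel₀ _ hx] at this
      simpa using this
  have := hC8 x (-y)
  simp only [C, nr, nl, sub_neg_eq_add] at this
  rw [sw x (x+y), sw (x+y) y] at this
  linarith


lemma AA_eq (m : ℕ) (a : ℕ → ℝ) (x y : ℝ) : AA m a x y =
    ∑ l ∈ range (m + 1), (a (m - l) - a l) * x ^ (2 * (m - l)) * y ^ (2 * l) := by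
  have h1 : PP m a x y = ∑ l ∈ range (m + 1), a (m - l) * x ^ (2 * (m - l)) * y ^ (2 * l) := by
    unfold PP
    rw [← sum_range_reflect]
    refine sum_congr rfl fun j hj => ?_
    have hj' : j ≤ m := by simp at hj; omega
    have e1 : m + 1 - 1 - j = m - j := by omega
    have e2 : m - (m - j) = j := by omega
    rw [e1, e2]
  unfold AA
  rw [h1]; unfold PP
  rw [← sum_sub_distrib]
  refine sum_congr rfl fun j hj => ?_
  ring

lemma add_pow_even_sum (x y : ℝ) (l n : ℕ) (hl : l ≤ n) : (x + y) ^ (2 * l) + (x - y) ^ (2 * l) =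
    2 * ∑ i ∈ range (n + 1), ((2 * l).choose (2 * i) : ℝ) * x ^ (2 * l - 2 * i) * y ^ (2 * i) := by
  have key : ∀ N : ℕ, ∀ f : ℕ → ℝ, ∑ i ∈ range (2 * N + 1), f i * (1 + (-1) ^ i) =
      2 * ∑ i ∈ range (N + 1), f (2 * i) := by
    intro N f
    induction N with
    | zero => simp; ring
    | succ N ih =>
      rw [show 2 * (N + 1) + 1 = 2 * N + 1 + 1 + 1 by ring, sum_range_succ, sum_range_succ, ih,
        sum_range_succ _ (N + 1)]
      have h1 : (-1 : ℝ) ^ (2 * N + 1) = -1 := by rw [pow_succ, pow_mul]; norm_num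
      have h2 : (-1 : ℝ) ^ (2 * N + 1 + 1) = 1 := by rw [pow_succ, h1]; norm_num
      rw [h1, h2, show 2 * (N + 1) = 2 * N + 1 + 1 by ring]; ring
  have h2 := key n (fun i => ((2 * l).choose i : ℝ) * x ^ (2 * l - i) * y ^ i)
  rw [← h2]
  have h3 : ∀ z : ℝ, (x + z) ^ (2 * l) =
      ∑ i ∈ range (2 * n + 1), ((2 * l).choose i : ℝ) * x ^ (2 * l - i) * z ^ i := by
    intro z
    rw [add_comm, add_pow]
    rw [← sum_subset (s₁ := range (2 * l + 1)) (s₂ := range (2 * n + 1))]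
    · refine sum_congr rfl fun i _ => ?_
      ring
    · intro i hi; simp at hi ⊢; omega
    · intro i _ hi; simp at hi
      rw [Nat.choose_eq_zero_of_lt (by omega)]; simp
  rw [h3 y, sub_eq_add_neg, h3 (-y), ← sum_add_distrib]
  refine sum_congr rfl fun i _ => ?_
  rw [neg_pow y]; ring

theorem rel_of_coeff (m : ℕ) (a : ℕ → ℝ) (hm : 1 ≤ m)
    (h : ∀ i, 1 ≤ i → i ≤ m → a (m - i) =
      ∑ l ∈ range (m + 1), (a (m - l) - a l) * ((2 * l).choose (2 * i) : ℝ)) (x y : ℝ) :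
    2 * PP m a x y = AA m a x (x + y) + AA m a x (x - y) := by
  have h0 : a m = 0 := by
    have := h m hm le_rfl
    rw [sum_eq_single m] at this
    · simp at this; linarith
    · intro l hl hlm
      simp at hl
      rw [Nat.choose_eq_zero_of_lt (by omega)]; simp
    · simp
  have hh : ∀ i, i ≤ m → a (m - i) =
      ∑ l ∈ range (m + 1), (a (m - l) - a l) * ((2 * l).choose (2 * i) : ℝ) := by
    intro i hi
    rcases Nat.eq_zero_or_pos i with rfl | h1
    · have := AA_eq m a 1 1
      simp [AA] at this
      simp [h0, ← sum_sub_distrib, this]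
    · exact h i h1 hi
  rw [AA_eq, AA_eq, ← sum_add_distrib]
  have h1 : PP m a x y = ∑ l ∈ range (m + 1), a (m - l) * x ^ (2 * (m - l)) * y ^ (2 * l) := by
    unfold PP
    rw [← sum_range_reflect]
    refine sum_congr rfl fun j hj => ?_
    have hj' : j ≤ m := by simp at hj; omega
    have e1 : m + 1 - 1 - j = m - j := by omega
    have e2 : m - (m - j) = j := by omega
    rw [e1, e2]
  have h2 : ∑ l ∈ range (m + 1), ((a (m - l) - a l) * x ^ (2 * (m - l)) * (x + y) ^ (2 * l) +
      (a (m - l) - a l) * x ^ (2 * (m - l)) * (x - y) ^ (2 * l)) =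
      ∑ l ∈ range (m + 1), ∑ i ∈ range (m + 1),
        2 * ((a (m - l) - a l) * ((2 * l).choose (2 * i) : ℝ)) * (x ^ (2 * (m - i)) * y ^ (2 * i)) := by
    refine sum_congr rfl fun l hl => ?_
    have hl' : l ≤ m := by simp at hl; omega
    rw [← mul_add, add_pow_even_sum x y l m hl', ← mul_assoc, mul_sum]
    refine sum_congr rfl fun i hi => ?_
    by_cases hil : i ≤ l
    · rw [show 2 * (m - i) = 2 * (m - l) + (2 * l - 2 * i) by omega, pow_add]; ring
    · rw [Nat.choose_eq_zero_of_lt (by omega)]; simp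
  rw [h2, sum_comm, h1, mul_sum]
  refine sum_congr rfl fun i hi => ?_
  have hi' : i ≤ m := by simp at hi; omega
  rw [hh i hi', ← sum_mul, ← mul_sum]; ring


/-- distance to nearest integer -/
def uu (x : ℝ) : ℝ := ‖(x : UnitAddCircle)‖

lemma uu_nonneg (x) : 0 ≤ uu x := norm_nonneg _
lemma uu_le (x) : uu x ≤ 1 / 2 := by
  have := AddCircle.norm_le_half_period (p := (1:ℝ)) (x := (x : UnitAddCircle)) one_ne_zero
  simpa [uu] using this
lemma uu_neg (x) : uu (-x) = uu x := by simp [uu]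
lemma uu_add_one (x) : uu (x + 1) = uu x := by
  simp [uu]
lemma uu_lip (x y) : |uu x - uu y| ≤ |x - y| := by
  refine (abs_norm_sub_norm_le _ _).trans ?_
  rw [← AddCircle.coe_sub]
  rw [UnitAddCircle.norm_eq]
  have := round_le (x - y) 0
  simpa using this
lemma uu_of_le (x : ℝ) (h : |x| ≤ 1 / 2) : uu x = |x| := by
  unfold uu
  rw [AddCircle.norm_coe_eq_abs_iff (p := (1:ℝ)) one_ne_zero]
  simpa using h

/-- the iteration -/
def TT (e : ℕ) (B : ℝ → ℝ) (f : ℝ → ℝ) (x : ℝ) : ℝ := uu x ^ e * f (1 / uu x) - B (uu x)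

lemma pow_lip (e : ℕ) (u v : ℝ) (hu : 0 ≤ u) (hu1 : u ≤ 1) (hv : 0 ≤ v) (hv1 : v ≤ 1) :
    |u ^ e - v ^ e| ≤ e * |u - v| := by
  induction e with
  | zero => simp
  | succ e ih =>
    have : u ^ (e + 1) - v ^ (e + 1) = u * (u ^ e - v ^ e) + (u - v) * v ^ e := by ring
    rw [this]
    refine (abs_add_le _ _).trans ?_
    rw [abs_mul, abs_mul, abs_of_nonneg hu, abs_of_nonneg (pow_nonneg hv e)]
    have h1 : u * |u ^ e - v ^ e| ≤ 1 * |u ^ e - v ^ e| := by gcongr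
    have h2 : |u - v| * v ^ e ≤ |u - v| * 1 := by
      gcongr; exact pow_le_one₀ hv hv1
    push_cast; linarith

lemma TT_aux (e : ℕ) (he : 4 ≤ e) (f : ℝ → ℝ) (M L : ℝ) (hM : ∀ x, |f x| ≤ M)
    (hL : ∀ x y, |f x - f y| ≤ L * |x - y|) (u v : ℝ) (hv : 0 ≤ v) (hvu : v ≤ u)
    (hu : u ≤ 1 / 2) : |u ^ e * f (1 / u) - v ^ e * f (1 / v)| ≤ (L / 4 + e * M) * |u - v| := by
  have hM0 : 0 ≤ M := (abs_nonneg _).trans (hM 0)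
  have hL0 : 0 ≤ L := by
    have := (abs_nonneg _).trans (hL 1 0); simpa using this
  have h1 : |(u ^ e - v ^ e) * f (1 / u)| ≤ e * |u - v| * M := by
    rw [abs_mul]
    gcongr
    · exact pow_lip e u v (by linarith) (by linarith) hv (by linarith)
    · exact hM _
  have h2 : |v ^ e * (f (1 / u) - f (1 / v))| ≤ L / 4 * |u - v| := by
    rcases hv.eq_or_lt with rfl | hv'
    · rw [zero_pow (by omega)]; simp; positivity
    rw [abs_mul, abs_of_nonneg (pow_nonneg hv e)]
    have hu0 : 0 < u := by linarith
    calc v ^ e * |f (1 / u) - f (1 / v)| ≤ v ^ e * (L * |1 / u - 1 / v|) := by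
          gcongr; exact hL _ _
      _ = L * (v ^ e / (u * v)) * |u - v| := by
          have : 1 / u - 1 / v = (v - u) / (u * v) := by field_simp
          rw [this, abs_div, abs_of_pos (mul_pos hu0 hv'), abs_sub_comm]; ring
      _ ≤ L * (1 / 4) * |u - v| := by
          gcongr ?_ * ?_
          refine mul_le_mul_of_nonneg_left ?_ hL0
          rw [div_le_iff₀ (by positivity)]
          have e1 : v ^ e = v ^ (e - 2) * (v * v) := by
            rw [← pow_two, ← pow_add]; congr 1; omega
          have e2 : v ^ (e - 2) ≤ 1 / 4 := by
            calc v ^ (e - 2) ≤ v ^ 2 := pow_le_pow_of_le_one hv (by linarith) (by omega)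
              _ ≤ (1 / 2) ^ 2 := by gcongr; linarith
              _ = 1 / 4 := by norm_num
          rw [e1]
          gcongr
      _ = _ := by ring
  have : u ^ e * f (1 / u) - v ^ e * f (1 / v) =
    (u ^ e - v ^ e) * f (1 / u) + v ^ e * (f (1 / u) - f (1 / v)) := by ring
  rw [this]
  refine (abs_add_le _ _).trans ?_
  linarith

theorem theta_fixed (e : ℕ) (he : 4 ≤ e) (B : ℝ → ℝ) (C : ℝ) (hB : ∀ u, 0 ≤ u → u ≤ 1 → |B u| ≤ C)
    (hB' : ∀ u v, 0 ≤ u → u ≤ 1 → 0 ≤ v → v ≤ 1 → |B u - B v| ≤ C * |u - v|) :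
    ∃ (θ : ℝ → ℝ) (L M : ℝ), (∀ x, |θ x| ≤ M) ∧ (∀ x y, |θ x - θ y| ≤ L * |x - y|) ∧
      (∀ x, θ (-x) = θ x) ∧ (∀ x, θ (x + 1) = θ x) ∧
      (∀ x, θ x = uu x ^ e * θ (1 / uu x) - B (uu x)) := by
  have hC0 : 0 ≤ C := (abs_nonneg _).trans (hB 0 le_rfl zero_le_one)
  let M := 2 * C
  let L := 2 * (e * M + C)
  have hu0 := uu_nonneg
  have hu2 := uu_le
  have hu1 : ∀ x, uu x ≤ 1 := fun x => (hu2 x).trans (by norm_num)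
  have hpow : ∀ x, uu x ^ e ≤ 1 / 2 := by
    intro x
    calc uu x ^ e ≤ uu x ^ 1 := pow_le_pow_of_le_one (hu0 x) (hu1 x) (by omega)
      _ ≤ 1 / 2 := by simpa using hu2 x
  let th : ℕ → ℝ → ℝ := fun n => (TT e B)^[n] (fun _ => 0)
  have hth : ∀ n, th (n + 1) = TT e B (th n) := fun n => Function.iterate_succ_apply' _ _ _
  have hM : ∀ n x, |th n x| ≤ M := by
    intro n
    induction n with
    | zero => intro x; simp [th, M, hC0]
    | succ n ih =>
      intro x
      rw [hth]; unfold TT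
      refine (abs_sub _ _).trans ?_
      rw [abs_mul, abs_of_nonneg (pow_nonneg (hu0 x) e)]
      have h1 : uu x ^ e * |th n (1 / uu x)| ≤ 1 / 2 * M := by
        gcongr
        · exact hpow x
        · exact ih _
      have h2 := hB (uu x) (hu0 x) (hu1 x)
      simp only [M] at h1 ⊢; linarith
  have hL : ∀ n x y, |th n x - th n y| ≤ L * |x - y| := by
    intro n
    induction n with
    | zero => intro x y; simp [th, L, M]; positivity
    | succ n ih =>
      have key : ∀ x y, uu y ≤ uu x → |th (n + 1) x - th (n + 1) y| ≤ L * |x - y| := by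
        intro x y hxy
        rw [hth]; unfold TT
        have h1 := TT_aux e he (th n) M L (hM n) ih (uu x) (uu y) (hu0 y) hxy (hu2 x)
        have h2 := hB' (uu x) (uu y) (hu0 x) (hu1 x) (hu0 y) (hu1 y)
        have h3 : |uu x ^ e * th n (1 / uu x) - B (uu x) - (uu y ^ e * th n (1 / uu y) - B (uu y))|
          ≤ (L / 4 + e * M) * |uu x - uu y| + C * |uu x - uu y| := by
          refine le_trans ?_ (add_le_add h1 h2)
          refine le_trans (le_of_eq ?_) (abs_sub _ _)
          congr 1; ring
        refine h3.trans ?_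
        rw [← add_mul]
        gcongr ?_ * ?_
        · simp only [L, M]
          have : (0:ℝ) ≤ e := by positivity
          nlinarith [mul_nonneg this hC0]
        · exact uu_lip x y
      intro x y
      rcases le_total (uu y) (uu x) with h | h
      · exact key x y h
      · rw [abs_sub_comm, abs_sub_comm x]; exact key y x h
  have hdiff : ∀ n x, |th n x - th (n + 1) x| ≤ M * (1 / 2) ^ n := by
    intro n
    induction n with
    | zero =>
      intro x
      have : th 0 x = 0 := rfl
      rw [this]; simpa using hM 1 x
    | succ n ih =>
      intro x
      have t1 : th (n + 1) x = uu x ^ e * th n (1 / uu x) - B (uu x) := by rw [hth]; rfl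
      have t2 : th (n + 1 + 1) x = uu x ^ e * th (n + 1) (1 / uu x) - B (uu x) := by
        rw [hth (n + 1)]; rfl
      rw [t1, t2]
      have : uu x ^ e * th n (1 / uu x) - B (uu x) - (uu x ^ e * th (n + 1) (1 / uu x) - B (uu x))
        = uu x ^ e * (th n (1 / uu x) - th (n + 1) (1 / uu x)) := by ring
      rw [this, abs_mul, abs_of_nonneg (pow_nonneg (hu0 x) e), pow_succ]
      calc _ ≤ 1 / 2 * (M * (1 / 2) ^ n) := by
            gcongr
            · exact hpow x
            · exact ih _
        _ = _ := by ring
  have hcauchy : ∀ x, ∃ l, Filter.Tendsto (fun n => th n x) Filter.atTop (nhds l) := by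
    intro x
    apply cauchySeq_tendsto_of_complete
    apply cauchySeq_of_le_geometric (1 / 2) M (by norm_num)
    intro n; rw [Real.dist_eq]; exact hdiff n x
  choose θ hθ using hcauchy
  refine ⟨θ, L, M, ?_, ?_, ?_, ?_, ?_⟩
  · intro x
    exact le_of_tendsto (hθ x).abs (Filter.Eventually.of_forall fun n => hM n x)
  · intro x y
    exact le_of_tendsto ((hθ x).sub (hθ y)).abs (Filter.Eventually.of_forall fun n => hL n x y)
  · intro x
    refine tendsto_nhds_unique ?_ (hθ x)
    refine (hθ (-x)).congr fun n => ?_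
    cases n with
    | zero => rfl
    | succ n => rw [hth]; simp [TT, uu_neg]
  · intro x
    refine tendsto_nhds_unique ?_ (hθ x)
    refine (hθ (x + 1)).congr fun n => ?_
    cases n with
    | zero => rfl
    | succ n => rw [hth]; simp [TT, uu_add_one]
  · intro x
    have h1 := (Filter.tendsto_add_atTop_iff_nat 1).2 (hθ x)
    refine tendsto_nhds_unique h1 ?_
    simp only [hth, TT]
    exact ((hθ _).const_mul _).sub_const _

theorem theta_exists (m : ℕ) (hm : 2 ≤ m) (a : ℕ → ℝ)
    (h3 : ∀ x y, AA m a x y = AA m a x (x + y) + AA m a (x + y) y) :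
    ∃ (θ : ℝ → ℝ) (L : ℝ), (∀ x y, |θ x - θ y| ≤ L * |x - y|) ∧
      (∀ x, θ (-x) = θ x) ∧ (∀ x, θ (x + 1) = θ x) ∧
      (∀ x, x ≠ 0 → AA m a x 1 = x ^ (2 * m) * θ (1 / x) - θ x) := by
  set B : ℝ → ℝ := fun x => AA m a x 1 with hBdef
  let C : ℝ := ∑ l ∈ range (m + 1), |a (m - l) - a l| * (2 * (m - l) + 1 : ℕ)
  have hB : ∀ u, 0 ≤ u → u ≤ 1 → |B u| ≤ C := by
    intro u h0 h1
    simp only [hBdef, AA_eq, one_pow, mul_one]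
    refine (abs_sum_le_sum_abs _ _).trans (sum_le_sum fun l _ => ?_)
    rw [abs_mul]
    gcongr
    rw [abs_of_nonneg (pow_nonneg h0 _)]
    refine (pow_le_one₀ h0 h1).trans ?_
    simp
  have hB' : ∀ u v, 0 ≤ u → u ≤ 1 → 0 ≤ v → v ≤ 1 → |B u - B v| ≤ C * |u - v| := by
    intro u v h0 h1 h2 h3
    simp only [hBdef, AA_eq, one_pow, mul_one]
    rw [← sum_sub_distrib, sum_mul]
    refine (abs_sum_le_sum_abs _ _).trans (sum_le_sum fun l _ => ?_)
    rw [← mul_sub, abs_mul, mul_assoc]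
    gcongr
    refine (pow_lip _ _ _ h0 h1 h2 h3).trans ?_
    gcongr; omega
  obtain ⟨θ, L, M, hM, hL, hev, hper, hfix⟩ := theta_fixed (2 * m) (by omega) B C hB hB'
  refine ⟨θ, L, hL, hev, hper, ?_⟩
  set e := 2 * m with he
  let E : ℝ → ℝ := fun x => θ x - x ^ e * θ (1 / x) + B x
  have E1 : ∀ x, 0 < x → x ≤ 1 / 2 → E x = 0 := by
    intro x h0 h1
    have : uu x = x := by rw [uu_of_le x (by rwa [abs_of_pos h0]), abs_of_pos h0]
    have h2 := hfix x
    rw [this] at h2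
    simp only [E]; linarith
  have sw : ∀ x y, AA m a y x = - AA m a x y := AA_swap m a
  have E2 : ∀ x, 1 / 2 ≤ x → x < 1 → E x = - x ^ e * E ((1 - x) / x) := by
    intro x h0 h1
    have hx0 : 0 < x := by linarith
    have hx1 : 0 < 1 - x := by linarith
    have k1 := E1 (1 - x) hx1 (by linarith)
    have k2 : θ x = θ (1 - x) := by
      rw [← hev, ← hper]; congr 1; ring
    have k3 : θ (1 / x) = θ ((1 - x) / x) := by
      rw [← hper ((1 - x) / x)]; congr 1; field_simp; ring
    have k4 : θ (1 / (1 - x)) = θ (1 / ((1 - x) / x)) := by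
      rw [← hper (1 / ((1 - x) / x))]; congr 1; field_simp; ring
    have k5 := h3 (1 - x) x
    rw [sub_add_cancel, sw x 1] at k5
    have k6 : AA m a (1 - x) x = x ^ e * B ((1 - x) / x) := by
      simp only [hBdef]
      rw [he, ← AA_smul]; congr 1 <;> field_simp
    simp only [E] at k1 ⊢
    rw [k4] at k1
    rw [k2, k3]
    have k7 : (1 - x) ^ e = x ^ e * ((1 - x) / x) ^ e := by
      rw [← mul_pow]; congr 1; field_simp
    rw [k7] at k1
    have k8 : B x = AA m a x 1 := rfl
    have k9 : B (1 - x) = AA m a (1 - x) 1 := rfl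
    rw [k6] at k5
    rw [k8]; rw [k9] at k1
    linear_combination k1 + k5
  have E3 : ∀ x, 0 < x → x ≤ 1 → |E x| ≤ M + M + C := by
    intro x h0 h1
    simp only [E]
    refine (abs_add_le _ _).trans (add_le_add ((abs_sub _ _).trans (add_le_add (hM _) ?_)) (hB x h0.le h1))
    rw [abs_mul, abs_of_nonneg (pow_nonneg h0.le e)]
    calc _ ≤ 1 * M := by
          gcongr
          · exact pow_le_one₀ h0.le h1
          · exact hM _
      _ = M := one_mul _
  have E4 : ∀ n : ℕ, ∀ x, 0 < x → x ≤ 1 → |E x| ≤ (M + M + C) * (2 / 3) ^ n := by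
    have hK : 0 ≤ M + M + C := (abs_nonneg _).trans (E3 1 one_pos le_rfl)
    intro n
    induction n with
    | zero => intro x h0 h1; simpa using E3 x h0 h1
    | succ n ih =>
      intro x h0 h1
      have hz : |(0:ℝ)| ≤ (M + M + C) * (2 / 3) ^ (n + 1) := by
        rw [abs_zero]; positivity
      rcases le_or_gt x (1 / 2) with h2 | h2
      · rw [E1 x h0 h2]; exact hz
      rcases h1.eq_or_lt with rfl | h1'
      · have : E 1 = 0 := by simp [E, hBdef, AA]
        rw [this]; exact hz
      rw [E2 x h2.le h1']
      have hzpos : 0 < (1 - x) / x := div_pos (by linarith) h0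
      rcases le_or_gt ((1 - x) / x) (1 / 2) with h4 | h4
      · rw [E1 _ hzpos h4, mul_zero]; exact hz
      have hx : x < 2 / 3 := by
        rw [lt_div_iff₀ h0] at h4; linarith
      have h5 := ih _ hzpos (by rw [div_le_one h0]; linarith)
      rw [abs_mul, abs_neg, abs_of_nonneg (pow_nonneg h0.le e), pow_succ]
      calc _ ≤ (2 / 3) * ((M + M + C) * (2 / 3) ^ n) := by
            gcongr
            calc x ^ e ≤ x ^ 1 := pow_le_pow_of_le_one h0.le h1 (by omega)
              _ ≤ 2 / 3 := by rw [pow_one]; exact hx.le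
        _ = _ := by ring
  have E5 : ∀ x, 0 < x → x ≤ 1 → E x = 0 := by
    intro x h0 h1
    have ht : Filter.Tendsto (fun n : ℕ => (M + M + C) * (2 / 3 : ℝ) ^ n) Filter.atTop (nhds ((M + M + C) * 0)) :=
      (tendsto_pow_atTop_nhds_zero_of_lt_one (by norm_num) (by norm_num)).const_mul _
    have := ge_of_tendsto' ht (fun n => E4 n x h0 h1)
    rw [mul_zero] at this
    exact abs_eq_zero.1 (le_antisymm this (abs_nonneg _))
  have E6 : ∀ x, 0 < x → E x = 0 := by
    intro x h0
    rcases le_or_gt x 1 with h1 | h1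
    · exact E5 x h0 h1
    have k := E5 (1 / x) (by positivity) (by rw [div_le_one h0]; exact h1.le)
    simp only [E, one_div_one_div] at k ⊢
    have k6 : x ^ e * B (1 / x) = - B x := by
      simp only [hBdef]
      rw [← sw x 1, he, ← AA_smul]; congr 1 <;> field_simp
    have k7 : x ^ e * (1 / x) ^ e = 1 := by rw [← mul_pow]; field_simp; simp
    linear_combination (-x ^ e) * k + k6 - θ x * k7
  intro x hx
  have : ∀ x, 0 < x → AA m a x 1 = x ^ e * θ (1 / x) - θ x := by
    intro x hx
    have := E6 x hx
    simp only [E, hBdef] at this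
    linarith
  rcases lt_or_gt_of_ne hx with h | h
  · have := this (-x) (by linarith)
    rw [AA_neg_left, hev, (show 1 / (-x) = -(1/x) by rw [div_neg]), hev, Even.neg_pow ⟨m, by omega⟩] at this
    exact this
  · exact this x h


/-- positive quadruples `(c₁,c₂,d₁,d₂)` with `c₁ d₁ + c₂ d₂ = n`. -/
def Quad (n : ℕ) : Finset (ℕ × ℕ × ℕ × ℕ) :=
  ((Icc 1 n) ×ˢ (Icc 1 n) ×ˢ (Icc 1 n) ×ˢ (Icc 1 n)).filter
    fun p => p.1 * p.2.2.1 + p.2.1 * p.2.2.2 = n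

lemma mem_Quad (n a b c d : ℕ) : (a, b, c, d) ∈ Quad n ↔
    0 < a ∧ 0 < b ∧ 0 < c ∧ 0 < d ∧ a * c + b * d = n := by
  simp only [Quad, mem_filter, mem_product, mem_Icc]
  constructor
  · rintro ⟨⟨⟨h1, _⟩, ⟨h2, _⟩, ⟨h3, _⟩, ⟨h4, _⟩⟩, h⟩
    exact ⟨h1, h2, h3, h4, h⟩
  · rintro ⟨h1, h2, h3, h4, h⟩
    have e1 := Nat.le_mul_of_pos_right a h3
    have e2 := Nat.le_mul_of_pos_left c h1
    have e3 := Nat.le_mul_of_pos_right b h4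
    have e4 := Nat.le_mul_of_pos_left d h2
    refine ⟨⟨⟨h1, ?_⟩, ⟨h2, ?_⟩, ⟨h3, ?_⟩, ⟨h4, ?_⟩⟩, h⟩ <;> omega

lemma quad_B1 (n : ℕ) (f : ℕ → ℕ → ℝ) :
    ∑ p ∈ (Quad n).filter (fun p => p.2.2.1 < p.2.2.2), f (p.1 + p.2.1) p.2.1 =
    ∑ p ∈ (Quad n).filter (fun p => p.2.1 < p.1), f p.1 p.2.1 := by
  refine sum_nbij' (fun p => (p.1 + p.2.1, p.2.1, p.2.2.1, p.2.2.2 - p.2.2.1))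
    (fun p => (p.1 - p.2.1, p.2.1, p.2.2.1, p.2.2.1 + p.2.2.2)) ?_ ?_ ?_ ?_ ?_
  · rintro ⟨a, b, c, d⟩ h
    simp only [mem_filter, mem_Quad] at h ⊢
    obtain ⟨⟨h1, h2, h3, h4, h5⟩, h6⟩ := h
    obtain ⟨x, rfl⟩ := Nat.exists_eq_add_of_lt h6
    refine ⟨⟨by omega, by omega, by omega, by omega, ?_⟩, by omega⟩
    rw [← h5, show c + x + 1 - c = x + 1 by omega]; ring
  · rintro ⟨a, b, c, d⟩ h
    simp only [mem_filter, mem_Quad] at h ⊢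
    obtain ⟨⟨h1, h2, h3, h4, h5⟩, h6⟩ := h
    obtain ⟨x, rfl⟩ := Nat.exists_eq_add_of_lt h6
    refine ⟨⟨by omega, by omega, by omega, by omega, ?_⟩, by omega⟩
    rw [← h5, show b + x + 1 - b = x + 1 by omega]; ring
  · rintro ⟨a, b, c, d⟩ h
    simp only [mem_filter] at h
    simp; omega
  · rintro ⟨a, b, c, d⟩ h
    simp only [mem_filter] at h
    simp; omega
  · intros; rfl

lemma quad_B2 (n : ℕ) (f : ℕ → ℕ → ℝ) :
    ∑ p ∈ (Quad n).filter (fun p => p.2.2.1 < p.2.2.2 ∧ p.2.1 < p.1), f (p.1 - p.2.1) p.2.1 =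
    ∑ p ∈ (Quad n).filter (fun p => 2 * p.2.2.1 < p.2.2.2), f p.1 p.2.1 := by
  refine sum_nbij' (fun p => (p.1 - p.2.1, p.2.1, p.2.2.1, p.2.2.1 + p.2.2.2))
    (fun p => (p.1 + p.2.1, p.2.1, p.2.2.1, p.2.2.2 - p.2.2.1)) ?_ ?_ ?_ ?_ ?_
  · rintro ⟨a, b, c, d⟩ h
    simp only [mem_filter, mem_Quad] at h ⊢
    obtain ⟨⟨h1, h2, h3, h4, h5⟩, h6, h7⟩ := h
    obtain ⟨x, rfl⟩ := Nat.exists_eq_add_of_lt h7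
    refine ⟨⟨by omega, by omega, by omega, by omega, ?_⟩, by omega⟩
    rw [← h5, show b + x + 1 - b = x + 1 by omega]; ring
  · rintro ⟨a, b, c, d⟩ h
    simp only [mem_filter, mem_Quad] at h ⊢
    obtain ⟨⟨h1, h2, h3, h4, h5⟩, h6⟩ := h
    obtain ⟨x, rfl⟩ := Nat.exists_eq_add_of_lt h6
    refine ⟨⟨by omega, by omega, by omega, by omega, ?_⟩, by omega, by omega⟩
    rw [← h5, show 2 * c + x + 1 - c = c + x + 1 by omega]; ring
  · rintro ⟨a, b, c, d⟩ h
    simp only [mem_filter] at h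
    simp; omega
  · rintro ⟨a, b, c, d⟩ h
    simp only [mem_filter] at h
    simp; omega
  · intros; rfl

lemma quad_B3 (n : ℕ) (f : ℕ → ℕ → ℝ) :
    ∑ p ∈ (Quad n).filter (fun p => p.2.2.1 < p.2.2.2 ∧ p.1 < p.2.1), f (p.2.1 - p.1) p.1 =
    ∑ p ∈ (Quad n).filter (fun p => p.2.2.1 < p.2.2.2 ∧ p.2.2.2 < 2 * p.2.2.1), f p.1 p.2.1 := by
  refine sum_nbij' (fun p => (p.2.1 - p.1, p.1, p.2.2.2, p.2.2.1 + p.2.2.2))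
    (fun p => (p.2.1, p.1 + p.2.1, p.2.2.2 - p.2.2.1, p.2.2.1)) ?_ ?_ ?_ ?_ ?_
  · rintro ⟨a, b, c, d⟩ h
    simp only [mem_filter, mem_Quad] at h ⊢
    obtain ⟨⟨h1, h2, h3, h4, h5⟩, h6, h7⟩ := h
    obtain ⟨x, rfl⟩ := Nat.exists_eq_add_of_lt h7
    refine ⟨⟨by omega, by omega, by omega, by omega, ?_⟩, by omega, by omega⟩
    rw [← h5, show a + x + 1 - a = x + 1 by omega]; ring
  · rintro ⟨a, b, c, d⟩ h
    simp only [mem_filter, mem_Quad] at h ⊢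
    obtain ⟨⟨h1, h2, h3, h4, h5⟩, h6, h7⟩ := h
    obtain ⟨x, rfl⟩ := Nat.exists_eq_add_of_lt h6
    refine ⟨⟨by omega, by omega, by omega, by omega, ?_⟩, by omega, by omega⟩
    rw [← h5, show c + x + 1 - c = x + 1 by omega]; ring
  · rintro ⟨a, b, c, d⟩ h
    simp only [mem_filter] at h
    simp; omega
  · rintro ⟨a, b, c, d⟩ h
    simp only [mem_filter] at h
    simp; omega
  · intros; rfl

lemma quad_B4 (n : ℕ) (f : ℕ → ℕ → ℝ) :
    ∑ p ∈ (Quad n).filter (fun p => p.1 < p.2.1), f p.1 (p.2.1 - p.1) =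
    ∑ p ∈ (Quad n).filter (fun p => p.2.2.2 < p.2.2.1), f p.1 p.2.1 := by
  refine sum_nbij' (fun p => (p.1, p.2.1 - p.1, p.2.2.1 + p.2.2.2, p.2.2.2))
    (fun p => (p.1, p.1 + p.2.1, p.2.2.1 - p.2.2.2, p.2.2.2)) ?_ ?_ ?_ ?_ ?_
  · rintro ⟨a, b, c, d⟩ h
    simp only [mem_filter, mem_Quad] at h ⊢
    obtain ⟨⟨h1, h2, h3, h4, h5⟩, h6⟩ := h
    obtain ⟨x, rfl⟩ := Nat.exists_eq_add_of_lt h6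
    refine ⟨⟨by omega, by omega, by omega, by omega, ?_⟩, by omega⟩
    rw [← h5, show a + x + 1 - a = x + 1 by omega]; ring
  · rintro ⟨a, b, c, d⟩ h
    simp only [mem_filter, mem_Quad] at h ⊢
    obtain ⟨⟨h1, h2, h3, h4, h5⟩, h6⟩ := h
    obtain ⟨x, rfl⟩ := Nat.exists_eq_add_of_lt h6
    refine ⟨⟨by omega, by omega, by omega, by omega, ?_⟩, by omega⟩
    rw [← h5, show d + x + 1 - d = x + 1 by omega]; ring
  · rintro ⟨a, b, c, d⟩ h
    simp only [mem_filter] at h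
    simp; omega
  · rintro ⟨a, b, c, d⟩ h
    simp only [mem_filter] at h
    simp; omega
  · intros; rfl

lemma quad_B5 (n : ℕ) (hn : 0 < n) (f : ℕ → ℝ) :
    ∑ p ∈ (Quad n).filter (fun p => p.1 = p.2.1), f p.1 =
    ∑ c ∈ n.divisors, ((n / c : ℕ) - 1 : ℝ) * f c := by
  have : ∑ c ∈ n.divisors, ((n / c : ℕ) - 1 : ℝ) * f c =
      ∑ c ∈ n.divisors, ∑ j ∈ Ioo 0 (n / c), f c := by
    refine sum_congr rfl fun c hc => ?_
    have h1 : 1 ≤ n / c := Nat.div_pos (Nat.divisor_le hc) (Nat.pos_of_mem_divisors hc)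
    rw [sum_const, nsmul_eq_mul, Nat.card_Ioo, Nat.cast_sub (by omega), Nat.cast_sub (by omega)]
    simp
  rw [this, sum_sigma']
  refine sum_nbij' (fun p => ⟨p.1, p.2.2.1⟩)
    (fun p => (p.1, p.1, p.2, n / p.1 - p.2)) ?_ ?_ ?_ ?_ ?_
  · rintro ⟨a, b, c, d⟩ h
    simp only [mem_filter, mem_Quad, mem_sigma, Nat.mem_divisors, mem_Ioo] at h ⊢
    obtain ⟨⟨h1, h2, h3, h4, h5⟩, rfl⟩ := h
    have h6 : n = a * (c + d) := by rw [← h5]; ring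
    refine ⟨⟨⟨_, h6⟩, by omega⟩, h3, ?_⟩
    rw [h6, Nat.mul_div_cancel_left _ h1]; omega
  · rintro ⟨a, c⟩ h
    simp only [mem_filter, mem_Quad, mem_sigma, Nat.mem_divisors, mem_Ioo] at h ⊢
    obtain ⟨⟨⟨x, rfl⟩, h2⟩, h3, h4⟩ := h
    have ha : 0 < a := Nat.pos_of_mul_pos_right hn
    rw [Nat.mul_div_cancel_left _ ha] at h4 ⊢
    refine ⟨⟨ha, ha, h3, by omega, ?_⟩, trivial⟩
    rw [← mul_add]; congr 1; omega
  · rintro ⟨a, b, c, d⟩ h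
    simp only [mem_filter, mem_Quad] at h
    obtain ⟨⟨h1, h2, h3, h4, h5⟩, rfl⟩ := h
    have h6 : n = a * (c + d) := by rw [← h5]; ring
    simp
    rw [h6, Nat.mul_div_cancel_left _ h1]; omega
  · rintro ⟨a, c⟩ h; rfl
  · intros; rfl

lemma quad_B6 (n : ℕ) (hn : 0 < n) (f : ℕ → ℕ → ℝ) :
    ∑ p ∈ (Quad n).filter (fun p => p.2.2.1 = p.2.2.2), f p.1 p.2.1 =
    ∑ N ∈ n.divisors, ∑ j ∈ Ioo 0 N, f j (N - j) := by
  rw [sum_sigma']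
  refine sum_nbij' (fun p => ⟨p.1 + p.2.1, p.1⟩)
    (fun p => (p.2, p.1 - p.2, n / p.1, n / p.1)) ?_ ?_ ?_ ?_ ?_
  · rintro ⟨a, b, c, d⟩ h
    simp only [mem_filter, mem_Quad, mem_sigma, Nat.mem_divisors, mem_Ioo] at h ⊢
    obtain ⟨⟨h1, h2, h3, h4, h5⟩, rfl⟩ := h
    refine ⟨⟨⟨c, by rw [← h5]; ring⟩, by omega⟩, h1, by omega⟩
  · rintro ⟨N, j⟩ h
    simp only [mem_filter, mem_Quad, mem_sigma, Nat.mem_divisors, mem_Ioo] at h ⊢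
    obtain ⟨⟨⟨x, rfl⟩, h2⟩, h3, h4⟩ := h
    have hN : 0 < N := by omega
    have hx : 0 < x := Nat.pos_of_mul_pos_left hn
    rw [Nat.mul_div_cancel_left _ hN]
    refine ⟨⟨h3, by omega, hx, hx, ?_⟩, trivial⟩
    rw [← add_mul]; congr 1; omega
  · rintro ⟨a, b, c, d⟩ h
    simp only [mem_filter, mem_Quad] at h
    obtain ⟨⟨h1, h2, h3, h4, h5⟩, rfl⟩ := h
    have h6 : n = (a + b) * c := by rw [← h5]; ring
    simp
    rw [h6, Nat.mul_div_cancel_left _ (by omega)]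
  · rintro ⟨N, j⟩ h
    simp only [mem_sigma, mem_Ioo] at h
    simp; omega
  · rintro ⟨a, b, c, d⟩ h
    simp

lemma quad_B7 (n : ℕ) (hn : 0 < n) (f : ℕ → ℕ → ℝ) :
    ∑ p ∈ (Quad n).filter (fun p => p.2.2.2 = 2 * p.2.2.1), f p.1 p.2.1 =
    ∑ N ∈ n.divisors, ∑ v ∈ (Ioo 0 N).filter (fun v => 2 * v < N), f (N - 2 * v) v := by
  rw [sum_sigma']
  refine sum_nbij' (fun p => ⟨p.1 + 2 * p.2.1, p.2.1⟩)
    (fun p => (p.1 - 2 * p.2, p.2, n / p.1, 2 * (n / p.1))) ?_ ?_ ?_ ?_ ?_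
  · rintro ⟨a, b, c, d⟩ h
    simp only [mem_filter, mem_Quad, mem_sigma, Nat.mem_divisors, mem_Ioo] at h ⊢
    obtain ⟨⟨h1, h2, h3, h4, h5⟩, rfl⟩ := h
    refine ⟨⟨⟨c, by rw [← h5]; ring⟩, by omega⟩, ⟨h2, by omega⟩, by omega⟩
  · rintro ⟨N, j⟩ h
    simp only [mem_filter, mem_Quad, mem_sigma, Nat.mem_divisors, mem_Ioo] at h ⊢
    obtain ⟨⟨⟨x, rfl⟩, h2⟩, ⟨h3, h4⟩, h5⟩ := h
    have hN : 0 < N := by omega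
    have hx : 0 < x := Nat.pos_of_mul_pos_left hn
    rw [Nat.mul_div_cancel_left _ hN]
    refine ⟨⟨by omega, by omega, hx, by omega, ?_⟩, trivial⟩
    obtain ⟨y, rfl⟩ := Nat.exists_eq_add_of_lt h5
    rw [show 2 * j + y + 1 - 2 * j = y + 1 by omega]; ring
  · rintro ⟨a, b, c, d⟩ h
    simp only [mem_filter, mem_Quad] at h
    obtain ⟨⟨h1, h2, h3, h4, h5⟩, rfl⟩ := h
    have h6 : n = (a + 2 * b) * c := by rw [← h5]; ring
    simp
    rw [h6, Nat.mul_div_cancel_left _ (by omega)]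
  · rintro ⟨N, j⟩ h
    simp only [mem_sigma, mem_Ioo, mem_filter] at h
    simp; omega
  · rintro ⟨a, b, c, d⟩ h
    simp

/-- combinatorial identity -/
theorem quad_comb (n : ℕ) (hn : 0 < n) (F : ℕ → ℕ → ℝ) (P : ℕ → ℕ → ℝ)
    (hper : ∀ u v, 0 < u → F u (v + u) = F u v)
    (hP1 : ∀ x y, 0 < x → 0 < y → y < x → 2 * P x y = 2 * F x y - F (x + y) y - F (x - y) y)
    (hP2 : ∀ x y, 0 < x → 0 < y → x < y → 2 * P x y = 2 * F x y - F (x + y) y - F (y - x) x)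
    (hP3 : ∀ x, 0 < x → 2 * P x x = 2 * F x x - F (x + x) x) :
    2 * ∑ p ∈ (Quad n).filter (fun p => p.2.2.1 < p.2.2.2), P p.1 p.2.1 =
      ∑ c ∈ n.divisors, ((n / c : ℕ) - 1 : ℝ) * F c c
      - ∑ N ∈ n.divisors, ∑ j ∈ Ioo 0 N, F j (N - j)
      + ∑ N ∈ n.divisors, ∑ v ∈ (Ioo 0 N).filter (fun v => 2 * v < N), F (N - 2 * v) v := by
  rw [← quad_B5 n hn (fun c => F c c), ← quad_B6 n hn, ← quad_B7 n hn]
  have b1 := quad_B1 n F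
  have b2 := quad_B2 n F
  have b3 := quad_B3 n F
  have b4 := quad_B4 n F
  have hpos : ∀ p ∈ Quad n, 0 < p.1 ∧ 0 < p.2.1 := by
    rintro ⟨a, b, c, d⟩ h
    rw [mem_Quad] at h; exact ⟨h.1, h.2.1⟩
  have b4' : ∑ p ∈ (Quad n).filter (fun p => p.1 < p.2.1), F p.1 (p.2.1 - p.1) =
      ∑ p ∈ (Quad n).filter (fun p => p.1 < p.2.1), F p.1 p.2.1 := by
    refine sum_congr rfl fun p hp => ?_
    rw [mem_filter] at hp
    rw [← hper _ _ (hpos p hp.1).1, Nat.sub_add_cancel hp.2.le]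
  rw [b4'] at b4
  simp only [sum_filter] at *
  have h0 : ∀ p ∈ Quad n, 2 * (if p.2.2.1 < p.2.2.2 then P p.1 p.2.1 else 0) =
      2 * (if p.2.2.1 < p.2.2.2 then F p.1 p.2.1 else 0)
      - (if p.2.2.1 < p.2.2.2 then F (p.1 + p.2.1) p.2.1 else 0)
      - (if p.2.2.1 < p.2.2.2 ∧ p.2.1 < p.1 then F (p.1 - p.2.1) p.2.1 else 0)
      - (if p.2.2.1 < p.2.2.2 ∧ p.1 < p.2.1 then F (p.2.1 - p.1) p.1 else 0) := by
    rintro ⟨a, b, c, d⟩ h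
    obtain ⟨h1, h2⟩ := hpos _ h
    simp only at h1 h2 ⊢
    by_cases hcd : c < d
    · simp only [hcd, true_and, if_true]
      rcases lt_trichotomy a b with h | h | h
      · rw [if_neg (by omega), if_pos h, hP2 a b h1 h2 h]; ring
      · subst h; simp [hP3 a h1]
      · rw [if_pos h, if_neg (by omega), hP1 a b h1 h2 h]; ring
    · simp [hcd]
  have h1 : ∀ p ∈ Quad n, F p.1 p.2.1 = (if p.2.2.1 < p.2.2.2 then F p.1 p.2.1 else 0)
      + (if p.2.2.1 = p.2.2.2 then F p.1 p.2.1 else 0)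
      + (if p.2.2.2 < p.2.2.1 then F p.1 p.2.1 else 0) := by
    rintro ⟨a, b, c, d⟩ _
    rcases lt_trichotomy c d with h | h | h
    · simp [h, h.ne, h.not_gt]
    · simp [h]
    · simp [h, h.ne', h.not_gt]
  have h2 : ∀ p ∈ Quad n, F p.1 p.2.1 = (if p.1 < p.2.1 then F p.1 p.2.1 else 0)
      + (if p.1 = p.2.1 then F p.1 p.1 else 0)
      + (if p.2.1 < p.1 then F p.1 p.2.1 else 0) := by
    rintro ⟨a, b, c, d⟩ _
    rcases lt_trichotomy a b with h | h | h
    · simp [h, h.ne, h.not_gt]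
    · simp [h]
    · simp [h, h.ne', h.not_gt]
  have h3 : ∀ p ∈ Quad n, (if p.2.2.1 < p.2.2.2 then F p.1 p.2.1 else 0) =
      (if 2 * p.2.2.1 < p.2.2.2 then F p.1 p.2.1 else 0)
      + (if p.2.2.1 < p.2.2.2 ∧ p.2.2.2 < 2 * p.2.2.1 then F p.1 p.2.1 else 0)
      + (if p.2.2.2 = 2 * p.2.2.1 then F p.1 p.2.1 else 0) := by
    rintro ⟨a, b, c, d⟩ h
    rw [mem_Quad] at h
    simp only
    split_ifs <;> first | omega | simp
  have s0 := sum_congr rfl h0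
  have s1 := sum_congr rfl h1
  have s2 := sum_congr rfl h2
  have s3 := sum_congr rfl h3
  simp only [sum_add_distrib, sum_sub_distrib, ← mul_sum] at s0 s1 s2 s3
  linarith


/-- functions on `ℕ` given by polynomials of degree at most `d` -/
def PolyD (d : ℕ) (f : ℕ → ℝ) : Prop :=
  ∃ Q : Polynomial ℝ, Q.natDegree ≤ d ∧ ∀ N : ℕ, f N = Q.eval (N : ℝ)

lemma PolyD.add {d f g} (hf : PolyD d f) (hg : PolyD d g) : PolyD d (fun N => f N + g N) := by
  obtain ⟨Q, hQ, h⟩ := hf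
  obtain ⟨Q', hQ', h'⟩ := hg
  exact ⟨Q + Q', (Polynomial.natDegree_add_le _ _).trans (max_le hQ hQ'), fun N => by simp [h, h']⟩

lemma PolyD.const_mul {d f} (c : ℝ) (hf : PolyD d f) : PolyD d (fun N => c * f N) := by
  obtain ⟨Q, hQ, h⟩ := hf
  exact ⟨Polynomial.C c * Q, (Polynomial.natDegree_C_mul_le _ _).trans hQ, fun N => by simp [h]⟩

lemma PolyD.sub {d f g} (hf : PolyD d f) (hg : PolyD d g) : PolyD d (fun N => f N - g N) := by
  have := hf.add (hg.const_mul (-1))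
  convert this using 2; ring

lemma PolyD.sum {d : ℕ} {ι : Type} (s : Finset ι) (f : ι → ℕ → ℝ) (h : ∀ i ∈ s, PolyD d (f i)) :
    PolyD d (fun N => ∑ i ∈ s, f i N) := by
  classical
  induction s using Finset.induction_on with
  | empty => exact ⟨0, by simp, by simp⟩
  | insert i s hi ih =>
    simp only [sum_insert hi]
    exact (h i (mem_insert_self _ _)).add (ih fun j hj => h j (mem_insert_of_mem hj))

lemma PolyD.pow {d j : ℕ} (h : j ≤ d) : PolyD d (fun N => (N : ℝ) ^ j) :=
  ⟨Polynomial.X ^ j, by simpa using h, by simp⟩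

lemma PolyD.mono {d d' f} (h : d ≤ d') (hf : PolyD d f) : PolyD d' f := by
  obtain ⟨Q, hQ, hh⟩ := hf
  exact ⟨Q, hQ.trans h, hh⟩

lemma PolyD.mul_pow {d f} (j : ℕ) (hf : PolyD d f) : PolyD (d + j) (fun N => (N : ℝ) ^ j * f N) := by
  obtain ⟨Q, hQ, hh⟩ := hf
  refine ⟨Polynomial.X ^ j * Q, ?_, fun N => by simp [hh]⟩
  refine Polynomial.natDegree_mul_le.trans ?_
  simp; omega

lemma PolyD.sum_pow (j : ℕ) : PolyD (j + 1) (fun N => ∑ v ∈ range N, (v : ℝ) ^ j) := by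
  have : (fun N : ℕ => ∑ v ∈ range N, (v : ℝ) ^ j) = fun N : ℕ => ∑ i ∈ range (j + 1),
      (((bernoulli i * (j + 1).choose i / (j + 1) : ℚ)) : ℝ) * (N : ℝ) ^ (j + 1 - i) := by
    ext N
    have := sum_range_pow N j
    have h2 : ((∑ v ∈ range N, (v : ℚ) ^ j : ℚ) : ℝ) = ∑ v ∈ range N, (v : ℝ) ^ j := by push_cast; rfl
    rw [← h2, this]
    push_cast
    refine sum_congr rfl fun i _ => ?_
    ring
  rw [this]
  exact PolyD.sum _ _ fun i _ => (PolyD.pow (by omega)).const_mul _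

/-- the mixed polynomial sum -/
lemma PolyD.sum_PP (m : ℕ) (a : ℕ → ℝ) (α β γ δ : ℝ) :
    PolyD (2 * m + 1) (fun N => ∑ v ∈ range N, PP m a (α * N + β * v) (γ * N + δ * v)) := by
  have : (fun N : ℕ => ∑ v ∈ range N, PP m a (α * N + β * v) (γ * N + δ * v)) =
      fun N : ℕ => ∑ j ∈ range (m + 1), ∑ s ∈ range (2 * j + 1), ∑ t ∈ range (2 * (m - j) + 1),
        (a j * (2 * j).choose s * (2 * (m - j)).choose t * α ^ s * β ^ (2 * j - s) * γ ^ t *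
          δ ^ (2 * (m - j) - t)) * ((N : ℝ) ^ (s + t) *
          ∑ v ∈ range N, (v : ℝ) ^ (2 * j - s + (2 * (m - j) - t))) := by
    ext N
    unfold PP
    rw [sum_comm]
    refine sum_congr rfl fun j _ => ?_
    simp only [mul_sum]
    symm
    refine (sum_congr rfl fun s _ => sum_comm).trans (sum_comm.trans ?_)
    · refine sum_congr rfl fun v _ => ?_
      rw [add_pow, add_pow, mul_assoc, sum_mul_sum, mul_sum]
      refine sum_congr rfl fun s _ => ?_
      rw [mul_sum]
      refine sum_congr rfl fun t _ => ?_
      simp only [pow_add]; ring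
  rw [this]
  refine PolyD.sum _ _ fun j hj => PolyD.sum _ _ fun s hs => PolyD.sum _ _ fun t ht =>
    PolyD.const_mul _ ?_
  simp only [mem_range] at hj hs ht
  refine PolyD.mono ?_ (PolyD.mul_pow (s + t) (PolyD.sum_pow _))
  omega

lemma sum_divisors_zero (f : ℕ → ℝ) (h : ∀ n, 0 < n → ∑ d ∈ n.divisors, f d = 0) :
    ∀ n, 0 < n → f n = 0 := by
  intro n
  induction n using Nat.strong_induction_on with
  | _ n ih =>
    intro hn
    have h1 := h n hn
    rw [← Nat.cons_self_properDivisors hn.ne', sum_cons] at h1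
    rw [sum_eq_zero, add_zero] at h1
    · exact h1
    · intro d hd
      rw [Nat.mem_properDivisors] at hd
      exact ih d hd.2 (Nat.pos_of_dvd_of_pos hd.1 hn)

/-- Riemann-type sums -/
def RN (θ : ℝ → ℝ) (N : ℕ) : ℝ := ∑ j ∈ range N, θ ((j : ℝ) / N)

/-- real divisor sums -/
def sg (h n : ℕ) : ℝ := ∑ d ∈ n.divisors, (d : ℝ) ^ h

/-- the main double divisor-type sum -/
def SS (m : ℕ) (a : ℕ → ℝ) (n : ℕ) : ℝ :=
  ∑ p ∈ (Quad n).filter (fun p => p.2.2.1 < p.2.2.2), PP m a (p.1 : ℝ) (p.2.1 : ℝ)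

/-- polynomial part -/
def qN (m : ℕ) (a : ℕ → ℝ) (N : ℕ) : ℝ :=
  ∑ v ∈ Ioo 0 N, (AA m a ((N : ℝ) - 2 * v) v - AA m a v N)

lemma range_Ioo (N : ℕ) (hN : 0 < N) (f : ℕ → ℝ) : ∑ v ∈ range N, f v = f 0 + ∑ v ∈ Ioo 0 N, f v := by
  rw [← Nat.Ico_zero_eq_range, ← Ioo_insert_left hN, sum_insert (by simp)]

theorem SS_formula (m : ℕ) (hm : 2 ≤ m) (a : ℕ → ℝ) (θ : ℝ → ℝ) (hc : Continuous θ)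
    (h : ∀ x y, 2 * PP m a x y = AA m a x (x + y) + AA m a x (x - y))
    (hev : ∀ x, θ (-x) = θ x) (hper : ∀ x, θ (x + 1) = θ x)
    (hA : ∀ x, x ≠ 0 → AA m a x 1 = x ^ (2 * m) * θ (1 / x) - θ x) (n : ℕ) (hn : 0 < n) :
    2 * SS m a n = θ 0 * (n * sg (2 * m - 1) n) +
      ∑ N ∈ n.divisors, (-(1 / 2) * θ 0 * (N : ℝ) ^ (2 * m) - 1 / 2 * ((N : ℝ) ^ (2 * m) * RN θ N)
        + 1 / 2 * qN m a N) := by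
  set e := 2 * m with he
  have he0 : e ≠ 0 := by omega
  let F : ℝ → ℝ → ℝ := fun u v => u ^ e * θ (v / u)
  have F0 : ∀ v, F 0 v = 0 := by intro v; simp [F, he0]
  have hA0 : AA m a 0 1 = - θ 0 := by
    have h1 : Filter.Tendsto (fun x : ℝ => θ x + AA m a x 1) (nhdsWithin 0 {0}ᶜ) (nhds (θ 0 + AA m a 0 1)) := by
      have : Continuous (fun x : ℝ => θ x + AA m a x 1) := by
        unfold AA PP; fun_prop
      exact (this.tendsto 0).mono_left nhdsWithin_le_nhds
    have hb : ∃ M, ∀ x, |θ x| ≤ M := by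
      obtain ⟨M, hM⟩ := (isCompact_Icc (a := (0:ℝ)) (b := 1)).exists_bound_of_continuousOn hc.continuousOn
      refine ⟨M, fun x => ?_⟩
      have : θ x = θ (Int.fract x) := by
        have hp : Function.Periodic θ 1 := hper
        have := hp.sub_int_mul_eq ⌊x⌋ (x := x)
        rw [mul_one, Int.self_sub_floor] at this
        exact this.symm
      rw [this]
      exact hM _ ⟨Int.fract_nonneg x, (Int.fract_lt_one x).le⟩
    obtain ⟨M, hM⟩ := hb
    have h2 : Filter.Tendsto (fun x : ℝ => θ x + AA m a x 1) (nhdsWithin 0 {0}ᶜ) (nhds 0) := by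
      have hx : Filter.Tendsto (fun x : ℝ => |x| ^ e * M) (nhdsWithin 0 {0}ᶜ) (nhds 0) := by
        have : Continuous (fun x : ℝ => |x| ^ e * M) := by fun_prop
        have h0 := (this.tendsto 0).mono_left (nhdsWithin_le_nhds (s := {0}ᶜ))
        simpa [he0] using h0
      refine squeeze_zero_norm' ?_ hx
      filter_upwards [self_mem_nhdsWithin] with x hx
      rw [hA x hx, add_sub_cancel, norm_mul, norm_pow, Real.norm_eq_abs, Real.norm_eq_abs]
      gcongr; exact hM _
    have := tendsto_nhds_unique h1 h2
    linarith
  have Fper : ∀ u v, F u (v + u) = F u v := by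
    intro u v
    by_cases hu : u = 0
    · simp [hu, F0]
    · simp only [F]; rw [add_div, div_self hu, hper]
  have Fev : ∀ u v, F u (-v) = F u v := by
    intro u v; simp only [F]; rw [neg_div, hev]
  have Fevl : ∀ u v, F (-u) v = F u v := by
    intro u v; simp only [F]; rw [div_neg, hev, Even.neg_pow ⟨m, by omega⟩]
  have Fself : ∀ u, F u u = u ^ e * θ 0 := by
    intro u
    by_cases hu : u = 0
    · simp [hu, F, he0]
    · simp only [F]; rw [div_self hu]; congr 1
      have := hper 0; rw [zero_add] at this; exact this
  -- `A (x, y) = F x y - F y x`, all x, y ≠ 0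
  have AF : ∀ x y, y ≠ 0 → x ≠ 0 → AA m a x y = F x y - F y x := by
    intro x y hy hx
    have := AA_smul m a y (x / y) 1
    rw [mul_div_cancel₀ _ hy, mul_one] at this
    rw [this, hA _ (div_ne_zero hx hy)]
    simp only [F, one_div_div]
    rw [mul_sub, ← mul_assoc, ← mul_pow, mul_div_cancel₀ _ hy]
  have A0 : ∀ y, AA m a 0 y = - (y ^ e * θ 0) := by
    intro y
    have := AA_smul m a y 0 1
    rw [mul_zero, mul_one, hA0] at this
    rw [this]; ring
  have A0' : ∀ x, AA m a x 0 = x ^ e * θ 0 := by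
    intro x; rw [AA_swap, A0]; ring
  have AF1 : ∀ x y, 0 < x → 0 < y → AA m a x (x + y) = F x y - F (x + y) y := by
    intro x y hx hy
    rw [AF _ _ (by linarith) hx.ne', add_comm x y, Fper]
    congr 1
    rw [← Fev, ← Fper]; congr 1; ring
  have AF2 : ∀ x y, 0 < x → 0 < y → x ≠ y → AA m a x (x - y) = F x y - F (x - y) y := by
    intro x y hx hy hxy
    rw [AF _ _ (sub_ne_zero.2 hxy) hx.ne']
    congr 1
    · rw [← Fev, ← Fper x, show -(x - y) + x = y by ring]
    · rw [← Fper (x - y) y]; congr 1; ring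
  have key := quad_comb n hn (fun u v => F u v) (fun x y => PP m a x y)
    (by intro u v _; push_cast; exact Fper u v)
    (by
      intro x y hx hy hxy
      have hx' : (0:ℝ) < x := by exact_mod_cast hx
      have hy' : (0:ℝ) < y := by exact_mod_cast hy
      have hne : (x:ℝ) ≠ y := by exact_mod_cast hxy.ne'
      rw [h, AF1 _ _ hx' hy', AF2 _ _ hx' hy' hne, Nat.cast_sub hxy.le]
      push_cast; ring)
    (by
      intro x y hx hy hxy
      have hx' : (0:ℝ) < x := by exact_mod_cast hx
      have hy' : (0:ℝ) < y := by exact_mod_cast hy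
      have hne : (x:ℝ) ≠ y := by exact_mod_cast hxy.ne
      rw [h, AF1 _ _ hx' hy', AF2 _ _ hx' hy' hne, Nat.cast_sub hxy.le]
      have : F ((x:ℝ) - y) y = F (y - x) x := by
        rw [← Fevl, neg_sub, ← Fper (y - x : ℝ) x, add_sub_cancel]
      rw [this]
      push_cast; ring)
    (by
      intro x hx
      have hx' : (0:ℝ) < x := by exact_mod_cast hx
      rw [h, AF1 _ _ hx' hx', sub_self, A0', Fself]
      push_cast; ring)
  unfold SS
  rw [key]
  have t1 : ∑ c ∈ n.divisors, ((n / c : ℕ) - 1 : ℝ) * F c c =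
      θ 0 * (n * sg (e - 1) n) - ∑ N ∈ n.divisors, θ 0 * (N : ℝ) ^ e := by
    unfold sg
    rw [mul_sum, mul_sum, ← sum_sub_distrib]
    refine sum_congr rfl fun c hc => ?_
    have hc0 : (c : ℝ) ≠ 0 := by
      have := Nat.pos_of_mem_divisors hc; positivity
    rw [Fself, Nat.cast_div (Nat.dvd_of_mem_divisors hc) hc0]
    have : (c : ℝ) ^ e = c ^ (e - 1) * c := by rw [← pow_succ]; congr 1; omega
    rw [this]; field_simp
  have sumF : ∀ N : ℕ, 0 < N → ∑ v ∈ Ioo 0 N, F N v = (N : ℝ) ^ e * RN θ N - (N : ℝ) ^ e * θ 0 := by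
    intro N hN
    unfold RN
    rw [range_Ioo N hN, mul_add, mul_sum]
    simp [F]
  have t2 : ∀ N : ℕ, 0 < N → ∑ j ∈ Ioo 0 N, F j (N - j : ℕ) =
      ∑ j ∈ Ioo 0 N, AA m a j N + ∑ v ∈ Ioo 0 N, F N v := by
    intro N hN
    rw [← sum_add_distrib]
    refine sum_congr rfl fun j hj => ?_
    rw [mem_Ioo] at hj
    have hN' : (N : ℝ) ≠ 0 := by positivity
    have hj' : (j : ℝ) ≠ 0 := by have := hj.1; positivity
    rw [AF _ _ hN' hj', Nat.cast_sub hj.2.le, ← Fper (j : ℝ) (N - j), sub_add_cancel]; ring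
  have t3 : ∀ N : ℕ, 0 < N → 2 * ∑ v ∈ (Ioo 0 N).filter (fun v => 2 * v < N), F (N - 2 * v : ℕ) v =
      ∑ v ∈ Ioo 0 N, (AA m a ((N : ℝ) - 2 * v) v + AA m a v N + F N v) := by
    intro N hN
    have hN' : (N : ℝ) ≠ 0 := by positivity
    have g1 : ∀ v ∈ Ioo 0 N, AA m a ((N : ℝ) - 2 * v) v + AA m a v N + F N v = F ((N : ℝ) - 2 * v) v := by
      intro v hv
      rw [mem_Ioo] at hv
      have hv' : (v : ℝ) ≠ 0 := by have := hv.1; positivity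
      rw [AF v N hN' hv']
      have e1 : F v N = F v ((N : ℝ) - 2 * v) := by
        rw [← Fper v ((N:ℝ) - 2 * v), ← Fper v ((N:ℝ) - 2 * v + v)]; congr 1; ring
      by_cases h2 : (N : ℝ) - 2 * v = 0
      · rw [e1, h2, A0, F0]
        simp [F]
        try ring
      · rw [AF _ _ hv' h2, e1]; ring
    rw [sum_congr rfl g1]
    have g2 : ∑ v ∈ (Ioo 0 N).filter (fun v => 2 * v < N), F (N - 2 * v : ℕ) v =
        ∑ v ∈ (Ioo 0 N).filter (fun v => 2 * v < N), F ((N : ℝ) - 2 * v) v := by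
      refine sum_congr rfl fun v hv => ?_
      rw [mem_filter] at hv
      rw [Nat.cast_sub hv.2.le]; push_cast; rfl
    have g3 : ∑ v ∈ (Ioo 0 N).filter (fun v => 2 * v < N), F ((N : ℝ) - 2 * v) v =
        ∑ v ∈ (Ioo 0 N).filter (fun v => N < 2 * v), F ((N : ℝ) - 2 * v) v := by
      refine sum_nbij' (fun v => N - v) (fun v => N - v) ?_ ?_ ?_ ?_ ?_
      · intro v hv; simp only [mem_filter, mem_Ioo] at hv ⊢; omega
      · intro v hv; simp only [mem_filter, mem_Ioo] at hv ⊢; omega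
      · intro v hv; simp only [mem_filter, mem_Ioo] at hv ⊢; omega
      · intro v hv; simp only [mem_filter, mem_Ioo] at hv ⊢; omega
      · intro v hv; simp only [mem_filter, mem_Ioo] at hv
        rw [Nat.cast_sub (by omega)]
        rw [show (N : ℝ) - 2 * (N - v) = -(N - 2 * v) by ring, Fevl, ← Fper (N - 2 * v : ℝ) v]
        congr 1; ring
    have g4 : ∀ v ∈ Ioo 0 N, F ((N : ℝ) - 2 * v) v =
        (if 2 * v < N then F ((N : ℝ) - 2 * v) v else 0) +
        (if N < 2 * v then F ((N : ℝ) - 2 * v) v else 0) := by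
      intro v _
      rcases lt_trichotomy (2 * v) N with h | h | h
      · simp [h, h.not_gt]
      · have : (N : ℝ) - 2 * v = 0 := by rw [← h]; push_cast; ring
        simp [h, this, F0]
      · simp [h, h.not_gt]
    rw [sum_congr rfl g4, sum_add_distrib, ← sum_filter, ← sum_filter, ← g3, g2]; ring
  have t4 : ∀ N ∈ n.divisors, -(1 / 2) * θ 0 * (N : ℝ) ^ e - 1 / 2 * ((N : ℝ) ^ e * RN θ N)
        + 1 / 2 * qN m a N = - (θ 0 * (N : ℝ) ^ e) - ∑ j ∈ Ioo 0 N, F j (N - j : ℕ) +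
        ∑ v ∈ (Ioo 0 N).filter (fun v => 2 * v < N), F (N - 2 * v : ℕ) v := by
    intro N hN
    have hN' := Nat.pos_of_mem_divisors hN
    have e1 := sumF N hN'
    have e2 := t2 N hN'
    have e3 := t3 N hN'
    simp only [sum_add_distrib] at e3
    unfold qN
    rw [sum_sub_distrib]
    linarith
  rw [t1, sum_congr rfl t4, sum_add_distrib, sum_sub_distrib, sum_neg_distrib]
  ring

lemma qN_poly (m : ℕ) (hm : 1 ≤ m) (a : ℕ → ℝ) : ∃ g, PolyD (2 * m + 1) g ∧ ∀ N, 0 < N → qN m a N = g N := by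
  refine ⟨fun N => (∑ v ∈ range N, PP m a (1 * N + (-2) * v) (0 * N + 1 * v)
    - ∑ v ∈ range N, PP m a (0 * N + 1 * v) (1 * N + (-2) * v))
    - (∑ v ∈ range N, PP m a (0 * N + 1 * v) (1 * N + 0 * v)
    - ∑ v ∈ range N, PP m a (1 * N + 0 * v) (0 * N + 1 * v)) - (2 * AA m a 1 0) * (N : ℝ) ^ (2 * m),
    ((((PolyD.sum_PP m a _ _ _ _).sub (PolyD.sum_PP m a _ _ _ _)).sub
      ((PolyD.sum_PP m a _ _ _ _).sub (PolyD.sum_PP m a _ _ _ _)))).sub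
      ((PolyD.pow (by omega)).const_mul _), ?_⟩
  intro N hN
  beta_reduce
  rw [← sum_sub_distrib, ← sum_sub_distrib, ← sum_sub_distrib, range_Ioo N hN]
  have h1 := AA_smul m a N 1 0
  rw [mul_one, mul_zero] at h1
  unfold qN
  have h2 : ∑ v ∈ Ioo 0 N, (PP m a (1 * (N:ℝ) + (-2) * v) (0 * N + 1 * v)
    - PP m a (0 * N + 1 * v) (1 * N + (-2) * v) - (PP m a (0 * N + 1 * v) (1 * N + 0 * v)
    - PP m a (1 * N + 0 * v) (0 * N + 1 * v))) =
      ∑ v ∈ Ioo 0 N, (AA m a ((N : ℝ) - 2 * v) v - AA m a v N) := by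
    refine sum_congr rfl fun v _ => ?_
    unfold AA
    ring_nf
  rw [h2]
  simp only [Nat.cast_zero, mul_zero, add_zero, zero_mul, one_mul]
  have h3 : AA m a N 0 = PP m a N 0 - PP m a 0 N := rfl
  linarith

theorem RN_poly (m : ℕ) (hm : 2 ≤ m) (a : ℕ → ℝ) (θ : ℝ → ℝ) (hc : Continuous θ)
    (h : ∀ x y, 2 * PP m a x y = AA m a x (x + y) + AA m a x (x - y))
    (hev : ∀ x, θ (-x) = θ x) (hper : ∀ x, θ (x + 1) = θ x)
    (hA : ∀ x, x ≠ 0 → AA m a x 1 = x ^ (2 * m) * θ (1 / x) - θ x)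
    (α : ℕ → ℝ) (β : ℝ) (H : ∀ n : ℕ, 0 < n →
      SS m a n + ∑ h ∈ range (2 * m + 2), α h * sg h n + β * (n * sg (2 * m - 1) n) = 0)
    (w : ℕ → ℝ) (hw : ∀ n : ℕ, 0 < n → ∑ d ∈ n.divisors, w d = n * sg (2 * m - 1) n) :
    ∃ (Q : Polynomial ℝ) (b : ℝ), Q.natDegree ≤ 2 * m + 1 ∧ ∀ N : ℕ, 0 < N →
      (N : ℝ) ^ (2 * m) * RN θ N = Q.eval (N : ℝ) + b * w N := by
  obtain ⟨g, hg, hgN⟩ := qN_poly m (by omega) a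
  have hpoly : PolyD (2 * m + 1) (fun N => g N + (- θ 0) * (N : ℝ) ^ (2 * m) +
      4 * ∑ h ∈ range (2 * m + 2), α h * (N : ℝ) ^ h) := by
    refine (hg.add ((PolyD.pow (by omega)).const_mul _)).add (PolyD.const_mul _ (PolyD.sum _ _ ?_))
    intro i hi
    rw [mem_range] at hi
    exact (PolyD.pow (by omega)).const_mul _
  obtain ⟨Q, hQ, hQN⟩ := hpoly
  refine ⟨Q, 2 * (θ 0 + 2 * β), hQ, ?_⟩
  have key := sum_divisors_zero (fun N => (-(1 / 2) * θ 0 * (N : ℝ) ^ (2 * m)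
    - 1 / 2 * ((N : ℝ) ^ (2 * m) * RN θ N) + 1 / 2 * qN m a N)
    + 2 * ∑ h ∈ range (2 * m + 2), α h * (N : ℝ) ^ h + (θ 0 + 2 * β) * w N) ?_
  · intro N hN
    have := key N hN
    rw [← hQN]; beta_reduce; rw [← hgN N hN]
    linarith
  · intro n hn
    have h1 := SS_formula m hm a θ hc h hev hper hA n hn
    have h2 := H n hn
    have h3 : ∑ h ∈ range (2 * m + 2), α h * sg h n =
        ∑ N ∈ n.divisors, ∑ h ∈ range (2 * m + 2), α h * (N : ℝ) ^ h := by
      unfold sg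
      simp only [mul_sum]
      rw [sum_comm]
    rw [sum_add_distrib, sum_add_distrib, ← mul_sum, ← mul_sum, hw n hn, ← h3]
    linarith


open MeasureTheory AddCircle in
lemma fourier_sq_bound (f : C(AddCircle (1:ℝ), ℂ)) (L : ℝ)
    (hL : ∀ (x : AddCircle (1:ℝ)) (h : ℝ), ‖f (x + (h:AddCircle (1:ℝ))) - f (x - (h:AddCircle (1:ℝ)))‖ ≤ L * |h|) (M : ℕ) (hM : 0 < M) :
    ∑ n ∈ Finset.Icc (-(M:ℤ)) M, (n:ℝ)^2 * ‖fourierCoeff (⇑f) n‖^2 ≤ L^2 := by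
  have : Fact ((0:ℝ) < 1) := ⟨one_pos⟩
  have hM' : (0:ℝ) < M := by exact_mod_cast hM
  set h : ℝ := 1/(4*M) with hh
  have hpos : 0 < h := by positivity
  let g : C(AddCircle (1:ℝ), ℂ) :=
    ⟨fun x => f (x + (h:AddCircle (1:ℝ))) - f (x - (h:AddCircle (1:ℝ))), by fun_prop⟩
  have hL0 : 0 ≤ L * |h| := le_trans (norm_nonneg _) (hL 0 h)
  have hg : ∀ n : ℤ, fourierCoeff (⇑g) n = (2 * Complex.I * Real.sin (2*Real.pi*n*h)) * fourierCoeff (⇑f) n := by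
    intro n
    have key : ∀ y : ℝ, ∫ t : AddCircle (1:ℝ), fourier (-n) t • f (t + (y:AddCircle (1:ℝ))) ∂haarAddCircle
        = fourier n (y:AddCircle (1:ℝ)) * fourierCoeff (⇑f) n := by
      intro y
      rw [fourierCoeff, ← integral_const_mul]
      rw [← integral_add_right_eq_self _ (y:AddCircle (1:ℝ))]
      rw [← integral_sub_right_eq_self (fun t => fourier n (y:AddCircle (1:ℝ)) * fourier (-n) t • f t) (-(y:AddCircle (1:ℝ)))]
      rw [← integral_add_right_eq_self _ (-(y:AddCircle (1:ℝ)))]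
      congr 1; ext t
      have e1 : fourier n (y:AddCircle (1:ℝ)) * fourier (-n) (t + (y:AddCircle (1:ℝ))) = fourier (-n) t := by
        rw [fourier_apply, fourier_apply, fourier_apply, ← Circle.coe_mul, ← AddCircle.toCircle_add]
        congr 2
        simp
      simp only [smul_eq_mul, neg_add_cancel_right, sub_neg_eq_add]
      rw [← mul_assoc, e1]
    have k1 := key h
    have k2 := key (-h)
    have : fourierCoeff (⇑g) n = (fourier n (h:AddCircle (1:ℝ)) - fourier n ((-h:ℝ):AddCircle (1:ℝ))) * fourierCoeff (⇑f) n := by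
      rw [sub_mul, ← k1, ← k2, ← integral_sub]
      · rw [fourierCoeff]
        congr 1; ext t
        simp only [g, ContinuousMap.coe_mk, smul_eq_mul, AddCircle.coe_neg]
        rw [← sub_eq_add_neg]; ring
      · apply Continuous.integrable_of_hasCompactSupport (by fun_prop)
        exact HasCompactSupport.of_compactSpace _
      · apply Continuous.integrable_of_hasCompactSupport (by fun_prop)
        exact HasCompactSupport.of_compactSpace _
    rw [this]
    congr 1
    rw [fourier_coe_apply, fourier_coe_apply]
    push_cast
    rw [Complex.sin]
    have : 2 * (Real.pi:ℂ) * Complex.I * n * h / 1 = (2 * Real.pi * n * h) * Complex.I := by ring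
    rw [this]
    have : 2 * (Real.pi:ℂ) * Complex.I * n * (-h) / 1 = -(2 * Real.pi * n * h) * Complex.I := by ring
    rw [this]
    ring_nf
    rw [Complex.I_sq]; ring
  have hsum := hasSum_sq_fourierCoeff (ContinuousMap.toLp 2 haarAddCircle ℂ g)
  have hintg : ∫ t, ‖(ContinuousMap.toLp 2 haarAddCircle ℂ g) t‖^2 ∂haarAddCircle ≤ (L * |h|)^2 := by
    have e1 : ∫ t, ‖(ContinuousMap.toLp 2 haarAddCircle ℂ g) t‖^2 ∂haarAddCircle = ∫ t, ‖g t‖^2 ∂haarAddCircle := by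
      apply integral_congr_ae
      filter_upwards [ContinuousMap.coeFn_toLp (p := 2) (𝕜 := ℂ) haarAddCircle g] with t ht
      rw [ht]
    rw [e1]
    have : ∫ t, ‖g t‖^2 ∂haarAddCircle ≤ ∫ t : AddCircle (1:ℝ), (L * |h|)^2 ∂haarAddCircle := by
      apply integral_mono
      · apply Continuous.integrable_of_hasCompactSupport (by fun_prop)
        exact HasCompactSupport.of_compactSpace _
      · exact integrable_const _
      · intro t
        exact pow_le_pow_left₀ (norm_nonneg _) (hL t h) 2
    refine this.trans ?_
    simp
  have hfin : ∑ n ∈ Finset.Icc (-(M:ℤ)) M, ‖fourierCoeff (⇑g) n‖^2 ≤ (L*|h|)^2 := by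
    refine le_trans ?_ hintg
    have := sum_le_hasSum (Finset.Icc (-(M:ℤ)) M) (fun i _ => by positivity) hsum
    simp only [fourierCoeff_toLp] at this
    exact this
  have hstep : ∀ n ∈ Finset.Icc (-(M:ℤ)) M, h^2 * ((n:ℝ)^2 * ‖fourierCoeff (⇑f) n‖^2) ≤ ‖fourierCoeff (⇑g) n‖^2 := by
    intro n hn
    rw [Finset.mem_Icc] at hn
    have hn1 : |(n:ℝ)| ≤ M := by
      rw [abs_le]; constructor <;> [exact_mod_cast hn.1; exact_mod_cast hn.2]
    rw [hg, norm_mul, mul_pow, ← mul_assoc]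
    apply mul_le_mul_of_nonneg_right _ (by positivity)
    have e2 : ‖2 * Complex.I * (Real.sin (2*Real.pi*n*h):ℂ)‖ = 2 * |Real.sin (2*Real.pi*n*h)| := by
      rw [norm_mul, norm_mul, Complex.norm_real]; simp
    rw [e2]
    have e3 : |Real.sin (2*Real.pi*n*h)| = Real.sin (2*Real.pi*|(n:ℝ)| *h) := by
      rcases abs_cases (n:ℝ) with ⟨h1, h2⟩ | ⟨h1, h2⟩
      · rw [h1, abs_of_nonneg]
        apply Real.sin_nonneg_of_nonneg_of_le_pi (by positivity)
        have : (n:ℝ) * h ≤ 1/4 := by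
          rw [hh, mul_one_div, div_le_iff₀ (by positivity)]
          rw [h1] at hn1; linarith
        nlinarith [Real.pi_pos]
      · have h3 : Real.sin (2*Real.pi*n*h) = - Real.sin (2*Real.pi*|(n:ℝ)| *h) := by
          rw [h1, ← Real.sin_neg]; congr 1; ring
        rw [h3, abs_neg, abs_of_nonneg]
        apply Real.sin_nonneg_of_nonneg_of_le_pi (by positivity)
        have : |(n:ℝ)| * h ≤ 1/4 := by
          rw [hh, mul_one_div, div_le_iff₀ (by positivity)]
          linarith
        nlinarith [Real.pi_pos]
    have hb : |(n:ℝ)| * h ≤ 1/4 := by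
      rw [hh, mul_one_div, div_le_iff₀ (by positivity)]
      linarith
    have e4 := Real.mul_le_sin (x := 2*Real.pi*|(n:ℝ)| *h) (by positivity) (by nlinarith [Real.pi_pos])
    have e5 : 2 / Real.pi * (2*Real.pi*|(n:ℝ)| *h) = 4 * (|(n:ℝ)| *h) := by
      field_simp; ring
    rw [e3]
    rw [e5] at e4
    have e6 : h^2 * (n:ℝ)^2 = (|(n:ℝ)| *h)^2 := by rw [mul_pow, sq_abs]; ring
    rw [e6]
    have : 0 ≤ |(n:ℝ)| *h := by positivity
    apply pow_le_pow_left₀ this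
    linarith
  have := (Finset.sum_le_sum hstep).trans hfin
  rw [← Finset.mul_sum, mul_pow, sq_abs, mul_comm (L^2)] at this
  exact le_of_mul_le_mul_left this (by positivity)


open MeasureTheory AddCircle in
lemma fourier_exists (θ : ℝ → ℝ) (L : ℝ) (hL : ∀ x y, |θ x - θ y| ≤ L*|x-y|)
    (hev : ∀ x, θ (-x) = θ x) (hper : ∀ x, θ (x+1) = θ x) :
    ∃ A : ℕ → ℝ, Summable (fun n : ℕ => (n:ℝ)^2 * (A n)^2) ∧ Summable (fun n => |A n|) ∧
      ∀ x, HasSum (fun n : ℕ => A n * Real.cos (2*Real.pi*n*x)) (θ x) := by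
  have : Fact ((0:ℝ) < 1) := ⟨one_pos⟩
  have hL0 : 0 ≤ L := by
    have := hL 1 0; have h2 := abs_nonneg (θ 1 - θ 0); simp at this; linarith
  have hc : Continuous θ := by
    have : LipschitzWith (Real.toNNReal L) θ := by
      apply LipschitzWith.of_dist_le_mul
      intro x y
      rw [Real.dist_eq, Real.dist_eq, Real.coe_toNNReal _ hL0]; exact hL x y
    exact this.continuous
  have hp : Function.Periodic (fun x => (θ x : ℂ)) 1 := by intro x; simp [hper]
  let f : C(AddCircle (1:ℝ), ℂ) := ⟨hp.lift, by
    apply continuous_coinduced_dom.2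
    change Continuous (fun x : ℝ => (θ x : ℂ))
    fun_prop⟩
  have hfc : ∀ x : ℝ, f (x : AddCircle (1:ℝ)) = θ x := fun x => rfl
  have hfL : ∀ (x : AddCircle (1:ℝ)) (h : ℝ), ‖f (x + (h:AddCircle (1:ℝ))) - f (x - (h:AddCircle (1:ℝ)))‖ ≤ (2*L) * |h| := by
    intro x h
    induction x using QuotientAddGroup.induction_on with
    | H x =>
      have e1 : f ((x:AddCircle (1:ℝ)) + (h:AddCircle (1:ℝ))) = θ (x+h) := by
        rw [← hfc]; simp
      have e2 : f ((x:AddCircle (1:ℝ)) - (h:AddCircle (1:ℝ))) = θ (x-h) := by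
        rw [← hfc]; simp
      erw [e1, e2]
      rw [← Complex.ofReal_sub, Complex.norm_real, Real.norm_eq_abs]
      refine (hL _ _).trans ?_
      have : x + h - (x - h) = 2 * h := by ring
      rw [this, abs_mul, abs_two]; linarith
  have hb := fourier_sq_bound f (2*L) hfL
  set a := fourierCoeff (⇑f) with ha
  have hs2 : Summable (fun n : ℤ => (n:ℝ)^2 * ‖a n‖^2) := by
    apply summable_of_sum_le (c := (2*L)^2) (fun n => by positivity)
    intro u
    obtain ⟨M, hM, hu⟩ : ∃ M : ℕ, 0 < M ∧ u ⊆ Finset.Icc (-(M:ℤ)) M := by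
      refine ⟨(∑ n ∈ u, n.natAbs) + 1, by omega, ?_⟩
      intro n hn
      have := Finset.single_le_sum (f := fun n : ℤ => n.natAbs) (fun i _ => Nat.zero_le _) hn
      simp only [Finset.mem_Icc]
      omega
    exact (Finset.sum_le_sum_of_subset_of_nonneg hu (fun i _ _ => by positivity)).trans (hb M hM)
  have hs1 : Summable a := by
    have h1 : Summable (fun n : ℤ => 1/((n:ℝ)^2)) := Real.summable_one_div_int_pow.2 (by norm_num)
    have h2 := h1.add hs2
    have h3 : Summable (fun n : ℤ => if n = 0 then ‖a 0‖ else 0) := by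
      apply summable_of_ne_finset_zero (s := {0}); intro b hb; simp at hb; simp [hb]
    refine Summable.of_norm_bounded (h2.add h3) ?_
    intro n
    by_cases hn : n = 0
    · simp [hn]
    · simp only [hn, if_false, add_zero]
      have hn' : (0:ℝ) < (n:ℝ)^2 := by positivity
      have : 0 ≤ (1/|(n:ℝ)| - |(n:ℝ)| * ‖a n‖)^2 := sq_nonneg _
      have hne : |(n:ℝ)| ≠ 0 := by simp [hn]
      have e : (1/|(n:ℝ)| - |(n:ℝ)| * ‖a n‖)^2 = 1/(n:ℝ)^2 + (n:ℝ)^2*‖a n‖^2 - 2 * ‖a n‖ := by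
        rw [sub_sq, div_pow, mul_pow, sq_abs]; field_simp; ring
      have := norm_nonneg (a n)
      linarith
  have hpt := has_pointwise_sum_fourier_series_of_summable hs1
  have hcos : ∀ x : ℝ, HasSum (fun n : ℤ => (a n).re * Real.cos (2*Real.pi*n*x)) (θ x) := by
    intro x
    have h1 := hpt (x : AddCircle (1:ℝ))
    have h2 := hpt ((-x:ℝ) : AddCircle (1:ℝ))
    rw [hfc] at h1 h2
    rw [hev] at h2
    have h3 := ((h1.add h2).mul_left (1/2 : ℂ)).mapL Complex.reCLM
    simp only [Complex.reCLM_apply] at h3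
    have e0 : ((1/2:ℂ) * ((θ x:ℂ) + θ x)).re = θ x := by
      have : (1/2:ℂ) * ((θ x:ℂ) + θ x) = θ x := by ring
      rw [this]; simp
    rw [e0] at h3
    refine h3.congr_fun ?_
    intro n
    simp only [smul_eq_mul, fourier_coe_apply]
    have : (1/2:ℂ) * (a n * Complex.exp (2*Real.pi*Complex.I*n*x/(1:ℝ)) + a n * Complex.exp (2*Real.pi*Complex.I*n*(-x:ℝ)/(1:ℝ)))
      = a n * (Real.cos (2*Real.pi*n*x) : ℂ) := by
      push_cast
      rw [Complex.cos]
      have e1 : 2 * (Real.pi:ℂ) * Complex.I * n * x / 1 = (2 * Real.pi * n * x) * Complex.I := by ring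
      have e2 : 2 * (Real.pi:ℂ) * Complex.I * n * (-x) / 1 = -(2 * Real.pi * n * x) * Complex.I := by ring
      rw [e1, e2]; ring
    rw [this, Complex.re_mul_ofReal]
  have hinj1 : Function.Injective (fun n : ℕ => (n:ℤ)) := Nat.cast_injective
  have hinj2 : Function.Injective (fun n : ℕ => -(n:ℤ)) := fun x y h => by simpa using h
  refine ⟨fun n => if n = 0 then (a 0).re else (a n).re + (a (-n)).re, ?_, ?_, ?_⟩
  · have := ((hs2.comp_injective hinj1).add (hs2.comp_injective hinj2)).mul_left 2
    refine Summable.of_nonneg_of_le (fun n => by positivity) ?_ this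
    intro n
    by_cases hn : n = 0
    · simp [hn]
    · simp only [hn, if_false, Function.comp_apply]
      push_cast
      have h1 : (a n).re^2 ≤ ‖a n‖^2 := by
        rw [← sq_abs]; exact pow_le_pow_left₀ (abs_nonneg _) (Complex.abs_re_le_norm _) 2
      have h2 : (a (-n)).re^2 ≤ ‖a (-n)‖^2 := by
        rw [← sq_abs (a (-n)).re]; exact pow_le_pow_left₀ (abs_nonneg _) (Complex.abs_re_le_norm _) 2
      have h3 : ((a n).re + (a (-n)).re)^2 ≤ 2 * (‖a n‖^2 + ‖a (-n)‖^2) := by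
        nlinarith [sq_nonneg ((a n).re - (a (-n)).re)]
      have := mul_le_mul_of_nonneg_left h3 (sq_nonneg (n:ℝ))
      nlinarith
  · have hn := hs1.norm
    have := ((hn.comp_injective hinj1).add (hn.comp_injective hinj2))
    refine Summable.of_nonneg_of_le (fun n => by positivity) ?_ this
    intro n
    by_cases hn : n = 0
    · simp only [hn, if_true, Function.comp_apply]
      have := Complex.abs_re_le_norm (a 0)
      simp; linarith [norm_nonneg (a 0)]
    · simp only [hn, if_false, Function.comp_apply]
      exact (abs_add_le _ _).trans (add_le_add (Complex.abs_re_le_norm _) (Complex.abs_re_le_norm _))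
  · intro x
    have h1 := (hcos x).nat_add_neg
    have h2 : HasSum (fun n : ℕ => if n = 0 then (a 0).re else 0) ((a 0).re) := by
      have := hasSum_ite_eq (0:ℕ) ((a 0).re)
      exact this
    have h3 := h1.sub h2
    simp only [Int.cast_zero, mul_zero, zero_mul, Real.cos_zero, mul_one] at h3
    rw [add_sub_cancel_right] at h3
    refine h3.congr_fun ?_
    intro n
    by_cases hn : n = 0
    · simp [hn]
    · simp only [hn, if_false]
      push_cast
      have : Real.cos (2*Real.pi*(-n)*x) = Real.cos (2*Real.pi*n*x) := by
        rw [← Real.cos_neg]; congr 1; ring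
      rw [this]; ring


lemma cos_sum_div (N n : ℕ) (hN : 0 < N) :
    ∑ j ∈ range N, Real.cos (2*Real.pi*n*((j:ℝ)/N)) = if N ∣ n then (N:ℝ) else 0 := by
  have hN' : (N:ℂ) ≠ 0 := by exact_mod_cast hN.ne'
  set z : ℂ := Complex.exp (2*Real.pi*Complex.I*(n/N)) with hz
  have h1 : ∀ j : ℕ, Real.cos (2*Real.pi*n*((j:ℝ)/N)) = (z^j).re := by
    intro j
    rw [hz, ← Complex.exp_nat_mul]
    have : (j:ℂ) * (2*Real.pi*Complex.I*(n/N)) = ((2*Real.pi*n*((j:ℝ)/N) : ℝ):ℂ) * Complex.I := by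
      push_cast; ring
    rw [this, Complex.exp_ofReal_mul_I_re]
  simp_rw [h1]
  rw [← Complex.re_sum]
  have hzN : z^N = 1 := by
    rw [hz, ← Complex.exp_nat_mul]
    have : (N:ℂ) * (2*Real.pi*Complex.I*(n/N)) = n * (2*Real.pi*Complex.I) := by
      field_simp
    rw [this, Complex.exp_nat_mul_two_pi_mul_I]
  have hz1 : z = 1 ↔ N ∣ n := by
    rw [hz, Complex.exp_eq_one_iff]
    constructor
    · rintro ⟨k, hk⟩
      have h2 : 2*(Real.pi:ℂ)*Complex.I ≠ 0 := Complex.two_pi_I_ne_zero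
      have h3 : (n:ℂ)/N = k := by
        apply mul_left_cancel₀ h2; rw [hk]; ring
      rw [div_eq_iff hN'] at h3
      have h4 : (n:ℤ) = k * N := by exact_mod_cast h3
      have : (N:ℤ) ∣ n := ⟨k, by rw [h4]; ring⟩
      exact_mod_cast this
    · rintro ⟨k, hk⟩
      refine ⟨k, ?_⟩
      rw [hk]; push_cast; field_simp
  by_cases h : N ∣ n
  · rw [if_pos h, hz1.2 h]; simp
  · rw [if_neg h]
    have hne : z ≠ 1 := fun hh => h (hz1.1 hh)
    have := geom_sum_eq hne N
    rw [this, hzN]; simp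

lemma RN_fourier (θ : ℝ → ℝ) (A : ℕ → ℝ)
    (h : ∀ x, HasSum (fun n : ℕ => A n * Real.cos (2*Real.pi*n*x)) (θ x)) (N : ℕ) (hN : 0 < N) :
    HasSum (fun l : ℕ => A (l*N)) (RN θ N / N) := by
  have hN' : (N:ℝ) ≠ 0 := by exact_mod_cast hN.ne'
  have h1 := hasSum_sum (s := range N) (fun j _ => h ((j:ℝ)/N))
  have h2 := h1.div_const (N:ℝ)
  have hinj : Function.Injective (fun l : ℕ => l * N) := fun x y hxy => Nat.eq_of_mul_eq_mul_right hN hxy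
  have h3 : HasSum (fun n => if N ∣ n then A n else 0) (RN θ N / N) := by
    refine h2.congr_fun ?_
    intro n
    rw [← Finset.mul_sum, cos_sum_div N n hN]
    split_ifs
    · field_simp
    · simp
  rw [← hinj.hasSum_iff] at h3
  · refine h3.congr_fun ?_
    intro l
    simp
  · intro x hx
    rw [if_neg]
    rintro ⟨k, hk⟩
    exact hx ⟨k, by simp [hk, mul_comm]⟩

lemma T_small (A : ℕ → ℝ) (h2 : Summable (fun n : ℕ => (n:ℝ)^2 * (A n)^2)) :
    Filter.Tendsto (fun N : ℕ => (N:ℝ) * ∑' l : ℕ, A ((l+1)*N)) Filter.atTop (nhds 0) := by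
  have hz : Summable (fun l : ℕ => 1/((l:ℝ)+1)^2) := by
    have := (summable_nat_add_iff 1).2 (Real.summable_one_div_nat_pow.2 (by norm_num : 1 < 2))
    simpa using this
  set Z := ∑' l : ℕ, 1/((l:ℝ)+1)^2 with hZ
  have hZ0 : 0 ≤ Z := tsum_nonneg (fun l => by positivity)
  have htail := tendsto_sum_nat_add (fun n : ℕ => (n:ℝ)^2 * (A n)^2)
  rw [Metric.tendsto_atTop]
  intro ε hε
  set δ := ε / (Z+1) with hδ
  have hδ0 : 0 < δ := by positivity
  obtain ⟨N0, hN0⟩ := (Metric.tendsto_atTop.1 htail) (δ*(ε/2)) (by positivity)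
  refine ⟨N0+1, fun N hN => ?_⟩
  have hNpos : 0 < N := by omega
  have hN' : (0:ℝ) < N := by exact_mod_cast hNpos
  have hb := hN0 N (by omega)
  rw [Real.dist_eq, sub_zero, abs_of_nonneg (tsum_nonneg (fun l => by positivity))] at hb
  rw [Real.dist_eq, sub_zero, ← tsum_mul_left]
  have hinj : Function.Injective (fun l : ℕ => (l+1) * N) := fun x y hxy => by
    have := Nat.eq_of_mul_eq_mul_right hNpos hxy; omega
  have hinj2 : Function.Injective (fun l : ℕ => (l+1) * N - N) := fun x y hxy => by
    simp only [add_mul, one_mul, Nat.add_sub_cancel] at hxy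
    exact Nat.eq_of_mul_eq_mul_right hNpos hxy
  have hsu := h2.comp_injective hinj
  have htl : ∑' l : ℕ, ((((l+1)*N:ℕ):ℝ)^2 * (A ((l+1)*N))^2) ≤ ∑' n : ℕ, (((n+N:ℕ):ℝ)^2 * (A (n+N))^2) := by
    apply Summable.tsum_le_tsum_of_inj (fun l : ℕ => (l+1) * N - N) hinj2
    · intro c _; positivity
    · intro l
      have : (l+1)*N - N + N = (l+1)*N := Nat.sub_add_cancel (by nlinarith)
      simp only [this]; exact le_rfl
    · exact hsu
    · exact (summable_nat_add_iff N).2 h2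
  have hbd : ∀ l : ℕ, ‖(N:ℝ) * A ((l+1)*N)‖ ≤ δ/2 * (1/((l:ℝ)+1)^2) + 1/(2*δ) * ((((l+1)*N:ℕ):ℝ)^2 * (A ((l+1)*N))^2) := by
    intro l
    set B := A ((l+1)*N)
    rw [Real.norm_eq_abs, abs_mul, abs_of_pos hN', ← sq_abs B]
    set C := |B|
    have hl : (0:ℝ) < (l:ℝ)+1 := by positivity
    push_cast
    have key : δ/2 * (1/((l:ℝ)+1)^2) + 1/(2*δ) * ((((l:ℝ)+1)*N)^2 * C^2) - N * C = 1/(2*δ) * (δ/((l:ℝ)+1) - ((l:ℝ)+1)*N*C)^2 := by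
      field_simp; ring
    have : 0 ≤ 1/(2*δ) * (δ/((l:ℝ)+1) - ((l:ℝ)+1)*N*C)^2 := by positivity
    linarith
  have hs := ((hz.mul_left (δ/2)).add (hsu.mul_left (1/(2*δ))))
  have h5 := tsum_of_norm_bounded hs.hasSum hbd
  rw [Real.norm_eq_abs] at h5
  refine h5.trans_lt ?_
  rw [Summable.tsum_add (hz.mul_left _) (hsu.mul_left _), tsum_mul_left, tsum_mul_left]
  have e1 : δ/2 * Z ≤ ε/2 := by
    rw [hδ]; rw [div_div, div_mul_eq_mul_div, div_le_div_iff₀ (by positivity) (by norm_num)]; nlinarith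
  have e2 : 1/(2*δ) * ∑' l : ℕ, ((((l+1)*N:ℕ):ℝ)^2 * (A ((l+1)*N))^2) < ε / 2 := by
    have : ∑' l : ℕ, ((((l+1)*N:ℕ):ℝ)^2 * (A ((l+1)*N))^2) < δ*(ε/2) := lt_of_le_of_lt htl hb
    calc _ < 1/(2*δ) * (δ*(ε/2)) := mul_lt_mul_of_pos_left this (by positivity)
      _ = ε/4 := by field_simp; norm_num
      _ ≤ ε/2 := by linarith
  have e3 : (∑' l, ((fun n : ℕ => (n:ℝ)^2 * (A n)^2) ∘ fun l : ℕ => (l+1)*N) l) = ∑' l : ℕ, ((((l+1)*N:ℕ):ℝ)^2 * (A ((l+1)*N))^2) := rfl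
  rw [e3]
  linarith


lemma sum_moebius_filter (K n : ℕ) (hK : 0 < K) :
    ∑ d ∈ K.divisors, (ArithmeticFunction.moebius d : ℝ) * (if d ∣ n then 1 else 0)
      = if Nat.gcd n K = 1 then 1 else 0 := by
  simp only [mul_ite, mul_one, mul_zero]
  rw [← Finset.sum_filter]
  have : K.divisors.filter (fun d => d ∣ n) = (Nat.gcd n K).divisors := by
    ext d
    simp only [Finset.mem_filter, Nat.mem_divisors, Nat.dvd_gcd_iff]
    have : Nat.gcd n K ≠ 0 := Nat.gcd_ne_zero_right hK.ne'
    constructor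
    · rintro ⟨⟨h1, h2⟩, h3⟩; exact ⟨⟨h3, h1⟩, this⟩
    · rintro ⟨⟨h1, h2⟩, _⟩; exact ⟨⟨h2, hK.ne'⟩, h1⟩
  rw [this]
  have h1 := congrArg (fun f : ArithmeticFunction ℤ => f (Nat.gcd n K)) ArithmeticFunction.moebius_mul_coe_zeta
  simp only [ArithmeticFunction.coe_mul_zeta_apply, ArithmeticFunction.one_apply] at h1
  have h2 := congrArg (fun z : ℤ => (z:ℝ)) h1
  push_cast at h2
  exact h2

lemma sieve_one (a : ℕ → ℝ) (hs : Summable (fun n => |a n|))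
    (h : ∀ d, 0 < d → HasSum (fun n => if d ∣ n then a n else 0) 0) : a 1 = 0 := by
  by_contra hne
  have hpos : 0 < |a 1| := abs_pos.2 hne
  have htail := tendsto_sum_nat_add (fun n => |a n|)
  obtain ⟨M0, hM0⟩ := (Metric.tendsto_atTop.1 htail) (|a 1|) hpos
  set M := M0 + 2
  have hb := hM0 M (by omega)
  rw [Real.dist_eq, sub_zero, abs_of_nonneg (tsum_nonneg (fun l => by positivity))] at hb
  set K := M.factorial
  have hK : 0 < K := Nat.factorial_pos _
  have h1 : HasSum (fun n => ∑ d ∈ K.divisors, (ArithmeticFunction.moebius d : ℝ) * (if d ∣ n then a n else 0))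
      (∑ d ∈ K.divisors, (ArithmeticFunction.moebius d : ℝ) * 0) := by
    apply hasSum_sum
    intro d hd
    exact (h d (Nat.pos_of_mem_divisors hd)).mul_left _
  simp only [mul_zero, Finset.sum_const_zero] at h1
  have h2 : HasSum (fun n => if Nat.gcd n K = 1 then a n else 0) 0 := by
    refine h1.congr_fun ?_
    intro n
    have := sum_moebius_filter K n hK
    have e : (if Nat.gcd n K = 1 then a n else 0) = (if Nat.gcd n K = 1 then (1:ℝ) else 0) * a n := by
      split_ifs <;> simp
    rw [e, ← this, Finset.sum_mul]
    apply Finset.sum_congr rfl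
    intro d _
    split_ifs <;> simp
  set f := fun n => if Nat.gcd n K = 1 then a n else 0 with hf
  have h3 := h2.summable.sum_add_tsum_nat_add M
  rw [h2.tsum_eq] at h3
  have h4 : ∑ i ∈ range M, f i = a 1 := by
    rw [Finset.sum_eq_single 1]
    · simp [hf]
    · intro b hb hb1
      simp only [Finset.mem_range] at hb
      simp only [hf]
      rw [if_neg]
      intro hg
      rcases Nat.eq_zero_or_pos b with h0 | h0
      · subst h0
        rw [Nat.gcd_zero_left] at hg
        have h2K : 2 ≤ K := by
          have : (2:ℕ).factorial ≤ M.factorial := Nat.factorial_le (by omega)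
          simpa using this
        omega
      · have : b ∣ K := Nat.dvd_factorial h0 hb.le
        rw [Nat.gcd_eq_left this] at hg
        exact hb1 hg
    · intro hh; exact absurd (Finset.mem_range.2 (by omega)) hh
  rw [h4] at h3
  have h5 : |∑' i, f (i+M)| ≤ ∑' i, |a (i+M)| := by
    rw [← Real.norm_eq_abs]
    apply tsum_of_norm_bounded ((summable_nat_add_iff M).2 hs).hasSum
    intro i
    simp only [hf, Real.norm_eq_abs]
    split_ifs <;> simp
  have h6 : |a 1| = |∑' i, f (i+M)| := by
    rw [← abs_neg]; congr 1; linarith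
  linarith

lemma sieve (a : ℕ → ℝ) (hs : Summable (fun n => |a n|))
    (h : ∀ N, 0 < N → ∑' l : ℕ, a ((l+1)*N) = 0) : ∀ n, 0 < n → a n = 0 := by
  intro n hn
  have key := sieve_one (fun k => if k = 0 then 0 else a (k*n)) ?_ ?_
  · simpa using key
  · have : Function.Injective (fun k : ℕ => k*n) := fun x y hxy => Nat.eq_of_mul_eq_mul_right hn hxy
    refine Summable.of_nonneg_of_le (fun n => by positivity) ?_ (hs.comp_injective this)
    intro k
    simp only [Function.comp_apply]
    split_ifs <;> simp
  · intro d hd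
    have hinj : Function.Injective (fun l : ℕ => (l+1)*d) := fun x y hxy => by
      have := Nat.eq_of_mul_eq_mul_right hd hxy; omega
    rw [← hinj.hasSum_iff]
    · have hinj2 : Function.Injective (fun l : ℕ => (l+1)*(d*n)) := fun x y hxy => by
        have := Nat.eq_of_mul_eq_mul_right (Nat.mul_pos hd hn) hxy; omega
      have h1 := (hs.of_abs.comp_injective hinj2).hasSum
      have h2 : ∑' l, (a ∘ fun l : ℕ => (l+1)*(d*n)) l = 0 := h (d*n) (Nat.mul_pos hd hn)
      rw [h2] at h1
      refine h1.congr_fun ?_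
      intro l
      have : (l+1)*d ≠ 0 := by positivity
      simp only [Function.comp_apply, dvd_mul_left, if_true, if_neg this, mul_assoc]
    · intro x hx
      by_cases hx0 : x = 0
      · simp [hx0]
      · rw [if_neg]
        rintro ⟨k, hk⟩
        apply hx
        refine ⟨k-1, ?_⟩
        have : k ≠ 0 := by rintro rfl; simp at hk; exact hx0 hk
        simp only [hk]
        rw [Nat.sub_add_cancel (by omega), mul_comm]


lemma w_exists (g : ℕ → ℝ) : ∃ w : ℕ → ℝ, ∀ n, 0 < n → ∑ d ∈ n.divisors, w d = g n :=
  ⟨fun n => ∑ x ∈ n.divisorsAntidiagonal, ((ArithmeticFunction.moebius x.1 : ℤ) : ℝ) * g x.2,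
    (ArithmeticFunction.sum_eq_iff_sum_mul_moebius_eq (f := fun n => ∑ x ∈ n.divisorsAntidiagonal, ((ArithmeticFunction.moebius x.1 : ℤ) : ℝ) * g x.2) (g := g)).2 (fun _ _ => rfl)⟩

lemma w_vals (e : ℕ) (he : 1 ≤ e) (w : ℕ → ℝ)
    (hw : ∀ n, 0 < n → ∑ d ∈ n.divisors, w d = n * sg (e-1) n) (p : ℕ) (hp : p.Prime) (hp2 : 2 < p) :
    w p = (p:ℝ)^e + p - 1 ∧ w (2*p) = (1+2^e) * ((p:ℝ)^e + p - 1) := by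
  obtain ⟨e, rfl⟩ : ∃ f, e = f+1 := ⟨e-1, by omega⟩
  simp only [Nat.add_sub_cancel] at hw
  have h1 := hw 1 one_pos
  have h2 := hw 2 two_pos
  have h3 := hw p hp.pos
  have h4 := hw (2*p) (by have := hp.pos; omega)
  have d4 : (2*p).divisors = {1, 2, p, 2*p} := by
    ext d
    simp only [Nat.mem_divisors, Finset.mem_insert, Finset.mem_singleton]
    constructor
    · rintro ⟨h, _⟩
      rcases (Nat.dvd_mul.1 h) with ⟨x, y, hx, hy, rfl⟩
      rcases (Nat.dvd_prime Nat.prime_two).1 hx with rfl | rfl <;> rcases (Nat.dvd_prime hp).1 hy with rfl | rfl <;> simp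
    · have := hp.pos
      rintro (rfl | rfl | rfl | rfl)
      · simp; omega
      · exact ⟨dvd_mul_right _ _, by omega⟩
      · exact ⟨dvd_mul_left _ _, by omega⟩
      · exact ⟨dvd_rfl, by omega⟩
  have n1 : (1:ℕ) ∉ ({2, p, 2*p} : Finset ℕ) := by simp; omega
  have n2 : (2:ℕ) ∉ ({p, 2*p} : Finset ℕ) := by simp; omega
  have n3 : p ∉ ({2*p} : Finset ℕ) := by simp; omega
  unfold sg at h1 h2 h3 h4
  rw [Nat.Prime.sum_divisors hp, Nat.Prime.sum_divisors hp] at h3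
  rw [Nat.Prime.sum_divisors Nat.prime_two, Nat.Prime.sum_divisors Nat.prime_two] at h2
  rw [d4, Finset.sum_insert n1, Finset.sum_insert n2, Finset.sum_insert n3, Finset.sum_singleton,
    Finset.sum_insert n1, Finset.sum_insert n2, Finset.sum_insert n3, Finset.sum_singleton] at h4
  simp only [Nat.divisors_one, Finset.sum_singleton, Nat.cast_one, one_pow, mul_one] at h1 h2 h3 h4
  push_cast at h2 h3 h4
  have hwp : w p = (p:ℝ)^(e+1) + p - 1 := by rw [pow_succ]; linarith
  refine ⟨hwp, ?_⟩
  have hw2 : w 2 = 2^(e+1) + 1 := by rw [pow_succ]; linarith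
  rw [h1, hwp, hw2, mul_pow] at h4
  have : w (2*p) = 2 * (p:ℝ) * (1 + (2^e + ((p:ℝ)^e + 2^e*(p:ℝ)^e))) - 1 - (2^(e+1)+1) - ((p:ℝ)^(e+1)+p-1) := by linarith
  rw [this]; ring

lemma poly_top (Q : Polynomial ℝ) (e : ℕ) (hQ : Q.natDegree ≤ e+1) (x : ℝ) :
    Q.eval x = Q.coeff (e+1) * x^(e+1) + Q.coeff e * x^e + ∑ i ∈ range e, Q.coeff i * x^i := by
  rw [Polynomial.eval_eq_sum_range' (n := e+2) (by omega), Finset.sum_range_succ, Finset.sum_range_succ]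
  ring

lemma low_tendsto (e : ℕ) (c : ℕ → ℝ) :
    Filter.Tendsto (fun N : ℕ => (∑ i ∈ range e, c i * (N:ℝ)^i) / (N:ℝ)^e) Filter.atTop (nhds 0) := by
  simp_rw [Finset.sum_div]
  rw [show (0:ℝ) = ∑ i ∈ range e, 0 by simp]
  apply tendsto_finsetSum
  intro i hi
  rw [Finset.mem_range] at hi
  have h1 : Filter.Tendsto (fun N : ℕ => c i * ((N:ℝ)^(e-i))⁻¹) Filter.atTop (nhds (c i * 0)) := by
    apply Filter.Tendsto.const_mul
    apply Filter.Tendsto.inv_tendsto_atTop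
    exact (Filter.tendsto_pow_atTop (by omega)).comp tendsto_natCast_atTop_atTop
  rw [mul_zero] at h1
  refine h1.congr' ?_
  filter_upwards [Filter.eventually_gt_atTop 0] with N hN
  have hN' : (N:ℝ) ≠ 0 := by exact_mod_cast hN.ne'
  have : (N:ℝ)^e = (N:ℝ)^i * (N:ℝ)^(e-i) := by rw [← pow_add]; congr 1; omega
  rw [this]; field_simp

lemma kill_b (e : ℕ) (he : 2 ≤ e) (A0 : ℝ) (T w : ℕ → ℝ) (Q : Polynomial ℝ) (b : ℝ) (hQ : Q.natDegree ≤ e+1)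
    (hT : Filter.Tendsto (fun N : ℕ => (N:ℝ) * T N) Filter.atTop (nhds 0))
    (hw : ∀ n, 0 < n → ∑ d ∈ n.divisors, w d = n * sg (e-1) n)
    (h : ∀ N : ℕ, 0 < N → (N:ℝ)^(e+1) * (A0 + T N) = Q.eval (N:ℝ) + b * w N) :
    ∀ N : ℕ, 0 < N → T N = (∑ i ∈ range e, Q.coeff i * (N:ℝ)^i) / (N:ℝ)^(e+1) := by
  set F := fun N : ℕ => (∑ i ∈ range e, Q.coeff i * (N:ℝ)^i) / (N:ℝ)^e with hF
  have hF0 : Filter.Tendsto F Filter.atTop (nhds 0) := low_tendsto e _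
  have hmain : ∀ N : ℕ, 0 < N → (N:ℝ) * T N = (Q.coeff (e+1) - A0) * N + Q.coeff e + F N + b * (w N / (N:ℝ)^e) := by
    intro N hN
    have hN' : (N:ℝ) ≠ 0 := by exact_mod_cast hN.ne'
    have h1 := h N hN
    rw [poly_top Q e hQ] at h1
    have h2 : (N:ℝ) * T N = ((N:ℝ)^(e+1) * (A0 + T N))/(N:ℝ)^e - A0 * N := by
      rw [pow_succ]; field_simp; ring
    rw [h2, h1, hF]
    rw [pow_succ]
    field_simp
    ring
  choose p hp1 hp2 using fun n : ℕ => Nat.exists_infinite_primes (n+3)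
  have hpt : Filter.Tendsto p Filter.atTop Filter.atTop :=
    Filter.tendsto_atTop_mono (fun n => by have := hp1 n; simp only [id]; omega) Filter.tendsto_id
  have hpt2 : Filter.Tendsto (fun n => 2 * p n) Filter.atTop Filter.atTop :=
    Filter.tendsto_atTop_mono (fun n => by have := hp1 n; simp only [id]; omega) Filter.tendsto_id
  have hv : ∀ n, w (p n) / (p n:ℝ)^e = 1 + (((p n:ℝ)^(e-1))⁻¹ - ((p n:ℝ)^e)⁻¹) := by
    intro n
    rw [(w_vals e (by omega) w hw (p n) (hp2 n) (by have := hp1 n; omega)).1]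
    have hN' : (p n:ℝ) ≠ 0 := by exact_mod_cast (hp2 n).ne_zero
    have : (p n:ℝ)^e = (p n:ℝ)^(e-1) * p n := by rw [← pow_succ]; congr 1; omega
    rw [this]; field_simp; ring
  have hinv : ∀ j, 1 ≤ j → Filter.Tendsto (fun n => ((p n:ℝ)^j)⁻¹) Filter.atTop (nhds 0) := by
    intro j hj
    apply Filter.Tendsto.inv_tendsto_atTop
    exact (Filter.tendsto_pow_atTop (by omega)).comp (tendsto_natCast_atTop_atTop.comp hpt)
  have hw1 : Filter.Tendsto (fun n => w (p n) / (p n:ℝ)^e) Filter.atTop (nhds 1) := by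
    simp_rw [hv]
    have := ((hinv (e-1) (by omega)).sub (hinv e (by omega))).const_add 1
    simpa using this
  have hw2 : Filter.Tendsto (fun n => w (2 * p n) / ((2 * p n : ℕ):ℝ)^e) Filter.atTop (nhds ((1+2^e)/2^e)) := by
    have : ∀ n, w (2 * p n) / ((2 * p n : ℕ):ℝ)^e = (1+2^e)/2^e * (w (p n) / (p n:ℝ)^e) := by
      intro n
      have := w_vals e (by omega) w hw (p n) (hp2 n) (by have := hp1 n; omega)
      rw [this.2, this.1]
      push_cast
      rw [mul_pow]
      have hN' : (p n:ℝ) ≠ 0 := by exact_mod_cast (hp2 n).ne_zero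
      field_simp
    simp_rw [this]
    simpa using hw1.const_mul ((1+2^e)/2^e : ℝ)
  have hc : Q.coeff (e+1) - A0 = 0 := by
    by_contra hne
    have h1 : Filter.Tendsto (fun n => (Q.coeff (e+1) - A0) * (p n:ℝ)) Filter.atTop (nhds (0 - Q.coeff e - 0 - b * 1)) := by
      have := (((hT.comp hpt).sub_const (Q.coeff e)).sub (hF0.comp hpt)).sub (hw1.const_mul b)
      refine this.congr ?_
      intro n
      simp only [Function.comp_apply]
      rw [hmain (p n) (hp2 n).pos]; ring
    have h2 := h1.const_mul (Q.coeff (e+1) - A0)⁻¹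
    have h3 : Filter.Tendsto (fun n => (p n:ℝ)) Filter.atTop (nhds ((Q.coeff (e+1) - A0)⁻¹ * (0 - Q.coeff e - 0 - b * 1))) := by
      refine h2.congr ?_
      intro n
      field_simp
    exact not_tendsto_nhds_of_tendsto_atTop (tendsto_natCast_atTop_atTop.comp hpt) _ h3
  have e1 : Q.coeff e + b = 0 := by
    have h1 : Filter.Tendsto (fun n => (p n:ℝ) * T (p n)) Filter.atTop (nhds (Q.coeff e + 0 + b * 1)) := by
      have := ((hF0.comp hpt).const_add (Q.coeff e)).add (hw1.const_mul b)
      refine this.congr ?_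
      intro n
      rw [hmain (p n) (hp2 n).pos, hc]; simp
    have := tendsto_nhds_unique h1 (hT.comp hpt)
    linarith
  have e2 : Q.coeff e + b * ((1+2^e)/2^e) = 0 := by
    have h1 : Filter.Tendsto (fun n => ((2 * p n:ℕ):ℝ) * T (2 * p n)) Filter.atTop (nhds (Q.coeff e + 0 + b * ((1+2^e)/2^e))) := by
      have := ((hF0.comp hpt2).const_add (Q.coeff e)).add (hw2.const_mul b)
      refine this.congr ?_
      intro n
      rw [hmain (2 * p n) (by have := (hp2 n).pos; omega), hc]; simp
    have := tendsto_nhds_unique h1 (hT.comp hpt2)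
    linarith
  have hb : b = 0 := by
    have : b * (1/2^e) = 0 := by
      have : (1+2^e)/2^e = 1 + 1/(2:ℝ)^e := by field_simp; ring
      rw [this] at e2; linarith
    rcases mul_eq_zero.1 this with h | h
    · exact h
    · exact absurd h (by positivity)
  intro N hN
  have hN' : (N:ℝ) ≠ 0 := by exact_mod_cast hN.ne'
  have := hmain N hN
  have hce : Q.coeff e = 0 := by linarith
  rw [hc, hb, hce] at this
  simp only [zero_mul, zero_add, add_zero, hF] at this
  rw [pow_succ]
  field_simp
  field_simp at this
  linarith

lemma coeff_poly (e : ℕ) (he : 2 ≤ e) (A : ℕ → ℝ) (c : ℕ → ℝ) (hs : Summable (fun n => |A n|))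
    (h : ∀ N : ℕ, 0 < N → ∑' l : ℕ, A ((l+1)*N) = (∑ i ∈ range e, c i * (N:ℝ)^i) / (N:ℝ)^(e+1)) :
    ∃ P : Polynomial ℝ, ∀ n : ℕ, 0 < n → A n = P.eval (n:ℝ) / (n:ℝ)^(e+1) := by
  have hsum : ∀ i ∈ range e, Summable (fun n : ℕ => (n:ℝ)^i / (n:ℝ)^(e+1)) := by
    intro i hi
    rw [Finset.mem_range] at hi
    have : Summable (fun n : ℕ => 1 / (n:ℝ)^(e+1-i)) := Real.summable_one_div_nat_pow.2 (by omega)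
    refine this.congr ?_
    intro n
    by_cases hn : n = 0
    · have : e + 1 - i ≠ 0 := by omega
      simp [hn, this]
    · have hn' : (n:ℝ) ≠ 0 := by exact_mod_cast hn
      have : (n:ℝ)^(e+1) = (n:ℝ)^i * (n:ℝ)^(e+1-i) := by rw [← pow_add]; congr 1; omega
      rw [this]; field_simp
  set z := fun i : ℕ => ∑' l : ℕ, ((l:ℝ)+1)^i / ((l:ℝ)+1)^(e+1) with hz
  have hsum1 : ∀ i ∈ range e, Summable (fun l : ℕ => ((l:ℝ)+1)^i / ((l:ℝ)+1)^(e+1)) := by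
    intro i hi
    have := (summable_nat_add_iff 1).2 (hsum i hi)
    simpa using this
  have hzpos : ∀ i ∈ range e, 0 < z i := by
    intro i hi
    exact (hsum1 i hi).tsum_pos (fun l => by positivity) 0 (by positivity)
  set B := fun n : ℕ => ∑ i ∈ range e, (c i / z i) * ((n:ℝ)^i / (n:ℝ)^(e+1)) with hB
  have hBs : Summable (fun n => |B n|) := by
    apply Summable.abs
    apply summable_sum
    intro i hi
    exact (hsum i hi).mul_left _
  have key := sieve (fun n => A n - B n) ?_ ?_
  · refine ⟨∑ i ∈ range e, Polynomial.C (c i / z i) * Polynomial.X^i, fun n hn => ?_⟩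
    have := key n hn
    simp only [hB] at this
    rw [Polynomial.eval_finsetSum, Finset.sum_div]
    simp only [Polynomial.eval_mul, Polynomial.eval_C, Polynomial.eval_pow, Polynomial.eval_X]
    rw [sub_eq_zero] at this
    rw [this]
    apply Finset.sum_congr rfl
    intro i _; ring
  · exact Summable.of_nonneg_of_le (fun n => by positivity) (fun n => abs_sub _ _) (hs.add hBs)
  · intro N hN
    have hN' : (N:ℝ) ≠ 0 := by exact_mod_cast hN.ne'
    have hinj : Function.Injective (fun l : ℕ => (l+1)*N) := fun x y hxy => by
      have := Nat.eq_of_mul_eq_mul_right hN hxy; omega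
    have h1 : Summable (fun l : ℕ => A ((l+1)*N)) := hs.of_abs.comp_injective hinj
    have h2 : Summable (fun l : ℕ => B ((l+1)*N)) := hBs.of_abs.comp_injective hinj
    rw [h1.tsum_sub h2, h N hN, sub_eq_zero]
    have h3 : ∀ l : ℕ, B ((l+1)*N) = ∑ i ∈ range e, (c i / z i * ((N:ℝ)^i/(N:ℝ)^(e+1))) * (((l:ℝ)+1)^i / ((l:ℝ)+1)^(e+1)) := by
      intro l
      simp only [hB]
      apply Finset.sum_congr rfl
      intro i _
      push_cast
      rw [mul_pow, mul_pow]
      field_simp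
    simp_rw [h3]
    rw [Summable.tsum_finsetSum (fun i hi => (hsum1 i hi).mul_left _), Finset.sum_div]
    apply Finset.sum_congr rfl
    intro i hi
    rw [tsum_mul_left]
    have := (hzpos i hi).ne'
    change _ = _ * z i
    field_simp


lemma log_contra (A : ℕ → ℝ) (e : ℕ) (hev : Even e) (C ε : ℝ) (hε : 0 < ε) (n0 : ℕ) (hn0 : 1 ≤ n0)
    (hA : ∀ n : ℕ, n0 ≤ n → ε / (n:ℝ)^(e+1) ≤ A n)
    (h : ∀ t : ℝ, 0 < t → ∃ S, HasSum (fun n : ℕ => A n * (2 * Real.sin (Real.pi*n*t))^e) S ∧ S ≤ C * t^e) : False := by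
  set C' := C + ∑ n ∈ range n0, |A n| * (2*Real.pi*n)^e with hC'
  have key : ∀ M : ℕ, n0 ≤ M → ε * ∑ n ∈ Ico n0 (M+1), 1/(n:ℝ) ≤ C' := by
    intro M hM
    have hM' : (0:ℝ) < M := by exact_mod_cast (by omega : 0 < M)
    set t : ℝ := 1/(2*M) with ht
    have ht0 : 0 < t := by positivity
    obtain ⟨S, hS, hSC⟩ := h t ht0
    have hnn : ∀ n : ℕ, 0 ≤ (2 * Real.sin (Real.pi*n*t))^e := fun n => hev.pow_nonneg _
    have hpos : ∀ n : ℕ, n0 ≤ n → 0 ≤ A n * (2 * Real.sin (Real.pi*n*t))^e := by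
      intro n hn
      exact mul_nonneg (le_trans (by positivity) (hA n hn)) (hnn n)
    have h1 : ∑ n ∈ range (M+1), A n * (2 * Real.sin (Real.pi*n*t))^e ≤ S := by
      apply sum_le_hasSum _ _ hS
      intro n hn
      simp only [Finset.mem_range, not_lt] at hn
      exact hpos n (by omega)
    rw [← Finset.sum_range_add_sum_Ico _ (show n0 ≤ M+1 by omega)] at h1
    have h2 : -(t^e * ∑ n ∈ range n0, |A n| * (2*Real.pi*n)^e) ≤ ∑ n ∈ range n0, A n * (2 * Real.sin (Real.pi*n*t))^e := by
      rw [Finset.mul_sum, ← Finset.sum_neg_distrib]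
      apply Finset.sum_le_sum
      intro n _
      have b1 : |2 * Real.sin (Real.pi*n*t)| ≤ 2*Real.pi*n*t := by
        rw [abs_mul, abs_two]
        have := Real.abs_sin_le_abs (x := Real.pi*n*t)
        rw [abs_of_nonneg (a := Real.pi*n*t) (by positivity)] at this
        linarith
      have b2 : (2 * Real.sin (Real.pi*n*t))^e ≤ (2*Real.pi*n*t)^e := by
        rw [← hev.pow_abs]
        exact pow_le_pow_left₀ (abs_nonneg _) b1 e
      have b3 : |A n| * (2 * Real.sin (Real.pi*n*t))^e ≤ |A n| * (2*Real.pi*n*t)^e := mul_le_mul_of_nonneg_left b2 (abs_nonneg _)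
      have b4 : -(|A n| * (2 * Real.sin (Real.pi*n*t))^e) ≤ A n * (2 * Real.sin (Real.pi*n*t))^e := by
        rw [← neg_mul]
        exact mul_le_mul_of_nonneg_right (neg_abs_le _) (hnn n)
      have b5 : (2*Real.pi*n*t)^e = t^e * (2*Real.pi*n)^e := by rw [mul_pow]; ring
      rw [b5] at b3
      linarith
    have h3 : t^e * (ε * ∑ n ∈ Ico n0 (M+1), 1/(n:ℝ)) ≤ ∑ n ∈ Ico n0 (M+1), A n * (2 * Real.sin (Real.pi*n*t))^e := by
      rw [Finset.mul_sum, Finset.mul_sum]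
      apply Finset.sum_le_sum
      intro n hn
      rw [Finset.mem_Ico] at hn
      have hn' : (0:ℝ) < n := by exact_mod_cast (by omega : 0 < n)
      have hnM : (n:ℝ) ≤ M := by exact_mod_cast (by omega : n ≤ M)
      have hnt : (n:ℝ) * t ≤ 1/2 := by
        rw [ht, mul_one_div, div_le_iff₀ (by positivity)]; linarith
      have b1 := Real.mul_le_sin (x := Real.pi*n*t) (by positivity) (by nlinarith [Real.pi_pos])
      have b2 : 2 / Real.pi * (Real.pi*n*t) = 2 * (n*t) := by field_simp
      rw [b2] at b1
      have b3 : (n*t)^e ≤ (2 * Real.sin (Real.pi*n*t))^e := by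
        apply pow_le_pow_left₀ (by positivity)
        have : 0 ≤ (n:ℝ)*t := by positivity
        linarith
      have b4 : t^e * (ε * (1/(n:ℝ))) = ε / (n:ℝ)^(e+1) * (n*t)^e := by
        rw [mul_pow, pow_succ]; field_simp
      rw [b4]
      exact mul_le_mul (hA n hn.1) b3 (by positivity) (le_trans (by positivity) (hA n hn.1))
    have : t^e * (ε * ∑ n ∈ Ico n0 (M+1), 1/(n:ℝ)) ≤ t^e * C' := by
      rw [hC', mul_add]; linarith
    exact le_of_mul_le_mul_left this (by positivity)
  have hdiv := Real.tendsto_sum_range_one_div_nat_succ_atTop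
  obtain ⟨M, hM1, hM2⟩ := ((hdiv.eventually_gt_atTop (C'/ε + ∑ n ∈ range n0, 1/(n:ℝ))).and (Filter.eventually_ge_atTop n0)).exists
  have := key M hM2
  have e1 : ∑ i ∈ range M, 1/((i:ℝ)+1) = ∑ n ∈ range (M+1), 1/(n:ℝ) := by
    rw [Finset.sum_range_succ']; simp
  rw [e1, ← Finset.sum_range_add_sum_Ico _ (show n0 ≤ M+1 by omega)] at hM1
  have h4 : C'/ε < ∑ n ∈ Ico n0 (M+1), 1/(n:ℝ) := by linarith
  rw [div_lt_iff₀ hε] at h4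
  linarith

/-- central difference -/
def CD (m : ℕ) (g : ℝ → ℝ) (t : ℝ) : ℝ :=
  ∑ i ∈ range (2*m+1), (-1:ℝ)^i * ((2*m).choose i) * g (((i:ℝ)-m)*t)

lemma CD_cos (m : ℕ) (y t : ℝ) :
    CD m (fun x => Real.cos (2*y*x)) t = (-1)^m * (2 * Real.sin (y*t))^(2*m) := by
  set u : ℂ := Complex.exp (y*t*Complex.I) with hu
  set v : ℂ := Complex.exp (-(y*t)*Complex.I) with hv
  have huv : u * v = 1 := by rw [hu, hv, ← Complex.exp_add]; simp
  have h1 : (v - u)^(2*m) = ((((-1)^m * (2 * Real.sin (y*t))^(2*m) : ℝ)) : ℂ) := by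
    have : v - u = -(2 * Complex.sin (y*t)) * Complex.I := by
      rw [Complex.sin, hu, hv]
      ring_nf
      rw [Complex.I_sq]; ring
    rw [this, pow_mul, mul_pow, Complex.I_sq]
    push_cast
    rw [mul_comm ((-1:ℂ)^m), pow_mul, ← mul_pow]
    congr 1; ring
  have h2 : (v - u)^(2*m) = ∑ i ∈ range (2*m+1), (-1:ℂ)^i * ((2*m).choose i) * Complex.exp (((2*y*(((i:ℝ)-m)*t) : ℝ):ℂ)*Complex.I) := by
    have : v - u = (-u) + v := by ring
    rw [this, add_pow]
    apply Finset.sum_congr rfl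
    intro i hi
    rw [Finset.mem_range] at hi
    have : u^i * v^(2*m-i) = Complex.exp (((2*y*(((i:ℝ)-m)*t) : ℝ):ℂ)*Complex.I) := by
      rw [hu, hv, ← Complex.exp_nat_mul, ← Complex.exp_nat_mul, ← Complex.exp_add]
      congr 1
      rw [Nat.cast_sub (by omega)]
      push_cast; ring
    rw [← this, neg_pow]; ring
  have h3 := congrArg Complex.re (h2.symm.trans h1)
  rw [Complex.ofReal_re, Complex.re_sum] at h3
  rw [← h3, CD]
  apply Finset.sum_congr rfl
  intro i _
  have : (-1:ℂ)^i * ((2*m).choose i) = (((-1:ℝ)^i * ((2*m).choose i) : ℝ) : ℂ) := by push_cast; ring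
  rw [this, Complex.re_ofReal_mul, Complex.exp_ofReal_mul_I_re]

lemma CD_pow (m j : ℕ) (t : ℝ) (hj : j < 2*m) : CD m (fun x => x^j) t = 0 := by
  have h1 := fwdDiff_iter_pow_eq_zero_of_lt (R := ℝ) hj
  have h2 := fwdDiff_iter_eq_sum_shift (1:ℝ) (fun x : ℝ => x^j) (2*m) (-(m:ℝ))
  rw [h1] at h2
  unfold CD
  have h3 : ∑ i ∈ range (2*m+1), (-1:ℝ)^i * ((2*m).choose i) * (((i:ℝ)-m)*t)^j =
    t^j * ∑ i ∈ range (2*m+1), (-1:ℝ)^i * ((2*m).choose i) * ((i:ℝ)-m)^j := by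
    rw [Finset.mul_sum]
    apply Finset.sum_congr rfl; intro i _; rw [mul_pow]; ring
  rw [h3]
  apply mul_eq_zero_of_right
  simp only [Pi.zero_apply] at h2
  rw [h2]
  apply Finset.sum_congr rfl
  intro i hi
  rw [Finset.mem_range] at hi
  have e1 : (-1:ℝ)^i = (-1)^(2*m-i) := by
    have : (-1:ℝ)^(2*m-i) * (-1)^i = 1 := by
      rw [← pow_add, Nat.sub_add_cancel (by omega)]; simp
    have h4 : (-1:ℝ)^i * (-1)^i = 1 := by rw [← mul_pow]; simp
    calc (-1:ℝ)^i = ((-1:ℝ)^(2*m-i) * (-1)^i) * (-1)^i := by rw [this, one_mul]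
      _ = _ := by rw [mul_assoc, h4, mul_one]
  rw [e1, zsmul_eq_mul]
  push_cast
  congr 1
  rw [nsmul_eq_mul]; ring

lemma CD_add (m : ℕ) (f g : ℝ → ℝ) (t : ℝ) : CD m (fun x => f x + g x) t = CD m f t + CD m g t := by
  unfold CD; rw [← Finset.sum_add_distrib]; apply Finset.sum_congr rfl; intro i _; ring

lemma CD_sub (m : ℕ) (f g : ℝ → ℝ) (t : ℝ) : CD m (fun x => f x - g x) t = CD m f t - CD m g t := by
  unfold CD; rw [← Finset.sum_sub_distrib]; apply Finset.sum_congr rfl; intro i _; ring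

lemma CD_bound (m : ℕ) (f : ℝ → ℝ) (B : ℝ) (h : ∀ x, |f x| ≤ B * |x|^(2*m)) :
    ∃ C, ∀ t, 0 < t → |CD m f t| ≤ C * t^(2*m) := by
  refine ⟨∑ i ∈ range (2*m+1), ((2*m).choose i) * (B * |(i:ℝ)-m|^(2*m)), fun t ht => ?_⟩
  rw [Finset.sum_mul]
  refine (Finset.abs_sum_le_sum_abs _ _).trans (Finset.sum_le_sum fun i _ => ?_)
  rw [abs_mul, abs_mul, abs_pow, abs_neg, abs_one, one_pow, one_mul, Nat.abs_cast, mul_assoc]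
  apply mul_le_mul_of_nonneg_left _ (Nat.cast_nonneg _)
  refine (h _).trans ?_
  rw [abs_mul, mul_pow, abs_of_pos ht]; linarith

lemma CD_sum (m n : ℕ) (c : ℕ → ℝ) (f : ℕ → ℝ → ℝ) (t : ℝ) :
    CD m (fun x => ∑ l ∈ range n, c l * f l x) t = ∑ l ∈ range n, c l * CD m (f l) t := by
  unfold CD
  simp_rw [Finset.mul_sum]
  rw [Finset.sum_comm]
  apply Finset.sum_congr rfl; intro l _
  apply Finset.sum_congr rfl; intro i _
  ring

lemma CD_AA (m : ℕ) (a : ℕ → ℝ) : ∃ C, ∀ t, 0 < t → |CD m (fun x => AA m a x 1) t| ≤ C * t^(2*m) := by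
  obtain ⟨C, hC⟩ := CD_bound m (fun x => (a (m-0) - a 0) * x^(2*m)) (|a (m-0) - a 0|) (fun x => by
    rw [abs_mul, abs_pow])
  refine ⟨C, fun t ht => ?_⟩
  have : CD m (fun x => AA m a x 1) t = CD m (fun x => (a (m-0) - a 0) * x^(2*m)) t := by
    have e : (fun x => AA m a x 1) = fun x => ∑ l ∈ range (m+1), (a (m-l) - a l) * x^(2*(m-l)) := by
      ext x; rw [AA_eq]; simp
    rw [e, CD_sum m (m+1) (fun l => a (m-l) - a l) (fun l x => x^(2*(m-l))), Finset.sum_eq_single 0]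
    · have := CD_sum m 1 (fun l => a (m-l) - a l) (fun l x => x^(2*(m-l))) t
      simp only [Finset.sum_range_one] at this
      rw [← this]; rfl
    · intro l hl h0
      rw [Finset.mem_range] at hl
      rw [CD_pow m _ t (by omega), mul_zero]
    · simp
  rw [this]; exact hC t ht


lemma poly_ev_pos (P : Polynomial ℝ) (hP : 0 < P.leadingCoeff) :
    ∃ ε > 0, ∃ n0 : ℕ, 1 ≤ n0 ∧ ∀ n : ℕ, n0 ≤ n → ε ≤ P.eval (n:ℝ) := by
  by_cases hd : 0 < P.degree
  · have h1 := (P.tendsto_atTop_of_leadingCoeff_nonneg hd hP.le).comp (tendsto_natCast_atTop_atTop (R := ℝ))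
    obtain ⟨n0, hn0⟩ := Filter.eventually_atTop.1 (h1.eventually_ge_atTop 1)
    exact ⟨1, one_pos, n0+1, by omega, fun n hn => hn0 n (by omega)⟩
  · have := Polynomial.eq_C_of_degree_le_zero (not_lt.1 hd)
    rw [this] at hP ⊢
    rw [Polynomial.leadingCoeff_C] at hP
    exact ⟨_, hP, 1, le_rfl, fun n _ => by simp⟩

lemma theta_const (m : ℕ) (hm : 2 ≤ m) (a : ℕ → ℝ) (θ : ℝ → ℝ) (L : ℝ) (hL : ∀ x y, |θ x - θ y| ≤ L*|x-y|)
    (A : ℕ → ℝ) (hs : Summable (fun n => |A n|))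
    (hA : ∀ x, x ≠ 0 → AA m a x 1 = x^(2*m) * θ (1/x) - θ x)
    (hc : ∀ x, HasSum (fun n : ℕ => A n * Real.cos (2*Real.pi*n*x)) (θ x))
    (P : Polynomial ℝ) (hP : ∀ n : ℕ, 0 < n → A n = P.eval (n:ℝ) / (n:ℝ)^(2*m+1)) : P = 0 := by
  set B := ∑' n, |A n| with hB
  have hbd : ∀ x, |θ x| ≤ B := by
    intro x
    rw [← (hc x).tsum_eq, ← Real.norm_eq_abs]
    apply tsum_of_norm_bounded hs.hasSum
    intro n
    rw [Real.norm_eq_abs, abs_mul]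
    exact mul_le_of_le_one_right (abs_nonneg _) (Real.abs_cos_le_one _)
  have hL0 : 0 ≤ L := by
    have := hL 1 0; have h2 := abs_nonneg (θ 1 - θ 0); simp at this; linarith
  have hcont : Continuous θ := by
    have : LipschitzWith (Real.toNNReal L) θ := by
      apply LipschitzWith.of_dist_le_mul
      intro x y
      rw [Real.dist_eq, Real.dist_eq, Real.coe_toNNReal _ hL0]; exact hL x y
    exact this.continuous
  have hAc : Continuous (fun x => AA m a x 1) := by
    have e : (fun x => AA m a x 1) = fun x => ∑ l ∈ range (m+1), (a (m-l) - a l) * x^(2*(m-l)) := by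
      ext x; rw [AA_eq]; simp
    rw [e]; fun_prop
  have h0 : θ 0 = - AA m a 0 1 := by
    have hlim : Filter.Tendsto (fun n : ℕ => 1/((n:ℝ)+1)) Filter.atTop (nhds 0) := tendsto_one_div_add_atTop_nhds_zero_nat
    have h1 : Filter.Tendsto (fun n : ℕ => θ (1/((n:ℝ)+1)) + AA m a (1/((n:ℝ)+1)) 1) Filter.atTop (nhds (θ 0 + AA m a 0 1)) :=
      ((hcont.tendsto 0).comp hlim).add ((hAc.tendsto 0).comp hlim)
    have h2 : Filter.Tendsto (fun n : ℕ => θ (1/((n:ℝ)+1)) + AA m a (1/((n:ℝ)+1)) 1) Filter.atTop (nhds 0) := by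
      have h3 : Filter.Tendsto (fun n : ℕ => (1/((n:ℝ)+1))^(2*m) * B) Filter.atTop (nhds 0) := by
        have := (hlim.pow (2*m)).mul_const B
        rwa [zero_pow (by omega), zero_mul] at this
      apply squeeze_zero_norm _ h3
      intro n
      have hn : 1/((n:ℝ)+1) ≠ 0 := by positivity
      rw [hA _ hn]
      have : θ (1/((n:ℝ)+1)) + ((1/((n:ℝ)+1))^(2*m) * θ (1/(1/((n:ℝ)+1))) - θ (1/((n:ℝ)+1))) = (1/((n:ℝ)+1))^(2*m) * θ (1/(1/((n:ℝ)+1))) := by ring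
      rw [this, Real.norm_eq_abs, abs_mul, abs_of_nonneg (a := (1/((n:ℝ)+1))^(2*m)) (by positivity)]
      exact mul_le_mul_of_nonneg_left (hbd _) (by positivity)
    have := tendsto_nhds_unique h1 h2
    linarith
  have hall : θ = fun x => x^(2*m) * θ (1/x) - AA m a x 1 := by
    ext x
    by_cases hx : x = 0
    · subst hx; rw [h0, zero_pow (by omega)]; ring
    · rw [hA x hx]; ring
  obtain ⟨C1, hC1⟩ := CD_bound m (fun x => x^(2*m) * θ (1/x)) B (fun x => by
    rw [abs_mul, abs_pow, mul_comm]; exact mul_le_mul_of_nonneg_right (hbd _) (by positivity))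
  obtain ⟨C2, hC2⟩ := CD_AA m a
  have hCD : ∀ t, 0 < t → |CD m θ t| ≤ (C1 + C2) * t^(2*m) := by
    intro t ht
    rw [hall, CD_sub]
    refine (abs_sub _ _).trans ?_
    rw [add_mul]
    exact add_le_add (hC1 t ht) (hC2 t ht)
  have hsin : ∀ t, HasSum (fun n : ℕ => A n * (2 * Real.sin (Real.pi*n*t))^(2*m)) ((-1)^m * CD m θ t) := by
    intro t
    have h1 : HasSum (fun n : ℕ => ∑ i ∈ range (2*m+1), (-1:ℝ)^i * ((2*m).choose i) * (A n * Real.cos (2*Real.pi*n*(((i:ℝ)-m)*t)))) (CD m θ t) := by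
      apply hasSum_sum
      intro i _
      exact (hc _).mul_left _
    refine (h1.mul_left ((-1)^m)).congr_fun ?_
    intro n
    have h2 := CD_cos m (Real.pi*n) t
    have h3 : ∑ i ∈ range (2*m+1), (-1:ℝ)^i * ((2*m).choose i) * (A n * Real.cos (2*Real.pi*n*(((i:ℝ)-m)*t))) = A n * CD m (fun x => Real.cos (2*(Real.pi*n)*x)) t := by
      unfold CD
      rw [Finset.mul_sum]
      apply Finset.sum_congr rfl; intro i _
      beta_reduce
      rw [show 2*(Real.pi*n)*(((i:ℝ)-m)*t) = 2*Real.pi*n*(((i:ℝ)-m)*t) by ring]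
      ring
    rw [h3, h2]
    have h4 : (-1:ℝ)^m * (-1)^m = 1 := by rw [← mul_pow]; simp
    calc _ = ((-1:ℝ)^m * (-1)^m) * (A n * (2 * Real.sin (Real.pi*n*t))^(2*m)) := by rw [h4, one_mul]
      _ = _ := by ring
  by_contra hP0
  have hlc : P.leadingCoeff ≠ 0 := Polynomial.leadingCoeff_ne_zero.2 hP0
  have hsgn : ∀ t, |(-1:ℝ)^m * CD m θ t| = |CD m θ t| := by intro t; rw [abs_mul, abs_pow]; simp
  rcases lt_or_gt_of_ne hlc with hlt | hgt
  · obtain ⟨ε, hε, n0, hn0, hn⟩ := poly_ev_pos (-P) (by rw [Polynomial.leadingCoeff_neg]; linarith)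
    apply log_contra (fun n => - A n) (2*m) (even_two_mul m) (C1+C2) ε hε n0 hn0
    · intro n hh
      have h1 := hn n hh
      rw [Polynomial.eval_neg] at h1
      rw [hP n (by omega), ← neg_div]
      gcongr
    · intro t ht
      refine ⟨-((-1)^m * CD m θ t), ?_, ?_⟩
      · refine (hsin t).neg.congr_fun ?_
        intro n; ring
      · refine le_trans (neg_le_abs _) ?_
        rw [hsgn]; exact hCD t ht
  · obtain ⟨ε, hε, n0, hn0, hn⟩ := poly_ev_pos P hgt
    apply log_contra A (2*m) (even_two_mul m) (C1+C2) ε hε n0 hn0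
    · intro n hh
      rw [hP n (by omega)]
      have := hn n hh
      gcongr
    · intro t ht
      refine ⟨((-1)^m * CD m θ t), hsin t, ?_⟩
      refine le_trans (le_abs_self _) ?_
      rw [hsgn]; exact hCD t ht

lemma AA_of_one (m : ℕ) (hm : 1 ≤ m) (a : ℕ → ℝ) (c : ℝ) (h : ∀ x, x ≠ 0 → AA m a x 1 = c * (x^(2*m) - 1)) :
    ∀ x y, AA m a x y = c * (x^(2*m) - y^(2*m)) := by
  have hAc : Continuous (fun x => AA m a x 1) := by
    have e : (fun x => AA m a x 1) = fun x => ∑ l ∈ range (m+1), (a (m-l) - a l) * x^(2*(m-l)) := by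
      ext x; rw [AA_eq]; simp
    rw [e]; fun_prop
  have hB : (fun x => AA m a x 1) = fun x => c * (x^(2*m) - 1) := by
    apply Continuous.ext_on (dense_compl_singleton (0:ℝ)) hAc (by fun_prop)
    intro x hx
    exact h x hx
  have h1 : ∀ x, AA m a x 1 = c * (x^(2*m) - 1) := fun x => congrFun hB x
  have key : ∀ x y, y ≠ 0 → AA m a x y = c * (x^(2*m) - y^(2*m)) := by
    intro x y hy
    have := AA_smul m a y (x/y) 1
    rw [mul_one, mul_div_cancel₀ _ hy, h1, div_pow] at this
    rw [this]; field_simp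
  intro x y
  by_cases hy : y = 0
  · by_cases hx : x = 0
    · subst hx hy; unfold AA; ring
    · rw [AA_swap, key y x hx]; ring
  · exact key x y hy

theorem partII (m : ℕ) (hm : 1 ≤ m) (a : ℕ → ℝ)
    (h : ∀ x y, 2*PP m a x y = AA m a x (x+y) + AA m a x (x-y)) (α : ℕ → ℝ) (β : ℝ)
    (H : ∀ n, 0 < n → SS m a n + ∑ h ∈ range (2*m+2), α h * sg h n + β*(n * sg (2*m-1) n) = 0) :
    ∃ c, ∀ x y, AA m a x y = c * (x^(2*m) - y^(2*m)) := by
  by_cases hm2 : m = 1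
  · subst hm2
    refine ⟨a 1 - a 0, AA_of_one 1 le_rfl a _ ?_⟩
    intro x _
    rw [AA_eq]; simp [Finset.sum_range_succ]; ring
  have hm2 : 2 ≤ m := by omega
  obtain ⟨θ, L, hL, hev, hper, hA⟩ := theta_exists m hm2 a (three_term m a h)
  have hL0 : 0 ≤ L := by
    have := hL 1 0; have h2 := abs_nonneg (θ 1 - θ 0); simp at this; linarith
  have hcont : Continuous θ := by
    have : LipschitzWith (Real.toNNReal L) θ := by
      apply LipschitzWith.of_dist_le_mul
      intro x y
      rw [Real.dist_eq, Real.dist_eq, Real.coe_toNNReal _ hL0]; exact hL x y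
    exact this.continuous
  obtain ⟨w, hw⟩ := w_exists (fun n => n * sg (2*m-1) n)
  obtain ⟨Q, b, hQ, hQN⟩ := RN_poly m hm2 a θ hcont h hev hper hA α β H w hw
  obtain ⟨A, hA2, hA1, hcos⟩ := fourier_exists θ L hL hev hper
  have hT := T_small A hA2
  have hmain : ∀ N : ℕ, 0 < N → (N:ℝ)^(2*m+1) * (A 0 + ∑' l : ℕ, A ((l+1)*N)) = Q.eval (N:ℝ) + b * w N := by
    intro N hN
    have hN' : (N:ℝ) ≠ 0 := by exact_mod_cast hN.ne'
    have h1 := RN_fourier θ A hcos N hN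
    have h2 := h1.summable.tsum_eq_zero_add
    rw [h1.tsum_eq, zero_mul] at h2
    rw [← h2, ← hQN N hN, pow_succ]; field_simp
  have h1 := kill_b (2*m) (by omega) (A 0) _ w Q b hQ hT hw hmain
  obtain ⟨P, hP⟩ := coeff_poly (2*m) (by omega) A _ hA1 h1
  have hP0 := theta_const m hm2 a θ L hL A hA1 hA hcos P hP
  have hAz : ∀ n : ℕ, 0 < n → A n = 0 := by intro n hn; rw [hP n hn, hP0]; simp
  have hθ : ∀ x, θ x = A 0 := by
    intro x
    rw [← (hcos x).tsum_eq, tsum_eq_single 0]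
    · simp
    · intro n hn; rw [hAz n (by omega), zero_mul]
  refine ⟨A 0, AA_of_one m hm a _ ?_⟩
  intro x hx
  rw [hA x hx, hθ, hθ]; ring


/-- recursion polynomials for derivatives of sech -/
def bp : ℕ → Polynomial ℤ
  | 0 => 1
  | (i+1) => -Polynomial.X * bp i + (1 - Polynomial.X^2) * Polynomial.derivative (bp i)

def bb (i : ℕ) (x : ℝ) : ℝ := 1/(2*Real.cosh x) * Polynomial.aeval (Real.tanh x) (bp i)

lemma bp_even (j : ℕ) : ∃ q : Polynomial ℤ, bp (2*j) = 1 + 2 * q := by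
  induction j with
  | zero => exact ⟨0, by simp [bp]⟩
  | succ j ih =>
    obtain ⟨q, hq⟩ := ih
    rw [show 2*(j+1) = 2*j+1+1 by ring]
    simp only [bp, hq]
    have h2 : Polynomial.derivative (2 : Polynomial ℤ) = 0 := by
      simp
    simp only [Polynomial.derivative_zero, Polynomial.derivative_add, Polynomial.derivative_mul, Polynomial.derivative_sub, Polynomial.derivative_neg, Polynomial.derivative_one, Polynomial.derivative_X, Polynomial.derivative_X_pow, h2]
    refine ⟨Polynomial.X^2 - 1 + (-Polynomial.X * (-Polynomial.X * q + (1 - Polynomial.X^2) * Polynomial.derivative q) + (1 - Polynomial.X^2) * (-q - Polynomial.X * Polynomial.derivative q - 2 * Polynomial.X * Polynomial.derivative q + (1 - Polynomial.X^2) * Polynomial.derivative (Polynomial.derivative q))), ?_⟩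
    simp only [Polynomial.C_ofNat, Nat.cast_ofNat, Nat.add_one_sub_one, pow_one]
    ring

lemma bb_zero_ne (j : ℕ) : bb (2*j) 0 ≠ 0 := by
  obtain ⟨q, hq⟩ := bp_even j
  unfold bb
  rw [hq, Real.tanh_zero, Real.cosh_zero]
  simp only [map_add, map_one, map_mul, map_ofNat]
  apply mul_ne_zero (by norm_num)
  have : Polynomial.aeval (0:ℝ) q = ((q.eval 0 : ℤ):ℝ) := by
    rw [Polynomial.aeval_def, Polynomial.eval₂_at_zero, ← Polynomial.coeff_zero_eq_eval_zero]; simp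
  rw [this]
  intro h
  have h2 : (1:ℤ) + 2 * q.eval 0 = 0 := by exact_mod_cast h
  omega

lemma hasDerivAt_tanh' (x : ℝ) : HasDerivAt Real.tanh (1 - Real.tanh x^2) x := by
  have hc := (Real.cosh_pos x).ne'
  have h := (Real.hasDerivAt_sinh x).div (Real.hasDerivAt_cosh x) hc
  have e : Real.tanh = fun y => Real.sinh y / Real.cosh y := by
    ext y; exact Real.tanh_eq_sinh_div_cosh y
  rw [e]
  refine h.congr_deriv ?_
  field_simp

lemma bb_hasDeriv (i : ℕ) (x : ℝ) : HasDerivAt (bb i) (bb (i+1) x) x := by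
  have hc := (Real.cosh_pos x).ne'
  have h1 : HasDerivAt (fun y => 1/(2*Real.cosh y)) (-(1/(2*Real.cosh x)) * Real.tanh x) x := by
    have := ((Real.hasDerivAt_cosh x).const_mul 2).inv (by positivity)
    have e : (fun y => 1/(2*Real.cosh y)) = (fun y => 2*Real.cosh y)⁻¹ := by ext y; simp
    rw [e]
    refine this.congr_deriv ?_
    rw [Real.tanh_eq_sinh_div_cosh]; field_simp
  have h2 : HasDerivAt (fun y => Polynomial.aeval (Real.tanh y) (bp i)) (Polynomial.aeval (Real.tanh x) (Polynomial.derivative (bp i)) * (1 - Real.tanh x^2)) x := 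
    ((bp i).hasDerivAt_aeval (Real.tanh x)).comp x (hasDerivAt_tanh' x)
  have h3 := h1.mul h2
  refine h3.congr_deriv ?_
  simp only [bb, bp, map_add, map_mul, map_neg, map_sub, map_one, map_pow, Polynomial.aeval_X]
  ring

lemma bb_bound (i : ℕ) : ∃ C, 0 ≤ C ∧ ∀ x, |bb i x| ≤ C * Real.exp (-|x|) := by
  obtain ⟨C, hC⟩ : ∃ C, ∀ y ∈ Set.Icc (-1:ℝ) 1, |Polynomial.aeval y (bp i)| ≤ C := by
    obtain ⟨C, hC⟩ := (isCompact_Icc (a := (-1:ℝ)) (b := 1)).exists_bound_of_continuousOn (f := fun y => Polynomial.aeval y (bp i)) (by fun_prop)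
    exact ⟨C, hC⟩
  have hC0 : 0 ≤ C := le_trans (abs_nonneg _) (hC 0 (by simp))
  refine ⟨C, hC0, fun x => ?_⟩
  unfold bb
  rw [abs_mul, mul_comm]
  have h1 : Real.tanh x ∈ Set.Icc (-1:ℝ) 1 := ⟨(Real.neg_one_lt_tanh x).le, (Real.tanh_lt_one x).le⟩
  have h2 : |1/(2*Real.cosh x)| ≤ Real.exp (-|x|) := by
    have hc := Real.cosh_pos x
    rw [abs_of_pos (by positivity), Real.exp_neg, one_div]
    apply inv_anti₀ (Real.exp_pos _)
    rw [← Real.cosh_abs, Real.cosh_eq]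
    have := Real.exp_pos (-|x|)
    linarith
  exact mul_le_mul (hC _ h1) h2 (abs_nonneg _) hC0

lemma bb_neg (i : ℕ) (x : ℝ) : bb i (-x) = (-1)^i * bb i x := by
  induction i generalizing x with
  | zero => simp [bb, bp]
  | succ i ih =>
    have h1 : HasDerivAt (fun y => bb i (-y)) (-(bb (i+1) (-x))) x := by
      have := (bb_hasDeriv i (-x)).comp x (hasDerivAt_neg x)
      refine this.congr_deriv (by ring)
    have h2 : HasDerivAt (fun y => bb i (-y)) ((-1)^i * bb (i+1) x) x := by
      have := (bb_hasDeriv i x).const_mul ((-1)^i)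
      have e : (fun y => bb i (-y)) = fun y => (-1)^i * bb i y := by ext y; exact ih y
      rw [e]; exact this
    have := h1.unique h2
    rw [pow_succ]; linarith

/-- the odd character modulo 4 -/
def chi (n : ℕ) : ℝ := if n % 4 = 1 then 1 else if n % 4 = 3 then -1 else 0
def tau (n : ℕ) : ℝ := if n % 4 = 0 then 1 else if n % 4 = 2 then -1 else 0

lemma chi_abs (n : ℕ) : |chi n| ≤ 1 := by unfold chi; split_ifs <;> simp
lemma tau_abs (n : ℕ) : |tau n| ≤ 1 := by unfold tau; split_ifs <;> simp

lemma chi_add (a b : ℕ) : chi (a+b) = chi a * tau b + tau a * chi b := by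
  unfold chi tau
  rw [Nat.add_mod]
  have ha := Nat.mod_lt a (show 0 < 4 by norm_num)
  have hb := Nat.mod_lt b (show 0 < 4 by norm_num)
  generalize a % 4 = x at *
  generalize b % 4 = y at *
  interval_cases x <;> interval_cases y <;> norm_num

lemma chi_mul (a b : ℕ) : chi (a*b) = chi a * chi b := by
  unfold chi
  rw [Nat.mul_mod]
  have ha := Nat.mod_lt a (show 0 < 4 by norm_num)
  have hb := Nat.mod_lt b (show 0 < 4 by norm_num)
  generalize a % 4 = x at *
  generalize b % 4 = y at *
  interval_cases x <;> interval_cases y <;> norm_num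

lemma chi_odd (j : ℕ) : chi (2*j+1) = (-1)^j := by
  rcases Nat.even_or_odd' j with ⟨c, rfl | rfl⟩
  · have : (2*(2*c)+1) % 4 = 1 := by omega
    simp [chi, this]
  · have : (2*(2*c+1)+1) % 4 = 3 := by omega
    simp [chi, this, pow_succ]

lemma chi_even (n : ℕ) (h : ¬ Odd n) : chi n = 0 := by
  rw [Nat.odd_iff] at h
  unfold chi
  rw [if_neg (by omega), if_neg (by omega)]

lemma hasSum_chi_iff (g : ℕ → ℝ) (S : ℝ) :
    HasSum (fun d => chi d * g d) S ↔ HasSum (fun j : ℕ => (-1)^j * g (2*j+1)) S := by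
  have hinj : Function.Injective (fun j : ℕ => 2*j+1) := fun x y h => by simp at h; exact h
  rw [← hinj.hasSum_iff]
  · have : ((fun d => chi d * g d) ∘ fun j : ℕ => 2*j+1) = fun j : ℕ => (-1)^j * g (2*j+1) := by
      ext j; simp [chi_odd]
    rw [this]
  · intro x hx
    rw [chi_even, zero_mul]
    rintro ⟨k, hk⟩
    exact hx ⟨k, hk.symm⟩

lemma summable_pow_exp (k : ℕ) (x : ℝ) (hx : 0 < x) : Summable (fun c : ℕ => (c:ℝ)^k * Real.exp (-(c*x))) := by
  have := Real.summable_pow_mul_exp_neg_nat_mul k hx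
  refine this.congr ?_
  intro n; congr 2; ring

lemma bb_sum (i : ℕ) (x : ℝ) (hx : 0 < x) :
    HasSum (fun c : ℕ => chi c * ((-(c:ℝ))^i * Real.exp (-(c*x)))) (bb i x) := by
  have hsum : ∀ i : ℕ, ∀ x : ℝ, 0 < x → Summable (fun c : ℕ => chi c * ((-(c:ℝ))^i * Real.exp (-(c*x)))) := by
    intro i x hx
    refine Summable.of_norm_bounded (summable_pow_exp i x hx) ?_
    intro c
    rw [Real.norm_eq_abs, abs_mul, abs_mul, abs_pow, abs_neg, Nat.abs_cast, abs_of_pos (Real.exp_pos _)]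
    exact mul_le_of_le_one_left (by positivity) (chi_abs c)
  suffices h : ∀ x : ℝ, 0 < x → ∑' c : ℕ, chi c * ((-(c:ℝ))^i * Real.exp (-(c*x))) = bb i x by
    rw [← h x hx]; exact (hsum i x hx).hasSum
  clear hx x
  induction i with
  | zero =>
    intro x hx
    apply HasSum.tsum_eq
    rw [hasSum_chi_iff (fun c => (-(c:ℝ))^0 * Real.exp (-(c*x)))]
    have h1 : |-(Real.exp (-(2*x)))| < 1 := by
      rw [abs_neg, abs_of_pos (Real.exp_pos _), Real.exp_lt_one_iff]; linarith
    have h2 := (hasSum_geometric_of_abs_lt_one h1).mul_left (Real.exp (-x))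
    have e : Real.exp (-x) * (1 - -Real.exp (-(2*x)))⁻¹ = bb 0 x := by
      simp only [bb, bp, map_one, mul_one]
      rw [Real.cosh_eq, Real.exp_neg (2*x), Real.exp_neg x, two_mul x, Real.exp_add]
      have := Real.exp_pos x
      have h3 : 1 + Real.exp x^2 ≠ 0 := by positivity
      field_simp
      ring_nf
      field_simp
      try ring
    rw [e] at h2
    refine h2.congr_fun ?_
    intro j
    rw [neg_pow (Real.exp (-(2*x))) j, ← Real.exp_nat_mul, pow_zero, one_mul, mul_left_comm, ← Real.exp_add]
    congr 2; push_cast; ring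
  | succ i ih =>
    intro x hx
    have hopen : IsOpen (Set.Ioi (x/2)) := isOpen_Ioi
    have hd : HasDerivAt (fun y => ∑' c : ℕ, chi c * ((-(c:ℝ))^i * Real.exp (-(c*y)))) (∑' c : ℕ, chi c * ((-(c:ℝ))^(i+1) * Real.exp (-(c*x)))) x := by
      apply hasDerivAt_tsum_of_isPreconnected (u := fun c : ℕ => (c:ℝ)^(i+1) * Real.exp (-(c*(x/2)))) (t := Set.Ioi (x/2)) (y₀ := x)
        (g := fun c y => chi c * ((-(c:ℝ))^i * Real.exp (-(c*y)))) (g' := fun c y => chi c * ((-(c:ℝ))^(i+1) * Real.exp (-(c*y))))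
      · exact summable_pow_exp (i+1) (x/2) (by linarith)
      · exact hopen
      · exact isPreconnected_Ioi
      · intro c y _
        have h1 : HasDerivAt (fun y => Real.exp (-((c:ℝ)*y))) (Real.exp (-(c*y)) * (-(c*1))) y :=
          (((hasDerivAt_id y).const_mul (c:ℝ)).neg).exp
        refine ((h1.const_mul ((-(c:ℝ))^i)).const_mul (chi c)).congr_deriv ?_
        ring
      · intro c y hy
        rw [Set.mem_Ioi] at hy
        rw [Real.norm_eq_abs, abs_mul, abs_mul, abs_pow, abs_neg, Nat.abs_cast, abs_of_pos (Real.exp_pos _)]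
        refine (mul_le_of_le_one_left (by positivity) (chi_abs c)).trans ?_
        gcongr
      · rw [Set.mem_Ioi]; linarith
      · exact hsum i x hx
      · rw [Set.mem_Ioi]; linarith
    have hd2 : HasDerivAt (fun y => ∑' c : ℕ, chi c * ((-(c:ℝ))^i * Real.exp (-(c*y)))) (bb (i+1) x) x := by
      refine (bb_hasDeriv i x).congr_of_eventuallyEq ?_
      filter_upwards [isOpen_Ioi.mem_nhds hx] with y hy
      exact ih y hy
    exact hd.unique hd2


/-- iterated differences of `bb i` with step `2 * t` -/
def NN (t : ℝ) : ℕ → ℕ → ℝ → ℝ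
  | 0, i, x => bb i x
  | (M+1), i, x => NN t M i x - NN t M i (x+2*t)

lemma NN_hasDeriv (t : ℝ) (M i : ℕ) (x : ℝ) : HasDerivAt (NN t M i) (NN t M (i+1) x) x := by
  induction M generalizing x with
  | zero => exact bb_hasDeriv i x
  | succ M ih =>
    have h2 : HasDerivAt (fun y => NN t M i (y+2*t)) (NN t M (i+1) (x+2*t)) x :=
      (ih (x+2*t)).comp_add_const x (2*t)
    exact (ih x).sub h2

lemma NN_bound (M i : ℕ) : ∃ C, 0 ≤ C ∧ ∀ t, 0 < t → t ≤ 1 → ∀ x, |NN t M i x| ≤ C * t^M * Real.exp (-|x|) := by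
  induction M generalizing i with
  | zero =>
    obtain ⟨C, h0, hC⟩ := bb_bound i
    exact ⟨C, h0, fun t _ _ x => by simpa [NN] using hC x⟩
  | succ M ih =>
    obtain ⟨C, h0, hC⟩ := ih (i+1)
    refine ⟨C * Real.exp 2 * 2, by positivity, fun t ht ht1 x => ?_⟩
    have key := Convex.norm_image_sub_le_of_norm_hasDerivWithin_le (f := NN t M i) (f' := NN t M (i+1)) (s := Set.Icc x (x+2*t)) (x := x+2*t) (y := x) (C := C * t^M * (Real.exp 2 * Real.exp (-|x|)))
      (fun z _ => (NN_hasDeriv t M i z).hasDerivWithinAt)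
      (fun z hz => by
        refine (hC t ht ht1 z).trans ?_
        rw [← Real.exp_add]
        gcongr
        have h1 : |x| ≤ |z| + |x - z| := by
          have := abs_add_le z (x-z); simpa using this
        have h2 : |x - z| ≤ 2 := by
          rw [abs_le]; constructor <;> linarith [hz.1, hz.2]
        linarith) (convex_Icc _ _) ⟨by linarith, le_refl _⟩ ⟨le_refl _, by linarith⟩
    show |NN t M i x - NN t M i (x+2*t)| ≤ _
    rw [Real.norm_eq_abs, Real.norm_eq_abs] at key
    have h3 : |x - (x+2*t)| = 2*t := by rw [show x - (x+2*t) = -(2*t) by ring, abs_neg, abs_of_pos (by linarith)]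
    rw [h3] at key
    refine key.trans (le_of_eq ?_)
    ring

lemma geo_odd (t : ℝ) (ht : 0 < t) : Summable (fun j : ℕ => Real.exp (-((2*j+1)*t))) ∧ ∑' j : ℕ, Real.exp (-((2*j+1)*t)) ≤ 1/(2*t) := by
  have h1 : |Real.exp (-(2*t))| < 1 := by
    rw [abs_of_pos (Real.exp_pos _), Real.exp_lt_one_iff]; linarith
  have h2 := (hasSum_geometric_of_abs_lt_one h1).mul_left (Real.exp (-t))
  have h3 : HasSum (fun j : ℕ => Real.exp (-((2*j+1)*t))) (Real.exp (-t) * (1 - Real.exp (-(2*t)))⁻¹) := by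
    refine h2.congr_fun fun j => ?_
    rw [← Real.exp_nat_mul, ← Real.exp_add]; congr 1; ring
  refine ⟨h3.summable, ?_⟩
  rw [h3.tsum_eq]
  have e : Real.exp (-t) * (1 - Real.exp (-(2*t)))⁻¹ = 1/(2*Real.sinh t) := by
    have h4 : Real.exp (-(2*t)) = Real.exp (-t) * Real.exp (-t) := by rw [← Real.exp_add]; congr 1; ring
    have h5 : 1 = Real.exp (-t) * Real.exp t := by rw [← Real.exp_add]; simp
    have h6 : 1 - Real.exp (-(2*t)) = Real.exp (-t) * (2*Real.sinh t) := by
      rw [h4, Real.sinh_eq]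
      linear_combination h5
    rw [h6, mul_inv, ← mul_assoc, mul_inv_cancel₀ (Real.exp_pos _).ne', one_mul, one_div]
  rw [e]
  have := (Real.self_le_sinh_iff (x := t)).2 ht.le
  apply one_div_le_one_div_of_le (by linarith); linarith

def VN (M i : ℕ) (t y : ℝ) : ℝ := ∑' j : ℕ, (-1)^j * NN t M i (y+(2*j+1)*t)

def VV (i : ℕ) (t y : ℝ) : ℝ := VN 0 i t y

lemma VN_term (M i : ℕ) : ∃ C, 0 ≤ C ∧ ∀ t, 0 < t → t ≤ 1 → ∀ y, ∀ j : ℕ, ‖(-1)^j * NN t M i (y+(2*j+1)*t)‖ ≤ C * t^M * Real.exp (-y) * Real.exp (-((2*j+1)*t)) := by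
  obtain ⟨C, h0, hC⟩ := NN_bound M i
  refine ⟨C, h0, fun t ht ht1 y j => ?_⟩
  rw [norm_mul, norm_pow, norm_neg, norm_one, one_pow, one_mul, Real.norm_eq_abs]
  refine (hC t ht ht1 _).trans ?_
  rw [mul_assoc (C*t^M), ← Real.exp_add]
  gcongr
  have := le_abs_self (y + (2*j+1)*t)
  linarith

lemma VN_summable (M i : ℕ) (t : ℝ) (ht : 0 < t) (ht1 : t ≤ 1) (y : ℝ) : Summable (fun j : ℕ => (-1)^j * NN t M i (y+(2*j+1)*t)) := by
  obtain ⟨C, h0, hC⟩ := VN_term M i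
  exact Summable.of_norm_bounded ((geo_odd t ht).1.mul_left _) (hC t ht ht1 y)

lemma VN_bound (M i : ℕ) : ∃ C, 0 ≤ C ∧ ∀ t, 0 < t → t ≤ 1 → ∀ y, 0 ≤ y → |VN (M+1) i t y| ≤ C * t^M := by
  obtain ⟨C, h0, hC⟩ := VN_term (M+1) i
  refine ⟨C, h0, fun t ht ht1 y hy => ?_⟩
  have h1 := tsum_of_norm_bounded (((geo_odd t ht).1.mul_left (C*t^(M+1)*Real.exp (-y))).hasSum) (hC t ht ht1 y)
  rw [Real.norm_eq_abs] at h1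
  refine h1.trans ?_
  rw [tsum_mul_left]
  have h2 := (geo_odd t ht).2
  have h3 : Real.exp (-y) ≤ 1 := by rw [Real.exp_le_one_iff]; linarith
  calc _ ≤ C*t^(M+1)*1 * (1/(2*t)) := by gcongr
    _ = C * t^M * (1/2) := by field_simp; ring
    _ ≤ _ := by nlinarith [mul_nonneg h0 (pow_nonneg ht.le M)]

lemma VN_step (M i : ℕ) (t : ℝ) (ht : 0 < t) (ht1 : t ≤ 1) (y : ℝ) :
    2 * VN M i t y = NN t M i (y+t) + VN (M+1) i t y := by
  have hs := VN_summable M i t ht ht1 y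
  have h1 := hs.tsum_eq_zero_add
  have h2 : VN (M+1) i t y = VN M i t y + ∑' j : ℕ, (-1)^(j+1) * NN t M i (y+(2*((j+1:ℕ):ℝ)+1)*t) := by
    unfold VN
    rw [← Summable.tsum_add hs ((summable_nat_add_iff 1).2 hs)]
    congr 1; ext j
    simp only [NN]
    rw [show y + (2*((j+1:ℕ):ℝ)+1)*t = y + (2*j+1)*t+2*t by push_cast; ring]
    ring
  have h3 : VN M i t y = NN t M i (y+t) + ∑' j : ℕ, (-1)^(j+1) * NN t M i (y+(2*((j+1:ℕ):ℝ)+1)*t) := by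
    unfold VN
    rw [h1]; simp
  linarith

lemma VV_bound (i : ℕ) : ∃ C, 0 ≤ C ∧ ∀ t, 0 < t → t ≤ 1 → ∀ y, 0 ≤ y → |VV i t y| ≤ C := by
  obtain ⟨C, h0, hC⟩ := VN_bound 0 i
  obtain ⟨D, d0, hD⟩ := bb_bound i
  refine ⟨C + D, by positivity, fun t ht ht1 y hy => ?_⟩
  have h1 := VN_step 0 i t ht ht1 y
  have h2 := hC t ht ht1 y hy
  have h3 : |bb i (y+t)| ≤ D := (hD _).trans (mul_le_of_le_one_right d0 (by rw [Real.exp_le_one_iff]; simp))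
  have h4 : NN t 0 i (y+t) = bb i (y+t) := rfl
  rw [h4] at h1
  rw [pow_zero, mul_one] at h2
  show |VN 0 i t y| ≤ _
  rw [abs_le] at *
  constructor <;> linarith [h2.1, h2.2, h3.1, h3.2]

lemma VV_lim (i : ℕ) : ∃ C, 0 ≤ C ∧ ∀ t, 0 < t → t ≤ 1 → |VV i t 0 - bb i 0 / 2| ≤ C * t := by
  obtain ⟨C, h0, hC⟩ := VN_bound 1 i
  obtain ⟨D, d0, hD⟩ := NN_bound 1 i
  obtain ⟨E, e0, hE⟩ := bb_bound (i+1)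
  refine ⟨C + D + E, by positivity, fun t ht ht1 => ?_⟩
  have h1 := VN_step 0 i t ht ht1 0
  have h2 := VN_step 1 i t ht ht1 0
  have h3 := hC t ht ht1 0 le_rfl
  have h4 : |NN t 1 i (0+t)| ≤ D * t^1 := (hD t ht ht1 _).trans (mul_le_of_le_one_right (by positivity) (by rw [Real.exp_le_one_iff]; simp))
  have h5 := Convex.norm_image_sub_le_of_norm_hasDerivWithin_le (f := bb i) (f' := bb (i+1)) (s := Set.univ) (x := 0) (y := 0+t) (C := E)
      (fun z _ => (bb_hasDeriv i z).hasDerivWithinAt)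
      (fun z hz => (hE _).trans (mul_le_of_le_one_right e0 (by rw [Real.exp_le_one_iff]; simp))) convex_univ trivial trivial
  have h6 : NN t 0 i (0+t) = bb i (0+t) := rfl
  rw [Real.norm_eq_abs, Real.norm_eq_abs, show 0 + t - 0 = t by ring, abs_of_pos ht] at h5
  show |VN 0 i t 0 - bb i 0/2| ≤ _
  have : 0 ≤ C * t := by positivity
  have : 0 ≤ D * t := by positivity
  have : 0 ≤ E * t := by positivity
  rw [pow_one] at h3 h4
  rw [h6] at h1
  simp only [zero_add] at *
  rw [abs_le] at *
  constructor <;> linarith [h3.1, h3.2, h4.1, h4.2, h5.1, h5.2]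

lemma VV_deriv (i : ℕ) (t : ℝ) (ht : 0 < t) (ht1 : t ≤ 1) (y : ℝ) (hy : 0 ≤ y) : HasDerivAt (VV i t) (VV (i+1) t y) y := by
  obtain ⟨C, h0, hC⟩ := VN_term 0 (i+1)
  apply hasDerivAt_tsum_of_isPreconnected (u := fun j : ℕ => C * t^0 * Real.exp 1 * Real.exp (-((2*j+1)*t))) (t := Set.Ioi (-1)) (y₀ := y)
    (g := fun j y => (-1)^j * NN t 0 i (y+(2*j+1)*t)) (g' := fun j y => (-1)^j * NN t 0 (i+1) (y+(2*j+1)*t))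
  · exact (geo_odd t ht).1.mul_left _
  · exact isOpen_Ioi
  · exact isPreconnected_Ioi
  · intro j z _
    exact ((NN_hasDeriv t 0 i (z + (2*j+1)*t)).comp_add_const z ((2*j+1)*t)).const_mul _
  · intro j z hz
    refine (hC t ht ht1 z j).trans ?_
    rw [Set.mem_Ioi] at hz
    gcongr
    linarith
  · rw [Set.mem_Ioi]; linarith
  · exact VN_summable 0 i t ht ht1 y
  · rw [Set.mem_Ioi]; linarith

lemma taylor_chain (n : ℕ) (F : ℕ → ℝ → ℝ) (hF : ∀ ν y, 0 ≤ y → HasDerivAt (F ν) (F (ν+1) y) y) (C : ℝ) (h0 : 0 ≤ C)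
    (hC : ∀ y, 0 ≤ y → |F n y| ≤ C) (y : ℝ) (hy : 0 ≤ y) :
    |F 0 y - ∑ ν ∈ range n, F ν 0 * y^ν / (ν.factorial : ℝ)| ≤ C * y^n := by
  induction n generalizing F y with
  | zero => simpa using hC y hy
  | succ n ih =>
    have ih' := ih (fun ν => F (ν+1)) (fun ν y hy => hF (ν+1) y hy) hC
    have key := Convex.norm_image_sub_le_of_norm_hasDerivWithin_le (f := fun z => F 0 z - ∑ ν ∈ range (n+1), F ν 0 * z^ν / (ν.factorial : ℝ))
      (f' := fun z => F 1 z - ∑ ν ∈ range n, F (ν+1) 0 * z^ν / (ν.factorial : ℝ)) (s := Set.Icc 0 y) (x := 0) (y := y) (C := C * y^n)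
      (fun z hz => by
        apply HasDerivAt.hasDerivWithinAt
        apply (hF 0 z hz.1).sub
        have h2 : HasDerivAt (fun z => ∑ ν ∈ range (n+1), F ν 0 * z^ν / (ν.factorial : ℝ)) (∑ ν ∈ range (n+1), F ν 0 * (ν * z^(ν-1)) / (ν.factorial : ℝ)) z := by
          apply HasDerivAt.fun_sum
          intro ν _
          exact ((hasDerivAt_pow ν z).const_mul (F ν 0)).div_const _
        refine h2.congr_deriv ?_
        rw [Finset.sum_range_succ']
        simp only [Nat.cast_zero, zero_mul, mul_zero, zero_div, add_zero, Nat.add_sub_cancel]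
        apply Finset.sum_congr rfl
        intro ν _
        rw [Nat.factorial_succ]
        push_cast
        have : (ν.factorial:ℝ) ≠ 0 := by positivity
        field_simp)
      (fun z hz => by
        refine (ih' z hz.1).trans ?_
        have := hz.1
        have := hz.2
        gcongr) (convex_Icc _ _) ⟨le_rfl, hy⟩ ⟨hy, le_rfl⟩
    have e0 : F 0 0 - ∑ ν ∈ range (n+1), F ν 0 * (0:ℝ)^ν / (ν.factorial : ℝ) = 0 := by
      rw [Finset.sum_range_succ']
      simp
    simp only [e0, sub_zero, Real.norm_eq_abs] at key
    rw [abs_of_nonneg hy] at key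
    refine key.trans (le_of_eq (by ring))

lemma VV_taylor (i n : ℕ) : ∃ C, 0 ≤ C ∧ ∀ t, 0 < t → t ≤ 1 → ∀ y, 0 ≤ y → 
    |VV i t y - ∑ ν ∈ range n, VV (i+ν) t 0 * y^ν / (ν.factorial : ℝ)| ≤ C * y^n := by
  obtain ⟨C, h0, hC⟩ := VV_bound (i+n)
  refine ⟨C, h0, fun t ht ht1 y hy => ?_⟩
  exact taylor_chain n (fun ν => VV (i+ν) t) (fun ν y hy => VV_deriv (i+ν) t ht ht1 y hy) C h0 (hC t ht ht1) y hy

lemma VV_odd (i : ℕ) (hi : Odd i) (M : ℕ) : ∃ C, 0 ≤ C ∧ ∀ t, 0 < t → t ≤ 1 → |VV i t 0| ≤ C * t^M := by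
  obtain ⟨C, h0, hC⟩ := NN_bound (M+1) i
  refine ⟨C, h0, fun t ht ht1 => ?_⟩
  -- two-sided sums
  have hnn : ∀ n : ℕ, (-1:ℝ)^(-((n:ℤ)+1)) = -(-1)^n := by
    intro n
    rw [zpow_neg, zpow_add₀ (by norm_num), zpow_natCast]
    rcases neg_one_pow_eq_or ℝ n with h | h <;> rw [h] <;> norm_num
  have hbd : ∀ K : ℕ, ∃ D, 0 ≤ D ∧ (∀ n : ℕ, ‖(-1:ℝ)^(n:ℤ) * NN t K i ((2*((n:ℤ):ℝ)+1)*t)‖ ≤ D * Real.exp (-((2*n+1)*t))) ∧ 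
     (∀ n : ℕ, ‖(-1:ℝ)^(-((n:ℤ)+1)) * NN t K i ((2*((-((n:ℤ)+1):ℤ):ℝ)+1)*t)‖ ≤ D * Real.exp (-((2*n+1)*t))) ∧ (K = M+1 → D = C * t^(M+1)) := by
    intro K
    obtain ⟨D, d0, hD, hD2⟩ : ∃ D, 0 ≤ D ∧ (∀ x, |NN t K i x| ≤ D * Real.exp (-|x|)) ∧ (K = M+1 → D = C * t^(M+1)) := by
      by_cases hK : K = M+1
      · subst hK; exact ⟨C * t^(M+1), by positivity, hC t ht ht1, fun _ => rfl⟩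
      · obtain ⟨D, d0, hD⟩ := NN_bound K i
        exact ⟨D * t^K, by positivity, hD t ht ht1, fun h => absurd h hK⟩
    refine ⟨D, d0, fun n => ?_, fun n => ?_, hD2⟩
    · rw [norm_mul, zpow_natCast, norm_pow, norm_neg, norm_one, one_pow, one_mul, Real.norm_eq_abs]
      refine (hD _).trans ?_
      rw [abs_of_nonneg (by push_cast; positivity)]; push_cast; exact le_rfl
    · rw [norm_mul, hnn, norm_neg, norm_pow, norm_neg, norm_one, one_pow, one_mul, Real.norm_eq_abs]
      refine (hD _).trans ?_
      rw [show (2*((-((n:ℤ)+1):ℤ):ℝ)+1)*t = -((2*n+1)*t) by push_cast; ring, abs_neg, abs_of_nonneg (by positivity)]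
  have hs : ∀ K : ℕ, Summable (fun j : ℤ => (-1:ℝ)^j * NN t K i ((2*(j:ℝ)+1)*t)) := by
    intro K
    obtain ⟨D, d0, h1, h2, -⟩ := hbd K
    have s1 := Summable.of_norm_bounded ((geo_odd t ht).1.mul_left D) h1
    have s2 := Summable.of_norm_bounded ((geo_odd t ht).1.mul_left D) h2
    exact (HasSum.of_nat_of_neg_add_one (f := fun j : ℤ => (-1:ℝ)^j * NN t K i ((2*(j:ℝ)+1)*t)) s1.hasSum s2.hasSum).summable
  set Φ : ℕ → ℝ := fun K => ∑' j : ℤ, (-1:ℝ)^j * NN t K i ((2*(j:ℝ)+1)*t) with hΦ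
  have hstep : ∀ K, Φ (K+1) = 2 * Φ K := by
    intro K
    have h1 : ∑' j : ℤ, (-1:ℝ)^(j+1) * NN t K i ((2*((j+1:ℤ):ℝ)+1)*t) = Φ K :=
      (Equiv.addRight (1:ℤ)).tsum_eq (fun j : ℤ => (-1:ℝ)^j * NN t K i ((2*(j:ℝ)+1)*t))
    have hs2 : Summable (fun j : ℤ => (-1:ℝ)^(j+1) * NN t K i ((2*((j+1:ℤ):ℝ)+1)*t)) :=
      (Equiv.addRight (1:ℤ)).summable_iff.2 (hs K)
    have h2 : Φ (K+1) = Φ K + ∑' j : ℤ, (-1:ℝ)^(j+1) * NN t K i ((2*((j+1:ℤ):ℝ)+1)*t) := by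
      simp only [hΦ]
      rw [← Summable.tsum_add (hs K) hs2]
      congr 1; ext j
      simp only [NN]
      rw [show (2*((j+1:ℤ):ℝ)+1)*t = (2*j+1)*t+2*t by push_cast; ring, zpow_add₀ (by norm_num), zpow_one]
      ring
    rw [h2, h1]; ring
  have hpow : ∀ K, Φ K = 2^K * Φ 0 := by
    intro K
    induction K with
    | zero => simp
    | succ K ih => rw [hstep, ih]; ring
  have hz : Φ 0 = 2 * VV i t 0 := by
    have s1 := (VN_summable 0 i t ht ht1 0).hasSum
    have a1 : HasSum (fun n : ℕ => (-1:ℝ)^(n:ℤ) * NN t 0 i ((2*((n:ℤ):ℝ)+1)*t)) (VV i t 0) := by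
      refine s1.congr_fun fun j => ?_
      rw [zpow_natCast, zero_add]; push_cast; rfl
    have a2 : HasSum (fun n : ℕ => (-1:ℝ)^(-((n:ℤ)+1)) * NN t 0 i ((2*((-((n:ℤ)+1):ℤ):ℝ)+1)*t)) (VV i t 0) := by
      refine s1.congr_fun fun j => ?_
      rw [hnn, show (2*((-((j:ℤ)+1):ℤ):ℝ)+1)*t = -((2*j+1)*t) by push_cast; ring, zero_add]
      simp only [NN]
      rw [bb_neg, hi.neg_one_pow]; ring
    have := (HasSum.of_nat_of_neg_add_one (f := fun j : ℤ => (-1:ℝ)^j * NN t 0 i ((2*(j:ℝ)+1)*t)) a1 a2).tsum_eq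
    simp only [hΦ]
    rw [this]; ring
  have hfin : |Φ (M+1)| ≤ C * t^M := by
    obtain ⟨D, d0, h1, h2, h3⟩ := hbd (M+1)
    rw [h3 rfl] at h1 h2
    have g := (geo_odd t ht).1.mul_left (C * t^(M+1))
    have s1 := Summable.of_norm_bounded g h1
    have s2 := Summable.of_norm_bounded g h2
    have b1 := tsum_of_norm_bounded g.hasSum h1
    have b2 := tsum_of_norm_bounded g.hasSum h2
    have := (HasSum.of_nat_of_neg_add_one (f := fun j : ℤ => (-1:ℝ)^j * NN t (M+1) i ((2*(j:ℝ)+1)*t)) s1.hasSum s2.hasSum).tsum_eq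
    simp only [hΦ]
    rw [this]
    have b3 : ∑' j : ℕ, C * t^(M+1) * Real.exp (-((2*j+1)*t)) ≤ C * t^M / 2 := by
      rw [tsum_mul_left]
      calc _ ≤ C*t^(M+1) * (1/(2*t)) := by gcongr; exact (geo_odd t ht).2
        _ = _ := by field_simp; ring
    rw [Real.norm_eq_abs] at b1 b2
    refine (abs_add_le _ _).trans ?_
    linarith
  have e1 : Φ (M+1) = 2^(M+2) * VV i t 0 := by rw [hpow, hz]; ring
  have e2 : (1:ℝ) ≤ 2^(M+2) := one_le_pow₀ (by norm_num)
  rw [e1, abs_mul, abs_of_pos (by positivity)] at hfin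
  nlinarith [abs_nonneg (VV i t 0)]


def pw (k c : ℕ) : ℝ := if c = 0 then 0 else (c:ℝ)^k

lemma pw_nonneg (k c : ℕ) : 0 ≤ pw k c := by unfold pw; split_ifs <;> positivity
lemma pw_le (k c : ℕ) : pw k c ≤ (c:ℝ)^k := by unfold pw; split_ifs <;> first | positivity | exact le_rfl
lemma pw_pos (k c : ℕ) (hk : k ≠ 0) : pw k c = (c:ℝ)^k := by
  unfold pw; split_ifs with h
  · simp [h, hk]
  · rfl
lemma pw_mul (k b c : ℕ) (hb : b ≠ 0) : pw k (b*c) = (b:ℝ)^k * pw k c := by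
  unfold pw
  by_cases h : c = 0
  · simp [h]
  · rw [if_neg (mul_ne_zero hb h), if_neg h]; push_cast; ring

def lm (k : ℕ) (x : ℝ) : ℝ := ∑' c : ℕ, pw k c * Real.exp (-(c*x))

lemma lm_summable (k : ℕ) (x : ℝ) (hx : 0 < x) : Summable (fun c : ℕ => pw k c * Real.exp (-(c*x))) := by
  refine Summable.of_nonneg_of_le (fun c => mul_nonneg (pw_nonneg _ _) (Real.exp_pos _).le) (fun c => ?_) (summable_pow_exp k x hx)
  exact mul_le_mul_of_nonneg_right (pw_le _ _) (Real.exp_pos _).le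

lemma lm_mult (k b : ℕ) (hb : b ≠ 0) (x : ℝ) (hx : 0 < x) :
    HasSum (fun c : ℕ => (if b ∣ c then 1 else 0) * (pw k c * Real.exp (-(c*x)))) ((b:ℝ)^k * lm k (b*x)) := by
  have hb0 : (0:ℝ) < b := by positivity
  have h := ((lm_summable k (b*x) (by positivity)).hasSum).mul_left ((b:ℝ)^k)
  have hinj : Function.Injective (fun j : ℕ => b*j) := fun x y h => Nat.eq_of_mul_eq_mul_left (Nat.pos_of_ne_zero hb) h
  rw [← hinj.hasSum_iff]
  · refine h.congr_fun fun j => ?_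
    simp only [Function.comp, dvd_mul_right, if_true, one_mul]
    rw [pw_mul k b j hb]; push_cast
    rw [mul_assoc]; congr 3; ring
  · intro c hc
    rw [if_neg, zero_mul]
    rintro ⟨j, rfl⟩
    exact hc ⟨j, rfl⟩

lemma lm_small (k : ℕ) (hk : 2 ≤ k) : ∃ C, 0 ≤ C ∧ ∀ x, 0 < x → |lm k x - k.factorial / x^(k+1)| ≤ C := by
  have hsum2 : Summable (fun n : ℤ => 1/|(n:ℝ)|^2) := by
    have := Real.summable_one_div_int_pow (p := 2)
    refine (this.2 (by norm_num)).congr fun n => ?_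
    rw [sq_abs]
  refine ⟨k.factorial * ∑' n : ℤ, 1/|(n:ℝ)|^2, by positivity, fun x hx => ?_⟩
  have hpi := Real.pi_pos
  let z : ℍ := ⟨(x/(2*Real.pi) : ℝ) * Complex.I, by
    rw [Complex.im_ofReal_mul, Complex.I_im, mul_one]; positivity⟩
  have hz : (z : ℂ) = (x/(2*Real.pi) : ℝ) * Complex.I := rfl
  have hid := EisensteinSeries.qExpansion_identity (k := k) (by omega) z
  have hpc : (Real.pi:ℂ) ≠ 0 := by exact_mod_cast hpi.ne'
  have hI : Complex.I ≠ 0 := Complex.I_ne_zero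
  have hexp : Complex.exp (2 * Real.pi * Complex.I * z) = Complex.exp (-(x:ℂ)) := by
    rw [hz]; congr 1; push_cast
    field_simp
    linear_combination (x:ℂ) * Complex.I_sq
  have hlm : (∑' n : ℕ, (n:ℂ)^k * Complex.exp (2 * Real.pi * Complex.I * z)^n) = (lm k x : ℂ) := by
    unfold lm
    rw [Complex.ofReal_tsum]
    congr 1; ext n
    rw [hexp, pw_pos k n (by omega), ← Complex.exp_nat_mul]; push_cast
    congr 2; ring
  have hterm : ∀ n : ℤ, 1/((z:ℂ)+n)^(k+1) = (-2*Real.pi*Complex.I)^(k+1) * (1/((x:ℂ) - 2*Real.pi*Complex.I*n)^(k+1)) := by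
    intro n
    have e : (-2*Real.pi*Complex.I) * ((z:ℂ)+n) = (x:ℂ) - 2*Real.pi*Complex.I*n := by
      rw [hz]; push_cast; field_simp
      linear_combination -(x:ℂ) * Complex.I_sq
    rw [← e, mul_pow (-2*Real.pi*Complex.I)]
    have h1 : (-2*Real.pi*Complex.I)^(k+1) ≠ 0 := pow_ne_zero _ (by simp [hpc])
    rw [one_div, one_div, mul_inv, mul_inv_cancel_left₀ h1]
  have hkf : (k.factorial : ℂ) ≠ 0 := by exact_mod_cast k.factorial_ne_zero
  have h1 : (-2*Real.pi*Complex.I)^(k+1) ≠ 0 := pow_ne_zero _ (by simp [hpc])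
  rw [hlm] at hid
  simp only [hterm] at hid
  rw [tsum_mul_left] at hid
  have hmain : (lm k x : ℂ) = k.factorial * ∑' n : ℤ, 1/((x:ℂ) - 2*Real.pi*Complex.I*n)^(k+1) := by
    have h2 : (-2*Real.pi*Complex.I)^(k+1) * (∑' n : ℤ, 1/((x:ℂ) - 2*Real.pi*Complex.I*n)^(k+1)) = (-2*Real.pi*Complex.I)^(k+1) * ((lm k x : ℂ) / k.factorial) := by
      rw [hid]; ring
    have h3 := mul_left_cancel₀ h1 h2
    rw [h3]; field_simp
  -- bound on terms
  have hb : ∀ n : ℤ, ‖(if n = 0 then 0 else 1/((x:ℂ) - 2*Real.pi*Complex.I*n)^(k+1))‖ ≤ 1/|(n:ℝ)|^2 := by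
    intro n
    split_ifs with hn
    · simp [hn]
    · have hn1 : (1:ℝ) ≤ |(n:ℝ)| := by exact_mod_cast Int.one_le_abs hn
      have hge : |(n:ℝ)| ≤ ‖(x:ℂ) - 2*Real.pi*Complex.I*n‖ := by
        refine le_trans ?_ (Complex.abs_im_le_norm _)
        simp [abs_mul, abs_of_pos hpi]
        have := Real.pi_gt_three
        nlinarith
      rw [norm_div, norm_one, norm_pow]
      apply one_div_le_one_div_of_le (by positivity)
      calc |(n:ℝ)|^2 ≤ |(n:ℝ)|^(k+1) := pow_le_pow_right₀ hn1 (by omega)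
        _ ≤ _ := by gcongr
  have hs' : Summable (fun n : ℤ => (if n = 0 then 0 else 1/((x:ℂ) - 2*Real.pi*Complex.I*n)^(k+1))) := Summable.of_norm_bounded hsum2 hb
  have hsplit : ∑' n : ℤ, 1/((x:ℂ) - 2*Real.pi*Complex.I*n)^(k+1) = 1/(x:ℂ)^(k+1) + ∑' n : ℤ, (if n = 0 then 0 else 1/((x:ℂ) - 2*Real.pi*Complex.I*n)^(k+1)) := by
    have a1 : HasSum (fun n : ℤ => if n = 0 then 1/(x:ℂ)^(k+1) else 0) (1/(x:ℂ)^(k+1)) := hasSum_ite_eq 0 _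
    have := (a1.add hs'.hasSum).tsum_eq
    rw [← this]
    congr 1; ext n
    split_ifs with hn
    · simp [hn]
    · simp
  have hb2 := tsum_of_norm_bounded hsum2.hasSum hb
  rw [hsplit] at hmain
  have e : ((lm k x - k.factorial / x^(k+1) : ℝ) : ℂ) = k.factorial * ∑' n : ℤ, (if n = 0 then 0 else 1/((x:ℂ) - 2*Real.pi*Complex.I*n)^(k+1)) := by
    push_cast
    rw [hmain]; ring
  rw [← Real.norm_eq_abs, ← Complex.norm_real, e, norm_mul, Complex.norm_natCast]
  gcongr

lemma lm_main (k : ℕ) (hk : 2 ≤ k) : ∃ C, 0 ≤ C ∧ ∀ x, 0 < x → |lm k x - k.factorial / x^(k+1)| ≤ C / x^2 := by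
  obtain ⟨C, h0, hC⟩ := lm_small k hk
  set E := ∑' c : ℕ, (c:ℝ)^k * Real.exp (-(c*(1/2))) with hE
  have hEs := summable_pow_exp k (1/2) (by norm_num)
  have hE0 : 0 ≤ E := tsum_nonneg fun c => by positivity
  refine ⟨C + 8*E + k.factorial, by positivity, fun x hx => ?_⟩
  rcases le_total x 1 with h1 | h1
  · refine (hC x hx).trans ?_
    rw [le_div_iff₀ (by positivity)]
    have : x^2 ≤ 1 := by nlinarith
    have : (0:ℝ) ≤ k.factorial := by positivity
    nlinarith
  · have h2 : lm k x ≤ Real.exp (-(x/2)) * E := by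
      rw [hE, ← tsum_mul_left]
      refine Summable.tsum_le_tsum (fun c => ?_) (lm_summable k x hx) (hEs.mul_left _)
      by_cases hc : c = 0
      · subst hc
        simp [pw]
        positivity
      · have hc1 : (1:ℝ) ≤ c := by exact_mod_cast Nat.one_le_iff_ne_zero.2 hc
        calc _ ≤ (c:ℝ)^k * Real.exp (-(c*x)) := mul_le_mul_of_nonneg_right (pw_le _ _) (Real.exp_pos _).le
          _ ≤ (c:ℝ)^k * (Real.exp (-(x/2)) * Real.exp (-(c*(1/2)))) := by
            rw [← Real.exp_add]; gcongr; nlinarith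
          _ = _ := by ring
    have h3 : Real.exp (-(x/2)) ≤ 8/x^2 := by
      rw [Real.exp_neg, ← one_div, div_le_div_iff₀ (Real.exp_pos _) (by positivity)]
      have := Real.quadratic_le_exp_of_nonneg (x := x/2) (by positivity)
      nlinarith
    have h4 : 0 ≤ lm k x := tsum_nonneg fun c => mul_nonneg (pw_nonneg _ _) (Real.exp_pos _).le
    have h5 : (k.factorial:ℝ)/x^(k+1) ≤ k.factorial/x^2 := by
      gcongr
      omega
    have h6 : lm k x ≤ 8*E/x^2 := by
      refine h2.trans ?_
      calc _ ≤ 8/x^2*E := by gcongr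
        _ = _ := by ring
    have h7 : 0 ≤ (k.factorial:ℝ)/x^(k+1) := by positivity
    have h8 : (C + 8*E + k.factorial)/x^2 = C/x^2 + 8*E/x^2 + k.factorial/x^2 := by ring
    have h9 : 0 ≤ C/x^2 := by positivity
    have h10 : 0 ≤ 8*E/x^2 := by positivity
    rw [h8, abs_le]
    constructor <;> linarith

lemma lm_zero (x : ℝ) (hx : 0 < x) : lm 0 x ≤ 2/x^2 := by
  have h1 : |Real.exp (-x)| < 1 := by
    rw [abs_of_pos (Real.exp_pos _), Real.exp_lt_one_iff]; linarith
  have h2 := (hasSum_geometric_of_abs_lt_one h1).mul_left (Real.exp (-x))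
  have h3 := (lm_summable 0 x hx).tsum_eq_zero_add
  have h4 : lm 0 x = Real.exp (-x) * (1 - Real.exp (-x))⁻¹ := by
    unfold lm
    rw [h3, ← h2.tsum_eq]
    simp only [pw, if_true, zero_mul, zero_add]
    congr 1; ext c
    rw [if_neg (by omega), pow_zero, one_mul, ← Real.exp_nat_mul, ← Real.exp_add]
    congr 1; push_cast; ring
  have h5 : Real.exp (-x) * (1 - Real.exp (-x))⁻¹ = 1/(Real.exp x - 1) := by
    have : Real.exp (-x) * Real.exp x = 1 := by rw [← Real.exp_add]; simp
    have h6 : 1 - Real.exp (-x) = Real.exp (-x) * (Real.exp x - 1) := by linear_combination -this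
    rw [h6, mul_inv, ← mul_assoc, mul_inv_cancel₀ (Real.exp_pos _).ne', one_mul, one_div]
  rw [h4, h5]
  have := Real.quadratic_le_exp_of_nonneg (x := x) hx.le
  rw [div_le_div_iff₀ (by nlinarith) (by positivity)]
  nlinarith

/-- the sums `∑ τ(cN) c^k e^{-cNt}` -/
def At (k N : ℕ) (t : ℝ) : ℝ := ∑' c : ℕ, tau (c*N) * (pw k c * Real.exp (-(c*(N*t))))

lemma At_term_le (k N : ℕ) (t : ℝ) (c : ℕ) : ‖tau (c*N) * (pw k c * Real.exp (-(c*(N*t))))‖ ≤ pw k c * Real.exp (-(c*(N*t))) := by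
  rw [Real.norm_eq_abs, abs_mul, abs_of_nonneg (mul_nonneg (pw_nonneg _ _) (Real.exp_pos _).le)]
  exact mul_le_of_le_one_left (mul_nonneg (pw_nonneg _ _) (Real.exp_pos _).le) (tau_abs _)

lemma At_zero (N : ℕ) (hN : 0 < N) (t : ℝ) (ht : 0 < t) : |At 0 N t| ≤ 2/(N*t)^2 := by
  have hx : 0 < (N:ℝ)*t := by positivity
  have := tsum_of_norm_bounded (lm_summable 0 (N*t) hx).hasSum (At_term_le 0 N t)
  exact this.trans (lm_zero _ hx)

lemma At_cases (k N : ℕ) (hN : 0 < N) (t : ℝ) (ht : 0 < t) :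
    At k N t = if 4 ∣ N then lm k (N*t) else if 2 ∣ N then 2*(2^k * lm k (2*(N*t))) - lm k (N*t)
      else 2*(4^k * lm k (4*(N*t))) - 2^k * lm k (2*(N*t)) := by
  have hx : 0 < (N:ℝ)*t := by positivity
  have h1 := (lm_summable k (N*t) hx).hasSum
  have h2 := lm_mult k 2 (by norm_num) (N*t) hx
  have h4 := lm_mult k 4 (by norm_num) (N*t) hx
  push_cast at h2 h4
  have hm : ∀ c, (c*N) % 4 = ((c%4)*(N%4))%4 := fun c => Nat.mul_mod _ _ _
  split_ifs with hd4 hd2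
  · apply HasSum.tsum_eq
    refine h1.congr_fun fun c => ?_
    have : (c*N)%4 = 0 := Nat.mod_eq_zero_of_dvd (Dvd.dvd.mul_left hd4 c)
    simp [tau, this]
  · apply HasSum.tsum_eq
    refine ((h2.mul_left 2).sub h1).congr_fun fun c => ?_
    have hN4 : N % 4 = 2 := by omega
    have hc := hm c
    rw [hN4] at hc
    by_cases h : 2 ∣ c
    · have : (c*N)%4 = 0 := by omega
      simp [tau, this, h]; ring
    · have : (c*N)%4 = 2 := by omega
      simp [tau, this, h]
  · apply HasSum.tsum_eq
    refine ((h4.mul_left 2).sub h2).congr_fun fun c => ?_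
    have hc := hm c
    have hN4 : N % 4 = 1 ∨ N % 4 = 3 := by omega
    by_cases h : 4 ∣ c
    · have h2 : 2 ∣ c := by omega
      have : (c*N)%4 = 0 := Nat.mod_eq_zero_of_dvd (Dvd.dvd.mul_right h N)
      simp [tau, this, h, h2]; ring
    · by_cases h2 : 2 ∣ c
      · have : (c*N)%4 = 2 := by
          rcases hN4 with e | e <;> rw [e] at hc <;> omega
        simp [tau, this, h, h2]
      · have : (c*N)%4 = 1 ∨ (c*N)%4 = 3 := by
          rcases hN4 with e | e <;> rw [e] at hc <;> omega
        rcases this with this | this <;> simp [tau, this, h, h2]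

lemma At_main (k : ℕ) (hk : 2 ≤ k) : ∃ C, 0 ≤ C ∧ ∀ N : ℕ, 0 < N → ∀ t, 0 < t →
    |At k N t - (if 4 ∣ N then k.factorial / (N*t)^(k+1) else 0)| ≤ C / (N*t)^2 := by
  obtain ⟨C, h0, hC⟩ := lm_main k hk
  refine ⟨C * (2*4^k + 2*2^k + 1), by positivity, fun N hN t ht => ?_⟩
  rw [At_cases k N hN t ht]
  have hx : 0 < (N:ℝ)*t := by positivity
  generalize (N:ℝ)*t = x at *
  have b1 := hC x hx
  have b2 := hC (2*x) (by positivity)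
  have b4 := hC (4*x) (by positivity)
  set u := C/x^2 with hu
  have hu0 : 0 ≤ u := by positivity
  have e2 : C/(2*x)^2 ≤ u := by
    rw [hu]; gcongr; linarith
  have e4 : C/(4*x)^2 ≤ u := by
    rw [hu]; gcongr; linarith
  have b2' := b2.trans e2
  have b4' := b4.trans e4
  have p2 : (0:ℝ) < 2^k := by positivity
  have p4 : (0:ℝ) < 4^k := by positivity
  have hR : C * (2*4^k + 2*2^k + 1)/x^2 = 2*4^k*u + 2*2^k*u + u := by rw [hu]; ring
  rw [hR]
  have q2 : 0 ≤ 2^k*u := by positivity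
  have q4 : 0 ≤ 4^k*u := by positivity
  split_ifs with hd4 hd2
  · refine b1.trans (by linarith)
  · have e : 2*(2^k*lm k (2*x)) - lm k x - 0 = 2*(2^k*(lm k (2*x) - k.factorial/(2*x)^(k+1))) - (lm k x - k.factorial/x^(k+1)) := by
      rw [mul_pow 2 x, pow_succ 2 k]; field_simp; ring
    rw [e]
    refine (abs_sub _ _).trans ?_
    rw [abs_mul, abs_mul, abs_of_pos p2, abs_two]
    have := mul_le_mul_of_nonneg_left b2' p2.le
    linarith
  · have e : 2*(4^k*lm k (4*x)) - 2^k * lm k (2*x) - 0 = 2*(4^k*(lm k (4*x) - k.factorial/(4*x)^(k+1))) - 2^k*(lm k (2*x) - k.factorial/(2*x)^(k+1)) := by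
      rw [mul_pow 2 x, mul_pow 4 x, pow_succ 2 k, pow_succ 4 k]; field_simp; ring
    rw [e]
    refine (abs_sub _ _).trans ?_
    rw [abs_mul, abs_mul, abs_mul, abs_of_pos p2, abs_of_pos p4, abs_two]
    have := mul_le_mul_of_nonneg_left b2' p2.le
    have := mul_le_mul_of_nonneg_left b4' p4.le
    linarith


lemma fiber_sum {ι E : Type*} [NormedAddCommGroup E] [CompleteSpace E] (f : ι → E) (w : ι → ℕ) (Q : ℕ → Finset ι)
    (hQ : ∀ i, f i ≠ 0 → ∀ n, i ∈ Q n ↔ w i = n) (hs : Summable f) :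
    HasSum (fun n => ∑ i ∈ Q n, f i) (∑' i, f i) := by
  have h1 : HasSum (f ∘ (Equiv.sigmaFiberEquiv w)) (∑' i, f i) := (Equiv.sigmaFiberEquiv w).hasSum_iff.2 hs.hasSum
  refine h1.sigma fun n => ?_
  have h2 : HasSum ((fun i => f i) ∘ ((↑) : {i | w i = n} → ι)) (∑ i ∈ Q n, f i) := by
    rw [hasSum_subtype_iff_indicator]
    have h3 := hasSum_sum_of_ne_finset_zero (f := Set.indicator {i | w i = n} f) (s := Q n) (L := SummationFilter.unconditional _) (by
      intro i hi
      by_cases h : f i = 0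
      · by_cases hm : i ∈ {i | w i = n}
        · rw [Set.indicator_of_mem hm, h]
        · rw [Set.indicator_of_notMem hm]
      · rw [Set.indicator_of_notMem]
        intro hm
        exact hi ((hQ i h n).2 hm))
    have h4 : ∑ i ∈ Q n, f i = ∑ i ∈ Q n, Set.indicator {i | w i = n} f i := by
      refine Finset.sum_congr rfl fun i hi => ?_
      by_cases h : f i = 0
      · by_cases hm : i ∈ {i | w i = n}
        · rw [Set.indicator_of_mem hm]
        · rw [Set.indicator_of_notMem hm, h]
      · rw [Set.indicator_of_mem]
        exact (hQ i h n).1 hi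
    rw [h4]; exact h3
  exact h2

lemma E2_summable (e : ℕ) (t : ℝ) (ht : 0 < t) :
    Summable (fun p : ℕ × ℕ => pw 0 p.1 * (pw e p.2 * Real.exp (-(p.2*(p.1*t))))) := by
  have h := ((lm_summable 0 t ht).mul_of_nonneg (lm_summable e t ht) (fun c => mul_nonneg (pw_nonneg _ _) (Real.exp_pos _).le) (fun c => mul_nonneg (pw_nonneg _ _) (Real.exp_pos _).le)).mul_left (Real.exp t)
  refine Summable.of_nonneg_of_le (fun p => mul_nonneg (pw_nonneg _ _) (mul_nonneg (pw_nonneg _ _) (Real.exp_pos _).le)) (fun p => ?_) h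
  obtain ⟨d, c⟩ := p
  simp only
  by_cases hd : d = 0
  · subst hd; simp [pw]
  by_cases hc : c = 0
  · subst hc; simp [pw]
  have hd1 : (1:ℝ) ≤ d := by exact_mod_cast Nat.one_le_iff_ne_zero.2 hd
  have hc1 : (1:ℝ) ≤ c := by exact_mod_cast Nat.one_le_iff_ne_zero.2 hc
  have : Real.exp (-(c*(d*t))) ≤ Real.exp t * Real.exp (-(d*t)) * Real.exp (-(c*t)) := by
    rw [← Real.exp_add, ← Real.exp_add, Real.exp_le_exp]
    nlinarith [mul_nonneg (mul_nonneg (sub_nonneg.2 hd1) (sub_nonneg.2 hc1)) ht.le]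
  calc _ ≤ pw 0 d * (pw e c * (Real.exp t * Real.exp (-(d*t)) * Real.exp (-(c*t)))) := by
        have := pw_nonneg 0 d
        have := pw_nonneg e c
        gcongr
    _ = _ := by ring

def kap (m : ℕ) (a : ℕ → ℝ) (l d N : ℕ) : ℝ := if d < N then a (m-l) else if N < d then a l else 0

lemma kap_abs (m : ℕ) (a : ℕ → ℝ) (l d N : ℕ) : |kap m a l d N| ≤ |a (m-l)| + |a l| := by
  unfold kap
  split_ifs
  · linarith [abs_nonneg (a l)]
  · linarith [abs_nonneg (a (m-l))]
  · simp; positivity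

def TX (m : ℕ) (a : ℕ → ℝ) (t : ℝ) (l : ℕ) (p : (ℕ × ℕ) × (ℕ × ℕ)) : ℝ :=
  (pw 0 p.1.1 * (tau (p.1.2 * p.1.1) * (pw (2*l) p.1.2 * Real.exp (-(p.1.2*(p.1.1*t)))))) *
   (kap m a l p.2.1 p.1.1 * (chi p.2.1 * (chi p.2.2 * ((-(p.2.2:ℝ))^(2*(m-l)) * Real.exp (-(p.2.2*(p.2.1*t)))))))

def Dl (m : ℕ) (a : ℕ → ℝ) (l N : ℕ) (t : ℝ) : ℝ := ∑' d : ℕ, kap m a l d N * (chi d * bb (2*(m-l)) (d*t))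

lemma chi_zero : chi 0 = 0 := by simp [chi]

lemma chi2_le (d b e : ℕ) (t : ℝ) : |chi d * (chi b * ((-(b:ℝ))^e * Real.exp (-(b*(d*t)))))| ≤ pw 0 d * (pw e b * Real.exp (-(b*(d*t)))) := by
  by_cases hd : d = 0
  · subst hd; simp [chi_zero, pw]
  by_cases hb : b = 0
  · subst hb; simp [chi_zero, pw]
  rw [abs_mul, abs_mul, abs_mul, abs_pow, abs_neg, Nat.abs_cast, abs_of_pos (Real.exp_pos _)]
  simp only [pw, hd, hb, if_false, pow_zero]
  have := chi_abs d
  have := chi_abs b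
  have h0 : 0 ≤ (b:ℝ)^e * Real.exp (-(b*(d*t))) := by positivity
  calc _ ≤ 1 * (1 * ((b:ℝ)^e * Real.exp (-(b*(d*t))))) := by gcongr
    _ = _ := by ring

lemma TX_summable (m : ℕ) (a : ℕ → ℝ) (t : ℝ) (ht : 0 < t) (l : ℕ) : Summable (TX m a t l) := by
  have h := ((E2_summable (2*l) t ht).mul_of_nonneg (E2_summable (2*(m-l)) t ht)
    (fun p => mul_nonneg (pw_nonneg _ _) (mul_nonneg (pw_nonneg _ _) (Real.exp_pos _).le))
    (fun p => mul_nonneg (pw_nonneg _ _) (mul_nonneg (pw_nonneg _ _) (Real.exp_pos _).le))).mul_left (|a (m-l)| + |a l|)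
  refine Summable.of_norm_bounded h fun p => ?_
  unfold TX
  have h1 := At_term_le (2*l) p.1.1 t p.1.2
  have h2 := chi2_le p.2.1 p.2.2 (2*(m-l)) t
  have h3 := kap_abs m a l p.2.1 p.1.1
  rw [Real.norm_eq_abs] at h1 ⊢
  rw [abs_mul, abs_mul, abs_mul (kap _ _ _ _ _), abs_of_nonneg (pw_nonneg 0 _)]
  have := pw_nonneg 0 p.1.1
  have := pw_nonneg (2*l) p.1.2
  calc _ ≤ (pw 0 p.1.1 * (pw (2*l) p.1.2 * Real.exp (-(p.1.2*(p.1.1*t))))) * ((|a (m-l)| + |a l|) * (pw 0 p.2.1 * (pw (2*(m-l)) p.2.2 * Real.exp (-(p.2.2*(p.2.1*t)))))) := by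
        gcongr
    _ = _ := by ring

lemma chi_bb_hasSum (e : ℕ) (t : ℝ) (ht : 0 < t) (d : ℕ) :
    HasSum (fun b : ℕ => chi d * (chi b * ((-(b:ℝ))^e * Real.exp (-(b*(d*t)))))) (chi d * bb e (d*t)) := by
  by_cases hd : d = 0
  · subst hd; simp [chi_zero, hasSum_zero]
  · exact (bb_sum e (d*t) (by positivity)).mul_left _

lemma TX_tsum (m : ℕ) (a : ℕ → ℝ) (t : ℝ) (ht : 0 < t) (l : ℕ) :
    ∑' p, TX m a t l p = ∑' N : ℕ, pw 0 N * (At (2*l) N t * Dl m a l N t) := by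
  have hs := TX_summable m a t ht l
  rw [hs.tsum_prod]
  have h1 : ∀ r : ℕ × ℕ, ∑' s, TX m a t l (r, s) = (pw 0 r.1 * (tau (r.2 * r.1) * (pw (2*l) r.2 * Real.exp (-(r.2*(r.1*t)))))) * Dl m a l r.1 t := by
    intro r
    unfold TX
    simp only
    rw [tsum_mul_left]
    congr 1
    have hs2 : Summable (fun s : ℕ × ℕ => kap m a l s.1 r.1 * (chi s.1 * (chi s.2 * ((-(s.2:ℝ))^(2*(m-l)) * Real.exp (-(s.2*(s.1*t))))))) := by
      refine Summable.of_norm_bounded ((E2_summable (2*(m-l)) t ht).mul_left (|a (m-l)| + |a l|)) fun s => ?_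
      rw [Real.norm_eq_abs, abs_mul]
      have := kap_abs m a l s.1 r.1
      have := chi2_le s.1 s.2 (2*(m-l)) t
      gcongr
    rw [hs2.tsum_prod]
    unfold Dl
    congr 1; ext d
    simp only
    rw [tsum_mul_left, (chi_bb_hasSum (2*(m-l)) t ht d).tsum_eq]
  simp only [h1]
  have hs3 : Summable (fun r : ℕ × ℕ => (pw 0 r.1 * (tau (r.2 * r.1) * (pw (2*l) r.2 * Real.exp (-(r.2*(r.1*t)))))) * Dl m a l r.1 t) := by
    simp only [← h1]
    exact hs.prod
  rw [hs3.tsum_prod]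
  congr 1; ext N
  simp only
  rw [tsum_mul_right, tsum_mul_left]
  unfold At
  ring

lemma PP_rev (m : ℕ) (a : ℕ → ℝ) (x y : ℝ) : PP m a x y = ∑ l ∈ range (m+1), a (m-l) * y^(2*l) * x^(2*(m-l)) := by
  unfold PP
  rw [← Finset.sum_range_reflect]
  refine Finset.sum_congr rfl fun l hl => ?_
  rw [Finset.mem_range] at hl
  rw [show m + 1 - 1 - l = m - l by omega, show m - (m-l) = l by omega]
  ring

lemma sum_filter_swap (n : ℕ) (F : ℕ → ℕ → ℕ → ℕ → ℝ) :
    ∑ p ∈ (Quad n).filter (fun p => p.2.2.1 < p.2.2.2), F p.1 p.2.1 p.2.2.1 p.2.2.2 =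
    ∑ p ∈ (Quad n).filter (fun p => p.2.2.2 < p.2.2.1), F p.2.1 p.1 p.2.2.2 p.2.2.1 := by
  refine sum_nbij' (fun p => (p.2.1, p.1, p.2.2.2, p.2.2.1))
    (fun p => (p.2.1, p.1, p.2.2.2, p.2.2.1)) ?_ ?_ ?_ ?_ ?_
  · rintro ⟨a, b, c, d⟩ h
    simp only [mem_filter, mem_Quad] at h ⊢
    obtain ⟨⟨h1, h2, h3, h4, h5⟩, h6⟩ := h
    exact ⟨⟨h2, h1, h4, h3, by omega⟩, h6⟩
  · rintro ⟨a, b, c, d⟩ h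
    simp only [mem_filter, mem_Quad] at h ⊢
    obtain ⟨⟨h1, h2, h3, h4, h5⟩, h6⟩ := h
    exact ⟨⟨h2, h1, h4, h3, by omega⟩, h6⟩
  · rintro ⟨a, b, c, d⟩ h; rfl
  · rintro ⟨a, b, c, d⟩ h; rfl
  · rintro ⟨a, b, c, d⟩ h; rfl

lemma chi_SS (m : ℕ) (a : ℕ → ℝ) (n : ℕ) :
    chi n * SS m a n = ∑ p ∈ Quad n, chi (p.1*p.2.2.1) * tau (p.2.1*p.2.2.2) *
      ∑ l ∈ range (m+1), kap m a l p.2.2.1 p.2.2.2 * (p.2.1:ℝ)^(2*l) * (p.1:ℝ)^(2*(m-l)) := by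
  have h1 : chi n * SS m a n = ∑ p ∈ (Quad n).filter (fun p => p.2.2.1 < p.2.2.2), chi (p.1*p.2.2.1) * tau (p.2.1*p.2.2.2) * PP m a p.1 p.2.1
     + ∑ p ∈ (Quad n).filter (fun p => p.2.2.1 < p.2.2.2), tau (p.1*p.2.2.1) * chi (p.2.1*p.2.2.2) * PP m a p.1 p.2.1 := by
    unfold SS
    rw [Finset.mul_sum, ← Finset.sum_add_distrib]
    refine Finset.sum_congr rfl fun p hp => ?_
    obtain ⟨b, c, d, N⟩ := p
    simp only [mem_filter, mem_Quad] at hp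
    rw [← hp.1.2.2.2.2, chi_add]; ring
  have h2 := sum_filter_swap n (fun b c d N => tau (b*d) * chi (c*N) * PP m a b c)
  rw [h1, h2, Finset.sum_filter, Finset.sum_filter, ← Finset.sum_add_distrib]
  refine Finset.sum_congr rfl fun p hp => ?_
  obtain ⟨b, c, d, N⟩ := p
  simp only [kap]
  rcases lt_trichotomy d N with h | h | h
  · rw [if_pos h, if_neg (by omega), PP_rev]
    simp only [if_pos h, add_zero]
  · subst h
    simp
  · rw [if_neg (by omega), if_pos h]
    simp only [if_neg (show ¬ d < N by omega), if_pos h, PP]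
    ring

theorem X_formula (m : ℕ) (a : ℕ → ℝ) (t : ℝ) (ht : 0 < t) :
    HasSum (fun n : ℕ => chi n * SS m a n * Real.exp (-(n*t)))
      (∑ l ∈ range (m+1), ∑' N : ℕ, pw 0 N * (At (2*l) N t * Dl m a l N t)) := by
  have hs : ∀ l ∈ range (m+1), Summable (TX m a t l) := fun l _ => TX_summable m a t ht l
  have hs2 : Summable (fun p => ∑ l ∈ range (m+1), TX m a t l p) := summable_sum hs
  have h := fiber_sum (fun p => ∑ l ∈ range (m+1), TX m a t l p) (fun p => p.2.2*p.2.1 + p.1.2*p.1.1)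
    (fun n => (Quad n).image (fun p => ((p.2.2.2, p.2.1), (p.2.2.1, p.1)))) (by
      rintro ⟨⟨N, c⟩, ⟨d, b⟩⟩ hne n
      have hmem : ((N, c), (d, b)) ∈ (Quad n).image (fun p => ((p.2.2.2, p.2.1), (p.2.2.1, p.1))) ↔ (b, c, d, N) ∈ Quad n := by
        simp only [mem_image]
        constructor
        · rintro ⟨⟨b', c', d', N'⟩, h1, h2⟩
          simp only [Prod.mk.injEq] at h2
          obtain ⟨⟨rfl, rfl⟩, rfl, rfl⟩ := h2
          exact h1
        · intro h1; exact ⟨_, h1, rfl⟩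
      rw [hmem, mem_Quad]
      simp only
      constructor
      · intro h; exact h.2.2.2.2
      · intro h
        refine ⟨?_, ?_, ?_, ?_, h⟩ <;> (rw [Nat.pos_iff_ne_zero]; rintro rfl; apply hne; refine Finset.sum_eq_zero fun l _ => ?_; simp [TX, pw, chi_zero])) hs2
  rw [Summable.tsum_finsetSum hs] at h
  simp only [TX_tsum m a t ht] at h
  refine h.congr_fun fun n => ?_
  rw [Finset.sum_image (by
    rintro ⟨b, c, d, N⟩ _ ⟨b', c', d', N'⟩ _ h
    simp only [Prod.mk.injEq] at h
    obtain ⟨⟨rfl, rfl⟩, rfl, rfl⟩ := h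
    rfl)]
  rw [chi_SS, Finset.sum_mul]
  refine Finset.sum_congr rfl fun p hp => ?_
  obtain ⟨b, c, d, N⟩ := p
  rw [mem_Quad] at hp
  obtain ⟨h1, h2, h3, h4, h5⟩ := hp
  simp only
  rw [Finset.mul_sum, Finset.sum_mul]
  refine Finset.sum_congr rfl fun l hl => ?_
  simp only [TX, pw, h4.ne', h2.ne', if_false, pow_zero, chi_mul, (even_two_mul (m-l)).neg_pow, one_mul]
  have he : Real.exp (-(n*t)) = Real.exp (-(c*(N*t))) * Real.exp (-(b*(d*t))) := by
    rw [← Real.exp_add, ← h5]; congr 1; push_cast; ring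
  rw [he]; ring


lemma R_even (i N : ℕ) (hN : Even N) (t : ℝ) (ht : 0 < t) (ht1 : t ≤ 1) :
    HasSum (fun d : ℕ => if N < d then chi d * bb i (d*t) else 0) (tau N * VV i t (N*t)) := by
  have h := (VN_summable 0 i t ht ht1 (N*t)).hasSum.mul_left (tau N)
  have hinj : Function.Injective (fun j : ℕ => N + (2*j+1)) := fun x y h => by simp at h; exact h
  rw [← hinj.hasSum_iff]
  · refine h.congr_fun fun j => ?_
    simp only [Function.comp]
    rw [if_pos (by omega), chi_add, chi_even N (by rw [Nat.not_odd_iff_even]; exact hN), chi_odd]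
    simp only [NN]
    rw [show ((N + (2*j+1) : ℕ):ℝ)*t = N*t + (2*j+1)*t by push_cast; ring]
    ring
  · intro d hd
    split_ifs with h
    · rw [chi_even, zero_mul]
      intro ho
      apply hd
      obtain ⟨k, rfl⟩ := ho
      obtain ⟨n, rfl⟩ := hN
      exact ⟨k - n, by simp only; omega⟩
    · rfl

def RR (i N : ℕ) (t : ℝ) : ℝ := if Even N then tau N * VV i t (N*t) else tau (N+1) * VV i t ((N+1:ℕ)*t)

lemma R_hasSum (i N : ℕ) (t : ℝ) (ht : 0 < t) (ht1 : t ≤ 1) :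
    HasSum (fun d : ℕ => if N < d then chi d * bb i (d*t) else 0) (RR i N t) := by
  unfold RR
  split_ifs with h
  · exact R_even i N h t ht ht1
  · have h2 := Nat.not_even_iff_odd.1 h
    refine (R_even i (N+1) h2.add_one t ht ht1).congr_fun fun d => ?_
    by_cases h3 : N + 1 < d
    · rw [if_pos h3, if_pos (by omega)]
    · rw [if_neg h3]
      split_ifs with h4
      · have : d = N + 1 := by omega
        rw [chi_even d (by rw [this, Nat.not_odd_iff_even]; exact h2.add_one), zero_mul]
      · rfl

lemma W_hasSum (i : ℕ) (t : ℝ) (ht : 0 < t) (ht1 : t ≤ 1) :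
    HasSum (fun d : ℕ => chi d * bb i (d*t)) (VV i t 0) := by
  have h := R_even i 0 (by simp) t ht ht1
  have e : tau 0 * VV i t ((0:ℕ)*t) = VV i t 0 := by simp [tau]
  rw [e] at h
  refine h.congr_fun fun d => ?_
  split_ifs with hd
  · rfl
  · have : d = 0 := by omega
    subst this; simp [chi_zero]

lemma Dl_eq (m : ℕ) (a : ℕ → ℝ) (l N : ℕ) (t : ℝ) (ht : 0 < t) (ht1 : t ≤ 1) :
    Dl m a l N t = a (m-l) * VV (2*(m-l)) t 0 - a (m-l) * (chi N * bb (2*(m-l)) (N*t)) + (a l - a (m-l)) * RR (2*(m-l)) N t := by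
  have h1 := (W_hasSum (2*(m-l)) t ht ht1).mul_left (a (m-l))
  have h2 : HasSum (fun d : ℕ => if d = N then a (m-l) * (chi N * bb (2*(m-l)) (N*t)) else 0) (a (m-l) * (chi N * bb (2*(m-l)) (N*t))) := hasSum_ite_eq N _
  have h3 := (R_hasSum (2*(m-l)) N t ht ht1).mul_left (a l - a (m-l))
  refine HasSum.tsum_eq (((h1.sub h2).add h3).congr_fun fun d => ?_)
  unfold kap
  rcases lt_trichotomy d N with h | h | h
  · rw [if_pos h, if_neg (by omega), if_neg (by omega)]; ring
  · subst h; simp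
  · rw [if_neg (by omega), if_pos h, if_neg (by omega), if_pos h]; ring

lemma RR_bound (i : ℕ) : ∃ C, 0 ≤ C ∧ ∀ t, 0 < t → t ≤ 1 → ∀ N, |RR i N t| ≤ C := by
  obtain ⟨C, h0, hC⟩ := VV_bound i
  refine ⟨C, h0, fun t ht ht1 N => ?_⟩
  unfold RR
  split_ifs
  · rw [abs_mul]
    calc _ ≤ 1 * C := mul_le_mul (tau_abs _) (hC t ht ht1 _ (by positivity)) (abs_nonneg _) zero_le_one
      _ = C := one_mul _
  · rw [abs_mul]
    calc _ ≤ 1 * C := mul_le_mul (tau_abs _) (hC t ht ht1 _ (by positivity)) (abs_nonneg _) zero_le_one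
      _ = C := one_mul _

lemma Dl_bound (m : ℕ) (a : ℕ → ℝ) (l : ℕ) : ∃ C, 0 ≤ C ∧ ∀ t, 0 < t → t ≤ 1 → ∀ N, |Dl m a l N t| ≤ C := by
  obtain ⟨C, h0, hC⟩ := RR_bound (2*(m-l))
  obtain ⟨D, d0, hD⟩ := bb_bound (2*(m-l))
  obtain ⟨E, e0, hE⟩ := VV_bound (2*(m-l))
  refine ⟨|a (m-l)| * E + |a (m-l)| * D + |a l - a (m-l)| * C, by positivity, fun t ht ht1 N => ?_⟩
  rw [Dl_eq m a l N t ht ht1]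
  have h1 : |chi N * bb (2*(m-l)) (N*t)| ≤ D := by
    rw [abs_mul]
    calc _ ≤ 1 * D := mul_le_mul (chi_abs _) ((hD _).trans (mul_le_of_le_one_right d0 (by rw [Real.exp_le_one_iff, neg_nonpos]; exact abs_nonneg _))) (abs_nonneg _) zero_le_one
      _ = D := one_mul _
  refine (abs_add_le _ _).trans ?_
  refine add_le_add ((abs_sub _ _).trans ?_) ?_
  · rw [abs_mul, abs_mul]
    gcongr
    exact hE t ht ht1 0 le_rfl
  · rw [abs_mul]; gcongr; exact hC t ht ht1 N

lemma Dl_four (m : ℕ) (a : ℕ → ℝ) (l N : ℕ) (hN : 4 ∣ N) (t : ℝ) (ht : 0 < t) (ht1 : t ≤ 1) :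
    Dl m a l N t = a (m-l) * VV (2*(m-l)) t 0 + (a l - a (m-l)) * VV (2*(m-l)) t (N*t) := by
  rw [Dl_eq m a l N t ht ht1]
  have he : Even N := by rw [even_iff_two_dvd]; omega
  have h1 : N % 4 = 0 := by omega
  rw [chi_even N (by rw [Nat.not_odd_iff_even]; exact he), RR, if_pos he]
  simp [tau, h1]

lemma sum_split_parity (g : ℕ → ℝ) (n : ℕ) : ∑ ν ∈ range (2*n+1), g ν = ∑ μ ∈ range (n+1), g (2*μ) + ∑ μ ∈ range n, g (2*μ+1) := by
  induction n with
  | zero => simp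
  | succ n ih =>
    rw [show 2*(n+1)+1 = 2*n+1+1+1 by ring, sum_range_succ, sum_range_succ, ih, sum_range_succ (fun μ => g (2*μ)) (n+1), sum_range_succ (fun μ => g (2*μ+1)) n]
    rw [show 2*(n+1) = 2*n+1+1 by ring]
    ring

lemma VV_taylor_even (i : ℕ) (hi : Even i) (l : ℕ) (hl : 1 ≤ l) : ∃ C, 0 ≤ C ∧ ∀ t, 0 < t → t ≤ 1 → ∀ y, t ≤ y →
    |VV i t y - ∑ μ ∈ range l, VV (i+2*μ) t 0 * y^(2*μ) / ((2*μ).factorial : ℝ)| ≤ C * y^(2*l-1) := by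
  obtain ⟨n, rfl⟩ : ∃ n, l = n+1 := ⟨l-1, by omega⟩
  obtain ⟨C, h0, hC⟩ := VV_taylor i (2*n+1)
  have hodd : ∀ μ : ℕ, ∃ C, 0 ≤ C ∧ ∀ t, 0 < t → t ≤ 1 → |VV (i+(2*μ+1)) t 0| ≤ C * t^(2*(n-μ)) := fun μ =>
    VV_odd (i+(2*μ+1)) (hi.add_odd ⟨μ, rfl⟩) _
  choose D d0 hD using hodd
  refine ⟨C + ∑ μ ∈ range n, D μ, add_nonneg h0 (Finset.sum_nonneg fun μ _ => d0 μ), fun t ht ht1 y hy => ?_⟩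
  have hy0 : 0 < y := by linarith
  have h1 := hC t ht ht1 y hy0.le
  rw [sum_split_parity (fun ν => VV (i+ν) t 0 * y^ν / (ν.factorial : ℝ)) n] at h1
  have h2 : |∑ μ ∈ range n, VV (i+(2*μ+1)) t 0 * y^(2*μ+1) / ((2*μ+1).factorial : ℝ)| ≤ ∑ μ ∈ range n, D μ * y^(2*n+1) := by
    refine (Finset.abs_sum_le_sum_abs _ _).trans (Finset.sum_le_sum fun μ hμ => ?_)
    rw [Finset.mem_range] at hμ
    rw [abs_div, abs_mul, abs_of_pos (show 0 < y^(2*μ+1) by positivity), Nat.abs_cast]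
    have hf : (1:ℝ) ≤ (2*μ+1).factorial := by exact_mod_cast Nat.one_le_iff_ne_zero.2 (Nat.factorial_ne_zero _)
    have := d0 μ
    calc _ ≤ |VV (i+(2*μ+1)) t 0| * y^(2*μ+1) := div_le_self (by positivity) hf
      _ ≤ D μ * t^(2*(n-μ)) * y^(2*μ+1) := by gcongr; exact hD μ t ht ht1
      _ ≤ D μ * y^(2*(n-μ)) * y^(2*μ+1) := by gcongr
      _ = D μ * y^(2*n+1) := by rw [mul_assoc, ← pow_add]; congr 2; omega
  rw [← Finset.sum_mul] at h2
  rw [show 2*(n+1)-1 = 2*n+1 by omega, add_mul]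
  rw [abs_le] at *
  constructor <;> linarith [h1.1, h1.2, h2.1, h2.2]

/-- singles -/
lemma single_sum (h : ℕ) (t : ℝ) (ht : 0 < t) (ht1 : t ≤ 1) :
    HasSum (fun n : ℕ => chi n * sg h n * Real.exp (-(n*t))) ((-1)^h * VV h t 0) := by
  set f : ℕ × ℕ → ℝ := fun s => chi s.1 * (chi s.2 * ((-(s.2:ℝ))^h * Real.exp (-(s.2*(s.1*t))))) with hf
  have hs : Summable f := Summable.of_norm_bounded (E2_summable h t ht) fun s => chi2_le s.1 s.2 h t
  have h1 := fiber_sum f (fun s => s.1*s.2) (fun n => n.divisorsAntidiagonal) (by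
    rintro ⟨d, b⟩ hne n
    rw [Nat.mem_divisorsAntidiagonal]
    simp only
    constructor
    · intro h; exact h.1
    · intro h
      refine ⟨h, ?_⟩
      rintro rfl
      rcases Nat.mul_eq_zero.1 h with rfl | rfl <;> apply hne <;> simp [hf, chi_zero]) hs
  have h2 : ∑' s, f s = VV h t 0 := by
    rw [hs.tsum_prod]
    simp only [hf, (chi_bb_hasSum h t ht _).tsum_eq]
    exact (W_hasSum h t ht ht1).tsum_eq
  rw [h2] at h1
  refine (h1.mul_left ((-1)^h)).congr_fun fun n => ?_
  have h3 : sg h n = ∑ x ∈ n.divisorsAntidiagonal, (x.2:ℝ)^h := by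
    rw [Nat.sum_divisorsAntidiagonal' (fun _ b => (b:ℝ)^h)]
    rfl
  rw [h3, Finset.mul_sum, Finset.mul_sum, Finset.sum_mul]
  refine Finset.sum_congr rfl fun x hx => ?_
  rw [Nat.mem_divisorsAntidiagonal] at hx
  rw [← hx.1, chi_mul]
  simp only [hf]
  rw [neg_pow (x.2:ℝ) h]
  have e1 : ((-1:ℝ)^h * (-1)^h) = 1 := by rw [← mul_pow]; simp
  rw [show (x.2:ℝ)*(x.1*t) = (x.1*x.2 : ℕ)*t by push_cast; ring]
  linear_combination -(chi x.1 * chi x.2 * (x.2:ℝ)^h * Real.exp (-(((x.1*x.2:ℕ):ℝ)*t))) * e1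

lemma single_star (e : ℕ) : ∃ C, 0 ≤ C ∧ ∀ t, 0 < t → t ≤ 1 → ∃ S,
    HasSum (fun n : ℕ => chi n * (n * sg e n) * Real.exp (-(n*t))) S ∧ |S| ≤ C / t^2 := by
  obtain ⟨C, h0, hC⟩ := bb_bound (e+1)
  refine ⟨C * 6, by positivity, fun t ht ht1 => ?_⟩
  set f : ℕ × ℕ → ℝ := fun s => s.1 * (chi s.1 * (chi s.2 * ((-(s.2:ℝ))^(e+1) * Real.exp (-(s.2*(s.1*t)))))) with hf
  -- the weight d e^{-dx}
  have hs : Summable f := by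
    have h := (((lm_summable 1 t ht).mul_of_nonneg (lm_summable (e+1) t ht) (fun c => mul_nonneg (pw_nonneg _ _) (Real.exp_pos _).le) (fun c => mul_nonneg (pw_nonneg _ _) (Real.exp_pos _).le)).mul_left (Real.exp t))
    refine Summable.of_norm_bounded h fun s => ?_
    obtain ⟨d, c⟩ := s
    simp only [hf]
    by_cases hd : d = 0
    · subst hd; simp [pw]
    by_cases hc : c = 0
    · subst hc; simp [pw]
    have hd1 : (1:ℝ) ≤ d := by exact_mod_cast Nat.one_le_iff_ne_zero.2 hd
    have hc1 : (1:ℝ) ≤ c := by exact_mod_cast Nat.one_le_iff_ne_zero.2 hc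
    have h3 : Real.exp (-(c*(d*t))) ≤ Real.exp t * Real.exp (-(d*t)) * Real.exp (-(c*t)) := by
      rw [← Real.exp_add, ← Real.exp_add, Real.exp_le_exp]
      nlinarith [mul_nonneg (mul_nonneg (sub_nonneg.2 hd1) (sub_nonneg.2 hc1)) ht.le]
    have h4 := chi2_le d c (e+1) t
    rw [norm_mul, Real.norm_eq_abs, Real.norm_eq_abs, Nat.abs_cast]
    have := pw_nonneg 0 d
    have := pw_nonneg (e+1) c
    calc _ ≤ (d:ℝ) * (pw 0 d * (pw (e+1) c * Real.exp (-(c*(d*t))))) := by gcongr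
      _ ≤ (d:ℝ) * (pw 0 d * (pw (e+1) c * (Real.exp t * Real.exp (-(d*t)) * Real.exp (-(c*t))))) := by gcongr
      _ = _ := by
        rw [pw_pos 1 d (by norm_num)]
        simp only [pw, hd, if_false]
        ring
  have h1 := fiber_sum f (fun s => s.1*s.2) (fun n => n.divisorsAntidiagonal) (by
    rintro ⟨d, b⟩ hne n
    rw [Nat.mem_divisorsAntidiagonal]
    simp only
    constructor
    · intro h; exact h.1
    · intro h
      refine ⟨h, ?_⟩
      rintro rfl
      rcases Nat.mul_eq_zero.1 h with rfl | rfl <;> apply hne <;> simp [hf, chi_zero]) hs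
  have h2 : ∑' s, f s = ∑' d : ℕ, (d:ℝ) * (chi d * bb (e+1) (d*t)) := by
    rw [hs.tsum_prod]
    simp only [hf, tsum_mul_left, (chi_bb_hasSum (e+1) t ht _).tsum_eq]
  rw [h2] at h1
  refine ⟨(-1)^(e+1) * ∑' d : ℕ, (d:ℝ) * (chi d * bb (e+1) (d*t)), ?_, ?_⟩
  · refine (h1.mul_left ((-1)^(e+1))).congr_fun fun n => ?_
    have h3 : sg e n = ∑ x ∈ n.divisorsAntidiagonal, (x.2:ℝ)^e := by
      rw [Nat.sum_divisorsAntidiagonal' (fun _ b => (b:ℝ)^e)]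
      rfl
    rw [h3, Finset.mul_sum, Finset.mul_sum, Finset.mul_sum, Finset.sum_mul]
    refine Finset.sum_congr rfl fun x hx => ?_
    rw [Nat.mem_divisorsAntidiagonal] at hx
    rw [← hx.1, chi_mul]
    simp only [hf]
    rw [neg_pow (x.2:ℝ) (e+1)]
    have e1 : ((-1:ℝ)^(e+1) * (-1)^(e+1)) = 1 := by rw [← mul_pow]; simp
    rw [show (x.2:ℝ)*(x.1*t) = (x.1*x.2 : ℕ)*t by push_cast; ring]
    push_cast
    linear_combination -(x.1 * chi x.1 * chi x.2 * (x.2:ℝ)^(e+1) * Real.exp (-(((x.1:ℝ)*x.2)*t))) * e1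
  · have hq : |Real.exp (-(t/2))| < 1 := by
      rw [abs_of_pos (Real.exp_pos _), Real.exp_lt_one_iff]; linarith
    have hg := (hasSum_geometric_of_abs_lt_one hq).mul_left (C*(2/t))
    have hb : ∀ d : ℕ, ‖(d:ℝ) * (chi d * bb (e+1) (d*t))‖ ≤ C*(2/t) * Real.exp (-(t/2))^d := by
      intro d
      rw [norm_mul, norm_mul, Real.norm_eq_abs, Real.norm_eq_abs, Real.norm_eq_abs, Nat.abs_cast]
      have h5 := hC (d*t)
      rw [abs_of_nonneg (show 0 ≤ (d:ℝ)*t by positivity)] at h5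
      have h6 : (d:ℝ) ≤ 2/t * Real.exp (d*(t/2)) := by
        have := Real.add_one_le_exp (d*(t/2))
        calc (d:ℝ) = 2/t * (d*(t/2)) := by field_simp
          _ ≤ _ := by gcongr; linarith
      calc (d:ℝ) * (|chi d| * |bb (e+1) (d*t)|) ≤ 2/t * Real.exp (d*(t/2)) * (1 * (C * Real.exp (-(d*t)))) := by
            gcongr; exact chi_abs d
        _ = C*(2/t) * (Real.exp (d*(t/2)) * Real.exp (-(d*t))) := by ring
        _ = _ := by
          rw [← Real.exp_nat_mul, ← Real.exp_add]; congr 2; ring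
    have h7 := tsum_of_norm_bounded hg hb
    rw [abs_mul, abs_pow, abs_neg, abs_one, one_pow, one_mul]
    rw [Real.norm_eq_abs] at h7
    refine h7.trans ?_
    have h8 : (1 - Real.exp (-(t/2)))⁻¹ ≤ 3/t := by
      rw [inv_le_comm₀ (by linarith [le_abs_self (Real.exp (-(t/2)))]) (by positivity), inv_div]
      have h9 : Real.exp (-(t/2)) * (1+t/2) ≤ 1 := by
        have := Real.add_one_le_exp (t/2)
        have h10 : Real.exp (-(t/2)) * Real.exp (t/2) = 1 := by rw [← Real.exp_add]; simp
        nlinarith [Real.exp_pos (-(t/2))]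
      nlinarith [Real.exp_pos (-(t/2))]
    calc _ ≤ C*(2/t) * (3/t) := by gcongr
      _ = _ := by field_simp; ring


def Zt (h : ℕ) : ℝ := ∑' M : ℕ, 1/(M:ℝ)^h

lemma Zt_pos (h : ℕ) (hh : 2 ≤ h) : 0 < Zt h := by
  have hs : Summable (fun M : ℕ => 1/(M:ℝ)^h) := Real.summable_one_div_nat_pow.2 (by omega)
  exact hs.tsum_pos (fun M => by positivity) 1 (by simp)

def Jt (t : ℝ) (h N : ℕ) : ℝ := if 4 ∣ N then 1/(N*t)^h else 0

lemma Jt_hasSum (t : ℝ) (h : ℕ) (hh : 2 ≤ h) : HasSum (Jt t h) (Zt h/(4*t)^h) := by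
  have hs : Summable (fun M : ℕ => 1/(M:ℝ)^h) := Real.summable_one_div_nat_pow.2 (by omega)
  have h1 := hs.hasSum.mul_right (1/(4*t)^h)
  have hinj : Function.Injective (fun j : ℕ => 4*j) := fun x y h => by simp at h; exact h
  rw [← hinj.hasSum_iff]
  · rw [div_eq_mul_one_div]
    refine h1.congr_fun fun j => ?_
    simp only [Function.comp, Jt, dvd_mul_right, if_true]
    push_cast
    rw [one_div_mul_one_div, ← mul_pow]; congr 2; ring
  · intro c hc
    unfold Jt
    rw [if_neg]
    rintro ⟨j, rfl⟩
    exact hc ⟨j, rfl⟩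

lemma inv_sq_sum (C t : ℝ) : HasSum (fun N : ℕ => C/(N*t)^2) (C * Zt 2 / t^2) := by
  have hs : Summable (fun M : ℕ => 1/(M:ℝ)^2) := Real.summable_one_div_nat_pow.2 (by omega)
  have h1 := hs.hasSum.mul_left (C/t^2)
  have e : C/t^2 * (∑' M : ℕ, 1/(M:ℝ)^2) = C * Zt 2/t^2 := by unfold Zt; ring
  rw [e] at h1
  refine h1.congr_fun fun n => ?_
  rw [mul_pow, div_mul_div_comm, mul_one, mul_comm (t^2)]

lemma l_zero (m : ℕ) (a : ℕ → ℝ) : ∃ C, 0 ≤ C ∧ ∀ t, 0 < t → t ≤ 1 →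
    |∑' N : ℕ, pw 0 N * (At (2*0) N t * Dl m a 0 N t)| ≤ C/t^2 := by
  obtain ⟨C, h0, hC⟩ := Dl_bound m a 0
  have hz := Zt_pos 2 le_rfl
  refine ⟨2*C*Zt 2, by positivity, fun t ht ht1 => ?_⟩
  rw [← Real.norm_eq_abs]
  refine tsum_of_norm_bounded (inv_sq_sum (2*C) t) fun N => ?_
  by_cases hN : N = 0
  · subst hN; simp [pw]
  · simp only [pw, hN, if_false, pow_zero, one_mul]
    rw [norm_mul, Real.norm_eq_abs, Real.norm_eq_abs]
    calc _ ≤ 2/(N*t)^2 * C := mul_le_mul (At_zero N (by omega) t ht) (hC t ht ht1 N) (abs_nonneg _) (by positivity)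
      _ = _ := by ring

lemma l_pos (m : ℕ) (a : ℕ → ℝ) (l : ℕ) (hl : 1 ≤ l) : ∃ C, 0 ≤ C ∧ ∀ t, 0 < t → t ≤ 1 →
    |∑' N : ℕ, pw 0 N * (At (2*l) N t * Dl m a l N t) - (2*l).factorial * (a (m-l) * VV (2*(m-l)) t 0 * (Zt (2*l+1) / (4*t)^(2*l+1)) +
       (a l - a (m-l)) * ∑ μ ∈ range l, VV (2*(m-l)+2*μ) t 0 / ((2*μ).factorial:ℝ) * (Zt (2*l+1-2*μ) / (4*t)^(2*l+1-2*μ)))| ≤ C/t^2 := by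
  obtain ⟨A, A0, hA⟩ := At_main (2*l) (by omega)
  obtain ⟨D, D0, hD⟩ := Dl_bound m a l
  obtain ⟨E, E0, hE⟩ := VV_taylor_even (2*(m-l)) (even_two_mul _) l hl
  have hz := Zt_pos 2 le_rfl
  set F : ℝ := ((2*l).factorial : ℝ) with hF
  have F0 : 0 ≤ F := by rw [hF]; positivity
  set K := A * D + F * (|a l - a (m-l)| * E) with hK
  refine ⟨K*Zt 2, by positivity, fun t ht ht1 => ?_⟩
  set i := 2*(m-l) with hi
  set MN : ℕ → ℝ := fun N => F * (a (m-l) * VV i t 0 * Jt t (2*l+1) N +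
       (a l - a (m-l)) * ∑ μ ∈ range l, VV (i+2*μ) t 0 / ((2*μ).factorial:ℝ) * Jt t (2*l+1-2*μ) N) with hMN
  have hMsum : HasSum MN (F * (a (m-l) * VV i t 0 * (Zt (2*l+1) / (4*t)^(2*l+1)) +
       (a l - a (m-l)) * ∑ μ ∈ range l, VV (i+2*μ) t 0 / ((2*μ).factorial:ℝ) * (Zt (2*l+1-2*μ) / (4*t)^(2*l+1-2*μ)))) := by
    refine HasSum.mul_left _ (HasSum.add ((Jt_hasSum t (2*l+1) (by omega)).mul_left _) (HasSum.mul_left _ (hasSum_sum fun μ hμ => ?_)))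
    rw [Finset.mem_range] at hμ
    exact (Jt_hasSum t _ (by omega)).mul_left _
  have hb : ∀ N : ℕ, ‖pw 0 N * (At (2*l) N t * Dl m a l N t) - MN N‖ ≤ K/(N*t)^2 := by
    intro N
    by_cases hN : N = 0
    · subst hN
      have hJ : ∀ h, 1 ≤ h → Jt t h 0 = 0 := fun h hh => by
        simp only [Jt, dvd_zero, if_true, Nat.cast_zero, zero_mul]
        rw [zero_pow (by omega), div_zero]
      have : MN 0 = 0 := by
        simp only [hMN]
        rw [hJ _ (by omega), Finset.sum_eq_zero]
        · ring
        · intro μ hμ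
          rw [Finset.mem_range] at hμ
          rw [hJ _ (by omega), mul_zero]
      rw [this]; simp [pw]
    · have hNt : 0 < (N:ℝ)*t := by positivity
      have hN1 : (1:ℝ) ≤ N := by exact_mod_cast Nat.one_le_iff_ne_zero.2 hN
      simp only [pw, hN, if_false, pow_zero, one_mul]
      have hA' := hA N (by omega) t ht
      have hD' := hD t ht ht1 N
      by_cases h4 : 4 ∣ N
      · rw [if_pos h4] at hA'
        set ap := a (m-l) * VV i t 0 + (a l - a (m-l)) * ∑ μ ∈ range l, VV (i+2*μ) t 0 * (N*t)^(2*μ) / ((2*μ).factorial:ℝ) with hap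
        have hM : MN N = F/(N*t)^(2*l+1) * ap := by
          simp only [hMN, Jt, if_pos h4, hap]
          rw [mul_add, mul_add, ← mul_assoc, ← mul_assoc, Finset.mul_sum, Finset.mul_sum, Finset.mul_sum, Finset.mul_sum]
          congr 1
          · ring
          · refine Finset.sum_congr rfl fun μ hμ => ?_
            rw [Finset.mem_range] at hμ
            have e : ((N:ℝ)*t)^(2*l+1) = (N*t)^(2*l+1-2*μ) * (N*t)^(2*μ) := by
              rw [← pow_add]; congr 1; omega
            rw [e]
            field_simp
        have hE' := hE t ht ht1 (N*t) (by nlinarith)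
        have hdiff : |Dl m a l N t - ap| ≤ |a l - a (m-l)| * (E * (N*t)^(2*l-1)) := by
          rw [Dl_four m a l N h4 t ht ht1, hap, add_sub_add_left_eq_sub, ← mul_sub, abs_mul]
          gcongr
        have e1 : At (2*l) N t * Dl m a l N t - MN N = (At (2*l) N t - F/(N*t)^(2*l+1)) * Dl m a l N t + F/(N*t)^(2*l+1) * (Dl m a l N t - ap) := by
          rw [hM]; ring
        rw [e1, Real.norm_eq_abs]
        refine (abs_add_le _ _).trans ?_
        rw [abs_mul, abs_mul, abs_of_nonneg (show 0 ≤ F/(N*t)^(2*l+1) by positivity)]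
        calc _ ≤ A/(N*t)^2 * D + F/(N*t)^(2*l+1) * (|a l - a (m-l)| * (E * (N*t)^(2*l-1))) := by gcongr
          _ = K/(N*t)^2 := by
            have e : ((N:ℝ)*t)^(2*l+1) = (N*t)^(2*l-1) * (N*t)^2 := by
              rw [← pow_add]; congr 1; omega
            rw [e, hK]
            field_simp
      · rw [if_neg h4, sub_zero] at hA'
        have hM : MN N = 0 := by
          simp only [hMN, Jt, if_neg h4]; simp
        rw [hM, sub_zero, norm_mul, Real.norm_eq_abs, Real.norm_eq_abs]
        calc _ ≤ A/(N*t)^2 * D := by gcongr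
          _ = (A*D)/(N*t)^2 := by ring
          _ ≤ _ := by
            gcongr
            rw [hK]
            have : 0 ≤ F * (|a l - a (m-l)| * E) := by positivity
            linarith
  have hsd := Summable.of_norm_bounded (inv_sq_sum K t).summable hb
  have hbd := tsum_of_norm_bounded (inv_sq_sum K t) hb
  have htot : HasSum (fun N : ℕ => pw 0 N * (At (2*l) N t * Dl m a l N t)) (∑' N, (pw 0 N * (At (2*l) N t * Dl m a l N t) - MN N) + (F * (a (m-l) * VV i t 0 * (Zt (2*l+1) / (4*t)^(2*l+1)) +
       (a l - a (m-l)) * ∑ μ ∈ range l, VV (i+2*μ) t 0 / ((2*μ).factorial:ℝ) * (Zt (2*l+1-2*μ) / (4*t)^(2*l+1-2*μ))))) := by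
    refine (hsd.hasSum.add hMsum).congr_fun fun N => by ring
  rw [htot.tsum_eq, add_sub_cancel_right]
  exact hbd

lemma l_reorg (m : ℕ) (l : ℕ) (hlm : l ≤ m) (f : ℕ → ℝ) :
    ((2*l).factorial:ℝ) * ∑ μ ∈ range l, f (l-μ) / ((2*μ).factorial:ℝ) = ∑ i ∈ Icc 1 m, ((2*i).factorial:ℝ) * ((2*l).choose (2*i):ℝ) * f i := by
  have h1 : ∑ i ∈ Icc 1 m, ((2*i).factorial:ℝ) * ((2*l).choose (2*i):ℝ) * f i = ∑ i ∈ Icc 1 l, ((2*i).factorial:ℝ) * ((2*l).choose (2*i):ℝ) * f i := by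
    symm
    refine Finset.sum_subset (Finset.Icc_subset_Icc_right hlm) fun i hi hi2 => ?_
    simp only [Finset.mem_Icc] at hi hi2
    rw [Nat.choose_eq_zero_of_lt (by omega)]; simp
  rw [h1, Finset.mul_sum]
  refine Finset.sum_nbij' (fun μ => l - μ) (fun i => l - i) ?_ ?_ ?_ ?_ ?_
  · intro μ hμ; simp only [Finset.mem_range, Finset.mem_Icc] at *; omega
  · intro μ hμ; simp only [Finset.mem_range, Finset.mem_Icc] at *; omega
  · intro μ hμ; simp only [Finset.mem_range, Finset.mem_Icc] at *; omega
  · intro μ hμ; simp only [Finset.mem_range, Finset.mem_Icc] at *; omega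
  · intro μ hμ
    rw [Finset.mem_range] at hμ
    have h2 := Nat.choose_mul_factorial_mul_factorial (show 2*(l-μ) ≤ 2*l by omega)
    rw [show 2*l - 2*(l-μ) = 2*μ by omega] at h2
    have h3 : ((2*l).choose (2*(l-μ)):ℝ) * ((2*(l-μ)).factorial:ℝ) * ((2*μ).factorial:ℝ) = (2*l).factorial := by exact_mod_cast h2
    rw [← h3]
    have : ((2*μ).factorial:ℝ) ≠ 0 := by positivity
    field_simp

lemma asym_zero (m : ℕ) (K v : ℕ → ℝ) (u : ℕ → ℝ → ℝ) (hv : ∀ i ∈ Icc 1 m, v i ≠ 0)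
    (hu : ∀ i ∈ Icc 1 m, ∃ C, ∀ t, 0 < t → t ≤ 1 → |u i t - v i| ≤ C*t)
    (C : ℝ) (hC : ∀ t, 0 < t → t ≤ 1 → |∑ i ∈ Icc 1 m, K i * (u i t / t^(2*i+1))| ≤ C/t^2) :
    ∀ i ∈ Icc 1 m, K i = 0 := by
  induction m with
  | zero => intro i hi; simp at hi
  | succ m ih =>
    have hmem : m+1 ∈ Icc 1 (m+1) := by simp
    have hKm : K (m+1) = 0 := by
      -- multiply by a power of t and let t tend to zero
      have hlim : ∀ i ∈ Icc 1 (m+1), Filter.Tendsto (u i) (nhdsWithin 0 (Set.Ioi 0)) (nhds (v i)) := by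
        intro i hi
        obtain ⟨D, hD⟩ := hu i hi
        rw [tendsto_iff_norm_sub_tendsto_zero]
        have h0 : Filter.Tendsto (fun t : ℝ => D*t) (nhdsWithin 0 (Set.Ioi 0)) (nhds 0) := by
          have : Filter.Tendsto (fun t : ℝ => D*t) (nhds 0) (nhds (D*0)) := (continuous_const.mul continuous_id).tendsto 0
          rw [mul_zero] at this
          exact this.mono_left nhdsWithin_le_nhds
        refine squeeze_zero' (Filter.Eventually.of_forall fun t => norm_nonneg _) ?_ h0
        filter_upwards [Ioo_mem_nhdsGT (show (0:ℝ) < 1 by norm_num)] with t ht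
        exact hD t ht.1 ht.2.le
      have hp : ∀ n : ℕ, 1 ≤ n → Filter.Tendsto (fun t : ℝ => t^n) (nhdsWithin 0 (Set.Ioi 0)) (nhds 0) := by
        intro n hn
        have : Filter.Tendsto (fun t : ℝ => t^n) (nhds 0) (nhds (0^n)) := (continuous_pow n).tendsto 0
        rw [zero_pow (by omega)] at this
        exact this.mono_left nhdsWithin_le_nhds
      have h1 : Filter.Tendsto (fun t : ℝ => ∑ i ∈ Icc 1 (m+1), K i * (u i t * t^(2*(m+1-i)))) (nhdsWithin 0 (Set.Ioi 0)) (nhds (∑ i ∈ Icc 1 (m+1), if i = m+1 then K (m+1) * v (m+1) else 0)) := by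
        refine tendsto_finsetSum _ fun i hi => ?_
        split_ifs with h
        · subst h
          have := (hlim (m+1) hi).const_mul (K (m+1))
          refine this.congr fun t => ?_
          simp
        · rw [Finset.mem_Icc] at hi
          have := ((hlim i (by rw [Finset.mem_Icc]; exact hi)).mul (hp (2*(m+1-i)) (by omega))).const_mul (K i)
          rw [mul_zero, mul_zero] at this
          exact this
      rw [Finset.sum_ite_eq' , if_pos hmem] at h1
      have h2 : Filter.Tendsto (fun t : ℝ => ∑ i ∈ Icc 1 (m+1), K i * (u i t * t^(2*(m+1-i)))) (nhdsWithin 0 (Set.Ioi 0)) (nhds 0) := by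
        have h0 := (hp (2*m+1) (by omega)).const_mul C
        rw [mul_zero] at h0
        refine squeeze_zero_norm' ?_ h0
        filter_upwards [Ioo_mem_nhdsGT (show (0:ℝ) < 1 by norm_num)] with t ht
        have h3 := hC t ht.1 ht.2.le
        have ht0 := ht.1
        have h4 : ∑ i ∈ Icc 1 (m+1), K i * (u i t * t^(2*(m+1-i))) = t^(2*m+3) * ∑ i ∈ Icc 1 (m+1), K i * (u i t / t^(2*i+1)) := by
          rw [Finset.mul_sum]
          refine Finset.sum_congr rfl fun i hi => ?_
          rw [Finset.mem_Icc] at hi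
          have : t^(2*m+3) = t^(2*(m+1-i)) * t^(2*i+1) := by rw [← pow_add]; congr 1; omega
          rw [this]; field_simp
        rw [h4, norm_mul, Real.norm_eq_abs, Real.norm_eq_abs, abs_of_pos (by positivity)]
        calc _ ≤ t^(2*m+3) * (C/t^2) := by gcongr
          _ = C * t^(2*m+1) := by
            field_simp; ring
      have h5 := tendsto_nhds_unique h1 h2
      exact (mul_eq_zero.1 h5).resolve_right (hv _ hmem)
    have ih' := ih (fun i hi => hv i (Finset.Icc_subset_Icc_right (by omega) hi)) (fun i hi => hu i (Finset.Icc_subset_Icc_right (by omega) hi)) (by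
      intro t ht ht1
      have := hC t ht ht1
      rw [Finset.sum_Icc_succ_top (by omega), hKm, zero_mul, add_zero] at this
      exact this)
    intro i hi
    rw [Finset.mem_Icc] at hi
    rcases Nat.lt_or_ge i (m+1) with h | h
    · exact ih' i (by rw [Finset.mem_Icc]; omega)
    · have : i = m+1 := by omega
      rw [this]; exact hKm

theorem partI (m : ℕ) (hm : 1 ≤ m) (a : ℕ → ℝ) (α : ℕ → ℝ) (β : ℝ)
    (H : ∀ n, 0 < n → SS m a n + ∑ h ∈ range (2*m+2), α h * sg h n + β*(n * sg (2*m-1) n) = 0) :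
    ∀ i, 1 ≤ i → i ≤ m → a (m-i) = ∑ l ∈ range (m+1), (a (m-l) - a l) * ((2*l).choose (2*i):ℝ) := by
  -- bound for X
  have hX : ∃ C, ∀ t, 0 < t → t ≤ 1 → |∑ l ∈ range (m+1), ∑' N : ℕ, pw 0 N * (At (2*l) N t * Dl m a l N t)| ≤ C/t^2 := by
    have hV : ∀ h : ℕ, ∃ C, 0 ≤ C ∧ ∀ t, 0 < t → t ≤ 1 → |VV h t 0| ≤ C := fun h => by
      obtain ⟨C, c0, hC⟩ := VV_bound h
      exact ⟨C, c0, fun t ht ht1 => hC t ht ht1 0 le_rfl⟩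
    choose V V0 hV using hV
    obtain ⟨S, S0, hS⟩ := single_star (2*m-1)
    refine ⟨∑ h ∈ range (2*m+2), |α h| * V h + |β| * S, fun t ht ht1 => ?_⟩
    obtain ⟨s, hs, hsb⟩ := hS t ht ht1
    have hx := X_formula m a t ht
    have hy : HasSum (fun n : ℕ => chi n * SS m a n * Real.exp (-(n*t))) (-(∑ h ∈ range (2*m+2), α h * ((-1)^h * VV h t 0) + β * s)) := by
      have h1 := ((hasSum_sum (s := range (2*m+2)) fun h _ => (single_sum h t ht ht1).mul_left (α h)).add (hs.mul_left β)).neg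
      refine h1.congr_fun fun n => ?_
      by_cases hn : n = 0
      · subst hn; simp [chi_zero]
      · have h2 := H n (by omega)
        have h3 : ∑ h ∈ range (2*m+2), α h * (chi n * sg h n * Real.exp (-(n*t))) = chi n * Real.exp (-(n*t)) * ∑ h ∈ range (2*m+2), α h * sg h n := by
          rw [Finset.mul_sum]; exact Finset.sum_congr rfl fun h _ => by ring
        rw [h3]
        linear_combination chi n * Real.exp (-(n*t)) * h2
    rw [hx.unique hy, abs_neg]
    refine (abs_add_le _ _).trans ?_
    rw [add_div]
    refine add_le_add ?_ ?_
    · refine (Finset.abs_sum_le_sum_abs _ _).trans ?_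
      rw [Finset.sum_div]
      refine Finset.sum_le_sum fun h _ => ?_
      rw [abs_mul, abs_mul, abs_pow, abs_neg, abs_one, one_pow, one_mul]
      have ht2 : t^2 ≤ 1 := by nlinarith
      have := V0 h
      calc _ ≤ |α h| * V h := by gcongr; exact hV h t ht ht1
        _ ≤ _ := by
          rw [le_div_iff₀ (by positivity)]
          exact mul_le_of_le_one_right (by positivity) ht2
    · rw [abs_mul]
      calc _ ≤ |β| * (S/t^2) := by gcongr
        _ = _ := by ring
  obtain ⟨CX, hCX⟩ := hX
  obtain ⟨C0, c00, hC0⟩ := l_zero m a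
  have hl : ∀ l : ℕ, ∃ C, 0 ≤ C ∧ ∀ t, 0 < t → t ≤ 1 → (1 ≤ l → 
    |∑' N : ℕ, pw 0 N * (At (2*l) N t * Dl m a l N t) - (2*l).factorial * (a (m-l) * VV (2*(m-l)) t 0 * (Zt (2*l+1) / (4*t)^(2*l+1)) +
       (a l - a (m-l)) * ∑ μ ∈ range l, VV (2*(m-l)+2*μ) t 0 / ((2*μ).factorial:ℝ) * (Zt (2*l+1-2*μ) / (4*t)^(2*l+1-2*μ)))| ≤ C/t^2) := by
    intro l
    by_cases h : 1 ≤ l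
    · obtain ⟨C, c0, hC⟩ := l_pos m a l h
      exact ⟨C, c0, fun t ht ht1 _ => hC t ht ht1⟩
    · exact ⟨0, le_rfl, fun t ht ht1 h' => absurd h' h⟩
  choose CL cl0 hCL using hl
  set U : ℝ → ℕ → ℝ := fun t i => VV (2*(m-i)) t 0 * (Zt (2*i+1) / (4*t)^(2*i+1)) with hU
  set K : ℕ → ℝ := fun i => ((2*i).factorial:ℝ) * (a (m-i) + ∑ l ∈ Icc 1 m, (a l - a (m-l)) * ((2*l).choose (2*i):ℝ)) with hK
  have hmain : ∀ t : ℝ, ∑ l ∈ Icc 1 m, ((2*l).factorial * (a (m-l) * VV (2*(m-l)) t 0 * (Zt (2*l+1) / (4*t)^(2*l+1)) +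
       (a l - a (m-l)) * ∑ μ ∈ range l, VV (2*(m-l)+2*μ) t 0 / ((2*μ).factorial:ℝ) * (Zt (2*l+1-2*μ) / (4*t)^(2*l+1-2*μ)))) = ∑ i ∈ Icc 1 m, K i * U t i := by
    intro t
    have h1 : ∀ l ∈ Icc 1 m, ((2*l).factorial * (a (m-l) * VV (2*(m-l)) t 0 * (Zt (2*l+1) / (4*t)^(2*l+1)) +
       (a l - a (m-l)) * ∑ μ ∈ range l, VV (2*(m-l)+2*μ) t 0 / ((2*μ).factorial:ℝ) * (Zt (2*l+1-2*μ) / (4*t)^(2*l+1-2*μ)))) = 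
       (2*l).factorial * a (m-l) * U t l + ∑ i ∈ Icc 1 m, (a l - a (m-l)) * (((2*i).factorial:ℝ) * ((2*l).choose (2*i):ℝ) * U t i) := by
      intro l hl
      rw [Finset.mem_Icc] at hl
      rw [← Finset.mul_sum, ← l_reorg m l hl.2 (U t)]
      have h2 : ∑ μ ∈ range l, VV (2*(m-l)+2*μ) t 0 / ((2*μ).factorial:ℝ) * (Zt (2*l+1-2*μ) / (4*t)^(2*l+1-2*μ)) = ∑ μ ∈ range l, U t (l-μ) / ((2*μ).factorial:ℝ) := by
        refine Finset.sum_congr rfl fun μ hμ => ?_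
        rw [Finset.mem_range] at hμ
        simp only [hU]
        rw [show 2*(m-l)+2*μ = 2*(m-(l-μ)) by omega, show 2*l+1-2*μ = 2*(l-μ)+1 by omega]
        ring
      rw [h2]
      simp only [hU]
      ring
    rw [Finset.sum_congr rfl h1, Finset.sum_add_distrib, Finset.sum_comm, ← Finset.sum_add_distrib]
    refine Finset.sum_congr rfl fun i hi => ?_
    simp only [hK]
    rw [mul_add, add_mul, Finset.mul_sum, Finset.sum_mul]
    congr 1
    exact Finset.sum_congr rfl fun l _ => by ring
  have hfin := asym_zero m K (fun i => bb (2*(m-i)) 0 / 2 * (Zt (2*i+1)/4^(2*i+1))) (fun i t => VV (2*(m-i)) t 0 * (Zt (2*i+1)/4^(2*i+1)))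
    (by
      intro i hi
      have := Zt_pos (2*i+1) (by rw [Finset.mem_Icc] at hi; omega)
      exact mul_ne_zero (div_ne_zero (bb_zero_ne _) (by norm_num)) (by positivity))
    (by
      intro i hi
      have := Zt_pos (2*i+1) (by rw [Finset.mem_Icc] at hi; omega)
      obtain ⟨C, c0, hC⟩ := VV_lim (2*(m-i))
      refine ⟨C * (Zt (2*i+1)/4^(2*i+1)), fun t ht ht1 => ?_⟩
      rw [← sub_mul, abs_mul, abs_of_pos (show 0 < Zt (2*i+1)/4^(2*i+1) by positivity)]
      calc _ ≤ C*t*(Zt (2*i+1)/4^(2*i+1)) := by gcongr; exact hC t ht ht1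
        _ = _ := by ring)
    (CX + C0 + ∑ l ∈ Icc 1 m, CL l)
    (by
      intro t ht ht1
      have e1 : ∑ i ∈ Icc 1 m, K i * (VV (2*(m-i)) t 0 * (Zt (2*i+1)/4^(2*i+1)) / t^(2*i+1)) = ∑ i ∈ Icc 1 m, K i * U t i := by
        refine Finset.sum_congr rfl fun i _ => ?_
        simp only [hU]
        rw [mul_pow, ← div_div, mul_div_assoc]
      rw [e1, ← hmain t]
      set G : ℕ → ℝ := fun l => ∑' N : ℕ, pw 0 N * (At (2*l) N t * Dl m a l N t) with hG
      have e2 : ∑ l ∈ range (m+1), G l = G 0 + ∑ l ∈ Icc 1 m, G l := by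
        rw [Finset.range_eq_Ico, Finset.sum_eq_sum_Ico_succ_bot (by omega)]
        rfl
      have h1 := hCX t ht ht1
      have h2 := hC0 t ht ht1
      have h3 : |∑ l ∈ Icc 1 m, (G l - ((2*l).factorial * (a (m-l) * VV (2*(m-l)) t 0 * (Zt (2*l+1) / (4*t)^(2*l+1)) +
       (a l - a (m-l)) * ∑ μ ∈ range l, VV (2*(m-l)+2*μ) t 0 / ((2*μ).factorial:ℝ) * (Zt (2*l+1-2*μ) / (4*t)^(2*l+1-2*μ)))))| ≤ ∑ l ∈ Icc 1 m, CL l / t^2 := by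
        refine (Finset.abs_sum_le_sum_abs _ _).trans (Finset.sum_le_sum fun l hl => ?_)
        exact hCL l t ht ht1 (Finset.mem_Icc.1 hl).1
      rw [Finset.sum_sub_distrib, ← Finset.sum_div] at h3
      have h1' : |∑ l ∈ range (m+1), G l| ≤ CX/t^2 := h1
      have h2' : |G 0| ≤ C0/t^2 := h2
      rw [e2] at h1'
      rw [add_div, add_div]
      rw [abs_le] at *
      constructor <;> linarith [h1'.1, h1'.2, h2'.1, h2'.2, h3.1, h3.2])
  intro i hi him
  have h1 := hfin i (by rw [Finset.mem_Icc]; omega)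
  simp only [hK] at h1
  have h2 := (mul_eq_zero.1 h1).resolve_left (by positivity)
  have e2 : ∑ l ∈ range (m+1), (a (m-l) - a l) * ((2*l).choose (2*i):ℝ) = -∑ l ∈ Icc 1 m, (a l - a (m-l)) * ((2*l).choose (2*i):ℝ) := by
    rw [Finset.range_eq_Ico, Finset.sum_eq_sum_Ico_succ_bot (by omega), Nat.choose_eq_zero_of_lt (show 2*0 < 2*i by omega), ← Finset.sum_neg_distrib]
    simp only [Nat.cast_zero, mul_zero, zero_add]
    refine Finset.sum_congr rfl fun l _ => by ring
  rw [e2]; linarith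


lemma even_poly_zero (m : ℕ) (b : ℕ → ℝ) (h : ∀ y : ℝ, ∑ l ∈ range (m+1), b l * y^(2*l) = 0) :
    ∀ l ≤ m, b l = 0 := by
  intro l hl
  have h1 : (∑ j ∈ range (m+1), Polynomial.C (b j) * Polynomial.X^(2*j) : Polynomial ℝ) = 0 := by
    apply Polynomial.funext
    intro y
    rw [Polynomial.eval_finsetSum, Polynomial.eval_zero, ← h y]
    exact Finset.sum_congr rfl fun j _ => by simp
  have h2 := congrArg (fun p => Polynomial.coeff p (2*l)) h1
  simp only [Polynomial.finsetSum_coeff, Polynomial.coeff_C_mul, Polynomial.coeff_X_pow, Polynomial.coeff_zero] at h2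
  rw [Finset.sum_eq_single l] at h2
  · simpa using h2
  · intro j _ hj
    rw [if_neg (by omega), mul_zero]
  · intro hn; exact absurd (Finset.mem_range.2 (by omega)) hn

lemma sg_prime (h p : ℕ) (hp : p.Prime) : sg h p = 1 + (p:ℝ)^h := by
  unfold sg
  rw [hp.divisors, Finset.sum_pair hp.one_lt.ne]
  simp

lemma prime_growth (m : ℕ) (hm : 1 ≤ m) (c κ : ℝ) (hκ : 0 < κ) (S : ℕ → ℝ) (hS : ∀ n, 0 ≤ S n) (α : ℕ → ℝ) (β : ℝ)
    (H : ∀ n, 0 < n → c * (S n + κ * sg (2*m+1) n) = ∑ h ∈ range (2*m+1), α h * sg h n + β*(n * sg (2*m-1) n)) : c = 0 := by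
  by_contra hc
  have hc' : 0 < |c| := abs_pos.2 hc
  set K := ∑ h ∈ range (2*m+1), |α h| * 2 + |β| * 2 with hK
  obtain ⟨N, hN⟩ := exists_nat_gt (K/(|c| * κ))
  obtain ⟨p, hpN, hp⟩ := Nat.exists_infinite_primes (N+1)
  have hp0 : (1:ℝ) ≤ p := by exact_mod_cast hp.one_lt.le
  have h1 := congrArg abs (H p hp.pos)
  have hlow : |c| * (κ * (p:ℝ)^(2*m+1)) ≤ |c * (S p + κ * sg (2*m+1) p)| := by
    rw [abs_mul]
    gcongr
    refine le_trans ?_ (le_abs_self _)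
    rw [sg_prime _ _ hp]
    have := hS p
    nlinarith
  have hsg : ∀ h : ℕ, |sg h p| ≤ 2*(p:ℝ)^h := by
    intro h
    rw [sg_prime _ _ hp, abs_of_nonneg (by positivity)]
    have := one_le_pow₀ hp0 (n := h)
    linarith
  have hup : |∑ h ∈ range (2*m+1), α h * sg h p + β*(p * sg (2*m-1) p)| ≤ K * (p:ℝ)^(2*m) := by
    refine (abs_add_le _ _).trans ?_
    rw [hK, add_mul, Finset.sum_mul]
    refine add_le_add ((Finset.abs_sum_le_sum_abs _ _).trans (Finset.sum_le_sum fun h hh => ?_)) ?_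
    · rw [abs_mul, mul_assoc]
      rw [Finset.mem_range] at hh
      refine mul_le_mul_of_nonneg_left ((hsg h).trans ?_) (abs_nonneg _)
      have := pow_le_pow_right₀ hp0 (show h ≤ 2*m by omega)
      linarith
    · rw [abs_mul, abs_mul, mul_assoc]
      refine mul_le_mul_of_nonneg_left ?_ (abs_nonneg _)
      rw [abs_of_nonneg (show (0:ℝ) ≤ p by positivity)]
      calc (p:ℝ) * |sg (2*m-1) p| ≤ p * (2 * (p:ℝ)^(2*m-1)) := by gcongr; exact hsg _
        _ = 2 * (p:ℝ)^(2*m) := by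
          have : (p:ℝ)^(2*m) = (p:ℝ)^(2*m-1) * p := by rw [← pow_succ]; congr 1; omega
          rw [this]; ring
  rw [← h1] at hup
  have h2 := hlow.trans hup
  have hpp : 0 < (p:ℝ)^(2*m) := by positivity
  have h3 : |c| * κ * p ≤ K := by
    have : (|c| * κ * p) * (p:ℝ)^(2*m) ≤ K * (p:ℝ)^(2*m) := by
      calc _ = |c| * (κ * (p:ℝ)^(2*m+1)) := by ring
        _ ≤ _ := h2
    exact le_of_mul_le_mul_right this hpp
  have h4 : K < N * (|c| * κ) := by rwa [div_lt_iff₀ (by positivity)] at hN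
  have h5 : (N:ℝ) ≤ p := by exact_mod_cast (by omega : N ≤ p)
  have h6 : (N:ℝ) * (|c| * κ) ≤ p * (|c| * κ) := by gcongr
  linarith

theorem partIII (m : ℕ) (hm : 1 ≤ m) (a : ℕ → ℝ) (α : ℕ → ℝ) (β : ℝ)
    (H : ∀ n, 0 < n → SS m a n + ∑ h ∈ range (2*m+2), α h * sg h n + β*(n * sg (2*m-1) n) = 0)
    (hα : α (2*m+1) = ∑ j ∈ range (m+1), a j * ((2*j).factorial * (2*(m-j)).factorial) * (1/(2*(2*m+1).factorial))) :
    ∀ j ≤ m, a j = 0 := by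
  have hI := partI m hm a α β H
  obtain ⟨c, hc⟩ := partII m hm a (rel_of_coeff m a hm hI) α β H
  have hb := even_poly_zero m (fun l => a (m-l) - a l - c * ((if l = 0 then 1 else 0) - (if l = m then 1 else 0))) (by
    intro y
    have h1 := hc 1 y
    rw [AA_eq] at h1
    simp only [one_pow, mul_one] at h1
    simp only [sub_mul, Finset.sum_sub_distrib, mul_sub]
    simp only [sub_mul, Finset.sum_sub_distrib] at h1
    rw [h1]
    simp [mul_assoc, mul_sub])
  have hd : ∀ l ≤ m, a (m-l) - a l = c * ((if l = 0 then 1 else 0) - (if l = m then 1 else 0)) := fun l hl => sub_eq_zero.1 (hb l hl)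
  have hval : ∀ i, 1 ≤ i → i ≤ m → a (m-i) = -c * ((2*m).choose (2*i) : ℝ) := by
    intro i h1 h2
    rw [hI i h1 h2, Finset.sum_eq_single m]
    · rw [hd m le_rfl, if_neg (by omega), if_pos rfl]; ring
    · intro l hl hlm
      rw [Finset.mem_range] at hl
      rw [hd l (by omega), if_neg hlm]
      by_cases h0 : l = 0
      · subst h0
        rw [Nat.choose_eq_zero_of_lt (by omega)]; simp
      · rw [if_neg h0]; simp
    · intro hn; exact absurd (Finset.mem_range.2 (by omega)) hn
  have ham : a m = 0 := by
    have h1 := hd 0 (by omega)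
    have h2 := hval m hm le_rfl
    rw [if_pos rfl, if_neg (by omega), Nat.sub_zero] at h1
    rw [Nat.sub_self, Nat.choose_self] at h2
    rw [h2] at h1
    push_cast at h1
    linarith
  have hval2 : ∀ j < m, a j = -c * ((2*m).choose (2*j) : ℝ) := by
    intro j hj
    have h1 := hval (m-j) (by omega) (by omega)
    rw [show m - (m-j) = j by omega, show 2*(m-j) = 2*m - 2*j by omega, Nat.choose_symm (by omega)] at h1
    exact h1
  set b : ℕ → ℝ := fun j => if j < m then ((2*m).choose (2*j) : ℝ) else 0 with hbdef
  have hab : ∀ j ≤ m, a j = -c * b j := by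
    intro j hj
    simp only [hbdef]
    split_ifs with h
    · exact hval2 j h
    · rw [show j = m by omega, ham]; simp
  have hSS : ∀ n, SS m a n = -c * SS m b n := by
    intro n
    unfold SS PP
    rw [Finset.mul_sum]
    refine Finset.sum_congr rfl fun p _ => ?_
    rw [Finset.mul_sum]
    refine Finset.sum_congr rfl fun j hj => ?_
    rw [Finset.mem_range] at hj
    rw [hab j (by omega)]; ring
  have hSb : ∀ n, 0 ≤ SS m b n := by
    intro n
    unfold SS PP
    refine Finset.sum_nonneg fun p _ => Finset.sum_nonneg fun j _ => ?_
    have : 0 ≤ b j := by simp only [hbdef]; split_ifs <;> positivity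
    positivity
  have hα2 : α (2*m+1) = -c * (m * (2*m).factorial / (2*(2*m+1).factorial)) := by
    rw [hα, Finset.sum_range_succ, ham]
    have : ∀ j ∈ range m, a j * (((2*j).factorial:ℝ) * (2*(m-j)).factorial) * (1/(2*(2*m+1).factorial)) = -c * ((2*m).factorial / (2*(2*m+1).factorial)) := by
      intro j hj
      rw [Finset.mem_range] at hj
      have h2 := Nat.choose_mul_factorial_mul_factorial (show 2*j ≤ 2*m by omega)
      rw [show 2*m - 2*j = 2*(m-j) by omega] at h2
      have h3 : ((2*m).choose (2*j):ℝ) * ((2*j).factorial:ℝ) * ((2*(m-j)).factorial:ℝ) = (2*m).factorial := by exact_mod_cast h2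
      rw [← h3, hval2 j hj]; ring
    rw [Finset.sum_congr rfl this, Finset.sum_const, Finset.card_range, nsmul_eq_mul]
    ring
  have hc0 : c = 0 := by
    refine prime_growth m hm c (m * (2*m).factorial / (2*(2*m+1).factorial)) ?_ (SS m b) hSb α β ?_
    · have : (0:ℝ) < m := by exact_mod_cast hm
      positivity
    · intro n hn
      have h1 := H n hn
      rw [hSS, Finset.sum_range_succ, hα2] at h1
      linarith
  intro j hj
  rw [hab j hj, hc0]; simp


/-- `f` has the power series expansion with coefficients `e` on the unit disc -/
def Co (f : ℂ → ℂ) (e : ℕ → ℂ) : Prop := ∀ q : ℂ, ‖q‖ < 1 → HasSum (fun n => e n * q^n) (f q)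

lemma Co.zero_unique (e : ℕ → ℂ) (h : Co (fun _ => 0) e) (n : ℕ) : e n = 0 := by
  have h1 : HasFPowerSeriesAt (0 : ℂ → ℂ) (FormalMultilinearSeries.ofScalars ℂ e) 0 := by
    rw [hasFPowerSeriesAt_iff]
    filter_upwards [Metric.ball_mem_nhds (0:ℂ) one_pos] with z hz
    have := h z (by simpa using hz)
    refine this.congr_fun fun n => ?_
    simp [FormalMultilinearSeries.coeff_ofScalars, mul_comm]
  have h2 := h1.eq_zero
  have h3 := congrArg (fun p => FormalMultilinearSeries.coeff p n) h2
  simp only [FormalMultilinearSeries.coeff_ofScalars] at h3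
  rw [h3]; rfl

lemma summ1 (h : ℕ) (r : ℝ) (h0 : 0 < r) (h1 : r < 1) : Summable (fun n : ℕ => ((n:ℝ)+1)^h * r^n) := by
  have := summable_pow_mul_geometric_of_norm_lt_one h (r := r) (by rwa [Real.norm_eq_abs, abs_of_pos h0])
  have h2 := ((summable_nat_add_iff 1).2 this).mul_right (1/r)
  refine h2.congr fun n => ?_
  push_cast
  field_simp
  ring

lemma exists_r (q : ℂ) (hq : ‖q‖ < 1) : ∃ r : ℝ, ‖q‖ ≤ r ∧ 0 < r ∧ r < 1 :=
  ⟨(‖q‖+1)/2, by linarith, by have := norm_nonneg q; linarith, by linarith⟩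

lemma norm_pow_le_r (q : ℂ) (r : ℝ) (hq : ‖q‖ ≤ r) (h0 : 0 < r) (h1 : r < 1) (a b : ℕ) (hab : b ≤ a) : ‖q^a‖ ≤ r^b := by
  rw [norm_pow]
  exact (pow_le_pow_left₀ (norm_nonneg _) hq a).trans (pow_le_pow_of_le_one h0.le h1.le hab)

lemma summ2 (h g : ℕ) (q : ℂ) (hq : ‖q‖ < 1) :
    Summable (fun p : ℕ × ℕ => ((p.2:ℂ)+1)^g * ((p.1:ℂ)+1)^h * q^((p.1+1)*(p.2+1))) := by
  obtain ⟨r, hr, h0, h1⟩ := exists_r q hq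
  have hs := (summ1 h r h0 h1).mul_of_nonneg (summ1 g r h0 h1) (fun n => by positivity) (fun n => by positivity)
  refine Summable.of_norm_bounded hs ?_
  rintro ⟨x, y⟩
  have h2 := norm_pow_le_r q r hr h0 h1 ((x+1)*(y+1)) (x+y) (by nlinarith)
  have e1 : ∀ n : ℕ, ‖((n:ℂ)+1)‖ = (n:ℝ)+1 := fun n => by
    have : ((n:ℂ)+1) = ((n+1:ℕ):ℂ) := by push_cast; ring
    rw [this, Complex.norm_natCast]; push_cast; ring
  simp only [norm_mul, norm_pow q] at *
  rw [norm_pow, norm_pow, e1, e1]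
  calc _ ≤ ((y:ℝ)+1)^g * ((x:ℝ)+1)^h * r^(x+y) := by gcongr
    _ = _ := by rw [pow_add]; ring

lemma summ4 (r s : ℕ) (q : ℂ) (hq : ‖q‖ < 1) :
    Summable (fun p : ℕ × ℕ × ℕ × ℕ =>
      ((p.1 : ℂ) + 1) ^ r * ((p.2.1 : ℂ) + 1) ^ s *
        q ^ ((p.1 + 1) * (p.2.2.1 + 1) + (p.2.1 + 1) * (p.2.2.1 + 1 + p.2.2.2 + 1))) := by
  obtain ⟨ρ, hr, h0, h1⟩ := exists_r q hq
  have hg := summ1 0 ρ h0 h1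
  have hs2 := hg.mul_of_nonneg hg (fun n => by positivity) (fun n => by positivity)
  have hs3 := (summ1 s ρ h0 h1).mul_of_nonneg hs2 (fun n => by positivity) (fun n => by positivity)
  have hs := (summ1 r ρ h0 h1).mul_of_nonneg hs3 (fun n => by positivity) (fun n => by positivity)
  refine Summable.of_norm_bounded hs ?_
  rintro ⟨x, y, z, w⟩
  have h2 := norm_pow_le_r q ρ hr h0 h1 ((x+1)*(z+1)+(y+1)*(z+1+w+1)) (x+(y+(z+w))) (by nlinarith [Nat.zero_le (x*z), Nat.zero_le (y*z), Nat.zero_le (y*w)])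
  have e1 : ∀ n : ℕ, ‖((n:ℂ)+1)‖ = (n:ℝ)+1 := fun n => by
    have : ((n:ℂ)+1) = ((n+1:ℕ):ℂ) := by push_cast; ring
    rw [this, Complex.norm_natCast]; push_cast; ring
  simp only [norm_mul, norm_pow q] at *
  rw [norm_pow, norm_pow, e1, e1]
  calc _ ≤ ((x:ℝ)+1)^r * ((y:ℝ)+1)^s * ρ^(x+(y+(z+w))) := by gcongr
    _ = _ := by rw [pow_add, pow_add, pow_add]; ring

/-- pairs with a given product, shifted -/
def Q2 (n : ℕ) : Finset (ℕ × ℕ) := (range n ×ˢ range n).filter fun p => (p.1+1)*(p.2+1) = n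

lemma mem_Q2 (p : ℕ × ℕ) (n : ℕ) : p ∈ Q2 n ↔ (p.1+1)*(p.2+1) = n := by
  simp only [Q2, mem_filter, mem_product, mem_range, and_iff_right_iff_imp]
  intro h
  constructor <;> nlinarith

lemma sum_Q2 (n : ℕ) (f : ℕ → ℕ → ℂ) : ∑ p ∈ Q2 n, f (p.1+1) (p.2+1) = ∑ d ∈ n.divisors, f d (n/d) := by
  refine Finset.sum_nbij' (fun p => p.1+1) (fun d => (d-1, n/d-1)) ?_ ?_ ?_ ?_ ?_
  · rintro ⟨x, y⟩ h
    rw [mem_Q2] at h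
    simp only at h
    rw [Nat.mem_divisors]
    exact ⟨⟨_, h.symm⟩, by rw [← h]; positivity⟩
  · intro d h
    rw [Nat.mem_divisors] at h
    obtain ⟨⟨x, rfl⟩, h0⟩ := h
    have hd : 0 < d := Nat.pos_of_ne_zero (by rintro rfl; simp at h0)
    have hx : 0 < x := Nat.pos_of_ne_zero (by rintro rfl; simp at h0)
    rw [mem_Q2]
    simp only [Nat.mul_div_cancel_left _ hd]
    rw [Nat.sub_add_cancel hd, Nat.sub_add_cancel hx]
  · rintro ⟨x, y⟩ h
    rw [mem_Q2] at h
    simp only at h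
    subst h
    rw [Nat.mul_div_cancel_left _ (by omega)]; simp
  · intro d h
    have := Nat.pos_of_mem_divisors h
    simp only; omega
  · rintro ⟨x, y⟩ h
    rw [mem_Q2] at h
    simp only at h
    subst h
    simp only
    rw [Nat.mul_div_cancel_left _ (by omega)]

lemma Co_single (h g : ℕ) : Co (fun q => ∑' p : ℕ × ℕ, ((p.2:ℂ)+1)^g * ((p.1:ℂ)+1)^h * q^((p.1+1)*(p.2+1)))
    (fun n => ∑ d ∈ n.divisors, ((n/d : ℕ):ℂ)^g * (d:ℂ)^h) := by
  intro q hq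
  have h1 := fiber_sum _ (fun p : ℕ × ℕ => (p.1+1)*(p.2+1)) Q2 (fun i _ n => mem_Q2 i n) (summ2 h g q hq)
  refine h1.congr_fun fun n => ?_
  rw [Finset.sum_mul, ← sum_Q2 n (fun d e => ((e:ℂ)^g * (d:ℂ)^h) * q^n)]
  refine Finset.sum_congr rfl fun p hp => ?_
  rw [mem_Q2] at hp
  rw [hp]; push_cast; ring

lemma Co_double (r s : ℕ) : Co (fun q => ∑' p : ℕ × ℕ × ℕ × ℕ,
      ((p.1 : ℂ) + 1) ^ r * ((p.2.1 : ℂ) + 1) ^ s *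
        q ^ ((p.1 + 1) * (p.2.2.1 + 1) + (p.2.1 + 1) * (p.2.2.1 + 1 + p.2.2.2 + 1)))
    (fun n => ∑ p ∈ (Quad n).filter (fun p => p.2.2.1 < p.2.2.2), (p.1:ℂ)^r * (p.2.1:ℂ)^s) := by
  intro q hq
  have h1 := fiber_sum _ (fun p : ℕ × ℕ × ℕ × ℕ => (p.1 + 1) * (p.2.2.1 + 1) + (p.2.1 + 1) * (p.2.2.1 + 1 + p.2.2.2 + 1))
    (fun n => ((Quad n).filter (fun p => p.2.2.1 < p.2.2.2)).image (fun p => (p.1-1, p.2.1-1, p.2.2.1-1, p.2.2.2-p.2.2.1-1)))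
    (by
      rintro ⟨x, y, z, w⟩ _ n
      simp only [mem_image, mem_filter]
      constructor
      · rintro ⟨⟨a, b, c, d⟩, ⟨h1, h2⟩, h3⟩
        rw [mem_Quad] at h1
        simp only [Prod.mk.injEq] at h2 h3
        obtain ⟨rfl, rfl, rfl, rfl⟩ := h3
        rw [show a - 1 + 1 = a by omega, show b-1+1 = b by omega, show c - 1 + 1 = c by omega, show c + (d-c-1)+1 = d by omega]
        exact h1.2.2.2.2
      · intro h
        refine ⟨(x+1, y+1, z+1, z+1+w+1), ⟨?_, by simp only; omega⟩, ?_⟩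
        · rw [mem_Quad]; exact ⟨by omega, by omega, by omega, by omega, h⟩
        · simp only [Prod.mk.injEq]; omega)
    (summ4 r s q hq)
  refine h1.congr_fun fun n => ?_
  rw [Finset.sum_mul, Finset.sum_image]
  · refine Finset.sum_congr rfl ?_
    rintro ⟨a, b, c, d⟩ h
    rw [mem_filter, mem_Quad] at h
    obtain ⟨⟨h1, h2, h3, h4, h5⟩, h6⟩ := h
    simp only at h6 ⊢
    rw [show a - 1 + 1 = a by omega, show b-1+1 = b by omega, show c - 1 + 1 = c by omega, show c + (d-c-1)+1 = d by omega, h5,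
      Nat.cast_sub h1, Nat.cast_sub h2]
    push_cast; ring
  · rintro ⟨a, b, c, d⟩ h ⟨a', b', c', d'⟩ h' he
    simp only [coe_filter, Set.mem_ofPred_eq, mem_Quad] at h h'
    simp only [Prod.mk.injEq] at he ⊢
    omega


lemma Co.add {f g : ℂ → ℂ} {e e' : ℕ → ℂ} (h : Co f e) (h' : Co g e') : Co (fun q => f q + g q) (fun n => e n + e' n) :=
  fun q hq => ((h q hq).add (h' q hq)).congr_fun fun n => by ring

lemma Co.smul {f : ℂ → ℂ} {e : ℕ → ℂ} (x : ℂ) (h : Co f e) : Co (fun q => x * f q) (fun n => x * e n) :=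
  fun q hq => ((h q hq).mul_left x).congr_fun fun n => by ring

lemma Co.sum {ι : Type*} (s : Finset ι) (f : ι → ℂ → ℂ) (e : ι → ℕ → ℂ) (h : ∀ i ∈ s, Co (f i) (e i)) :
    Co (fun q => ∑ i ∈ s, f i q) (fun n => ∑ i ∈ s, e i n) :=
  fun q hq => (hasSum_sum fun i hi => h i hi q hq).congr_fun fun n => by rw [Finset.sum_mul]

lemma Co_const (x : ℂ) : Co (fun _ => x) (fun n => if n = 0 then x else 0) := fun q _ => by
  refine (hasSum_ite_eq 0 x).congr_fun fun n => ?_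
  by_cases h : n = 0
  · subst h; simp
  · simp [h]

/-- the function is a combination of single divisor series, with `x` as coefficient of the top one -/
def Sgl (m : ℕ) (f : ℂ → ℂ) (x : ℂ) : Prop := ∃ (e α : ℕ → ℂ) (β : ℂ), Co f e ∧ α (2*m+1) = x ∧
  ∀ n, 0 < n → e n = ∑ h ∈ range (2*m+2), α h * sg h n + β * (n * sg (2*m-1) n)

lemma Sgl.add {m : ℕ} {f g : ℂ → ℂ} {x y : ℂ} (h : Sgl m f x) (h' : Sgl m g y) : Sgl m (fun q => f q + g q) (x + y) := by
  obtain ⟨e, α, β, h1, h2, h3⟩ := h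
  obtain ⟨e', α', β', h1', h2', h3'⟩ := h'
  refine ⟨_, fun h => α h + α' h, β + β', h1.add h1', by simp only [h2, h2'], fun n hn => ?_⟩
  simp only [h3 n hn, h3' n hn, add_mul, Finset.sum_add_distrib]; ring

lemma Sgl.smul {m : ℕ} {f : ℂ → ℂ} {x : ℂ} (y : ℂ) (h : Sgl m f x) : Sgl m (fun q => y * f q) (y * x) := by
  obtain ⟨e, α, β, h1, h2, h3⟩ := h
  refine ⟨_, fun h => y * α h, y * β, h1.smul y, by simp only [h2], fun n hn => ?_⟩
  simp only [h3 n hn, mul_add, Finset.mul_sum, mul_assoc]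

lemma Sgl_const (m : ℕ) (x : ℂ) : Sgl m (fun _ => x) 0 :=
  ⟨_, fun _ => 0, 0, Co_const x, rfl, fun n hn => by simp [hn.ne']⟩

lemma Sgl.sum0 {m : ℕ} {ι : Type*} (s : Finset ι) (f : ι → ℂ → ℂ) (h : ∀ i ∈ s, Sgl m (f i) 0) :
    Sgl m (fun q => ∑ i ∈ s, f i q) 0 := by
  classical
  induction s using Finset.induction_on with
  | empty => simpa using Sgl_const m 0
  | insert i s hi ih =>
    have h1 := (h i (by simp)).add (ih fun j hj => h j (by simp [hj]))
    simp only [Finset.sum_insert hi]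
    simpa using h1

lemma sg_complex (h n : ℕ) : ((sg h n : ℝ) : ℂ) = ∑ d ∈ n.divisors, (d:ℂ)^h := by
  unfold sg; push_cast; rfl

lemma gSeries_Co (h : ℕ) : Co (gSeries h) (fun n => ((-1 : ℂ) ^ h / (Nat.factorial (h - 1) : ℂ)) * sg (h-1) n) := by
  have h1 := (Co_single (h-1) 0).smul ((-1 : ℂ) ^ h / (Nat.factorial (h - 1) : ℂ))
  simp only [pow_zero, one_mul] at h1
  simp only [sg_complex]
  exact h1

lemma gSeries_Sgl (m h : ℕ) (h1 : 1 ≤ h) (h2 : h ≤ 2*m+1) : Sgl m (gSeries h) 0 := by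
  refine ⟨_, fun i => if i = h-1 then ((-1 : ℂ) ^ h / (Nat.factorial (h - 1) : ℂ)) else 0, 0, gSeries_Co h, if_neg (by omega), fun n hn => ?_⟩
  simp only [ite_mul, zero_mul, Finset.sum_ite_eq', Finset.mem_range]
  rw [if_pos (by omega), add_zero]

lemma gStar_Sgl (m : ℕ) (hm : 1 ≤ m) : Sgl m (gStar (2*m)) 0 := by
  have h1 := (Co_single (2*m) 1).smul ((-1 : ℂ) ^ (2*m) / (Nat.factorial (2*m) : ℂ))
  simp only [pow_one] at h1
  refine ⟨_, fun _ => 0, ((-1 : ℂ) ^ (2*m) / (Nat.factorial (2*m) : ℂ)), h1, rfl, fun n hn => ?_⟩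
  simp only [zero_mul, Finset.sum_const_zero, zero_add, sg_complex]
  rw [Finset.mul_sum (n.divisors) _ (n:ℂ)]
  congr 1
  refine Finset.sum_congr rfl fun d hd => ?_
  have hdv := Nat.dvd_of_mem_divisors hd
  have e : (n:ℂ) = ((n/d:ℕ):ℂ) * d := by rw [← Nat.cast_mul, Nat.div_mul_cancel hdv]
  have e2 : (d:ℂ)^(2*m) = d * (d:ℂ)^(2*m-1) := by rw [← pow_succ']; congr 1; omega
  rw [e2, ← mul_assoc, ← e]

lemma Gq_Sgl (m : ℕ) : Sgl m (Gq (2*m+2)) (1/(2*m+1).factorial) := by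
  have h0 := (Co_single (2*m+1) 0)
  have h1 : Co (fun q => ∑' n : ℕ, (sigmaFn (2*m+1) (n + 1) : ℂ) * q ^ (n + 1)) (fun n => (sg (2*m+1) n : ℂ)) := by
    intro q hq
    have h2 := h0 q hq
    have h3 : Summable (fun n : ℕ => (sg (2*m+1) n : ℂ) * q^n) := by
      refine h2.summable.congr fun n => ?_
      simp only [sg_complex, pow_zero, one_mul]
    have h4 : ∑' n : ℕ, (sg (2*m+1) n : ℂ) * q^n = ∑' n : ℕ, (sigmaFn (2*m+1) (n + 1) : ℂ) * q ^ (n + 1) := by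
      rw [h3.tsum_eq_zero_add]
      simp only [sg_complex, sigmaFn]
      push_cast
      simp
    have h6 := h3.hasSum
    rw [h4] at h6
    exact h6
  have h5 := (Co_const (zetaTilde (2*m+2))).add (h1.smul ((-1 : ℂ) ^ (2*m+2) / (Nat.factorial (2*m+1) : ℂ)))
  refine ⟨_, fun i => if i = 2*m+1 then 1/(2*m+1).factorial else 0, 0, h5, if_pos rfl, fun n hn => ?_⟩
  have e : (-1:ℂ)^(2*m+2) = 1 := Even.neg_one_pow ⟨m+1, by ring⟩
  simp only [ite_mul, zero_mul, Finset.sum_ite_eq', Finset.mem_range, e, hn.ne', if_false, zero_add, add_zero]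
  rw [if_pos (by omega)]

lemma eps_Sgl (m j : ℕ) (hm : 1 ≤ m) (hj : j ≤ m) : Sgl m (epsSeries (2*j+1) (2*(m-j)+1)) 0 := by
  have e : epsSeries (2*j+1) (2*(m-j)+1) = fun q => (if j = 0 then -1 else 0) * gStar (2*m) q +
      ((if j = m then 1 else 0) * gStar (2*m) q + (if j = m then 1 else 0) * gSeries 1 q) := by
    funext q
    unfold epsSeries
    rw [if_neg (by omega)]
    by_cases h0 : j = 0
    · subst h0
      rw [if_pos (by omega), if_neg (by omega), if_neg (by omega), if_pos rfl, if_neg (by omega)]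
      simp
    · rw [if_neg (by omega), if_neg h0]
      by_cases h1 : j = m
      · subst h1
        rw [if_pos (by omega), if_neg (by omega), if_pos rfl]
        simp
      · rw [if_neg (by omega), if_neg (by omega), if_neg h1]; simp
  rw [e]
  have := ((gStar_Sgl m hm).smul (if j = 0 then -1 else 0)).add (((gStar_Sgl m hm).smul (if j = m then 1 else 0)).add
    ((gSeries_Sgl m 1 le_rfl (by omega)).smul (if j = m then 1 else 0)))
  simpa using this

/-- the single part of the double Eisenstein series -/
lemma Ghalf_decomp (m j : ℕ) (hm : 1 ≤ m) (hj : j ≤ m) : ∃ F : ℂ → ℂ, Sgl m F (1/(2*(2*m+1).factorial)) ∧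
    ∀ q, Ghalf (2*j+1) (2*(m-j)+1) q = gDoubleSeries (2*j+1) (2*(m-j)+1) q + F q := by
  have hrs : 2*j+1 + (2*(m-j)+1) = 2*m+2 := by omega
  have h1 := Sgl.sum0 (m := m) (Icc 1 (2*m+1)) (fun p q => (Ccoef (2*j+1) (2*(m-j)+1) p : ℂ) * gSeries (2*m+2-p) q * zetaTilde p) (by
    intro p hp
    rw [Finset.mem_Icc] at hp
    have := (gSeries_Sgl m (2*m+2-p) (by omega) (by omega)).smul ((Ccoef (2*j+1) (2*(m-j)+1) p : ℂ) * zetaTilde p)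
    rw [mul_zero] at this
    convert this using 2
    ring)
  have h2 := ((Sgl_const m (doubleZetaTilde (2*j+1) (2*(m-j)+1))).add h1).add (((eps_Sgl m j hm hj).smul (1/2)).add ((Gq_Sgl m).smul (1/2)))
  refine ⟨fun q => (doubleZetaTilde (2*j+1) (2*(m-j)+1) + ∑ p ∈ Icc 1 (2*m+1), (Ccoef (2*j+1) (2*(m-j)+1) p : ℂ) * gSeries (2*m+2-p) q * zetaTilde p) +
      ((1/2) * epsSeries (2*j+1) (2*(m-j)+1) q + (1/2) * Gq (2*m+2) q), ?_, fun q => ?_⟩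
  · convert h2 using 1
    have : ((2*m+1).factorial : ℂ) ≠ 0 := by exact_mod_cast Nat.factorial_ne_zero _
    field_simp; ring
  · unfold Ghalf Gdouble
    rw [hrs, show 2*m+2-1 = 2*m+1 by omega]
    ring

lemma SS_of_double (m : ℕ) (x : ℕ → ℝ) (n : ℕ) :
    SS m (fun j => x j / ((2*j).factorial * (2*(m-j)).factorial)) n =
    ∑ j ∈ range (m+1), x j / ((2*j).factorial * (2*(m-j)).factorial) *
      ∑ p ∈ (Quad n).filter (fun p => p.2.2.1 < p.2.2.2), (p.1:ℝ)^(2*j) * (p.2.1:ℝ)^(2*(m-j)) := by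
  unfold SS PP
  rw [Finset.sum_comm]
  refine Finset.sum_congr rfl fun j _ => ?_
  rw [Finset.mul_sum]
  exact Finset.sum_congr rfl fun p _ => by ring

/-- real double coefficient -/
def Dco (m j n : ℕ) : ℝ := ∑ p ∈ (Quad n).filter (fun p => p.2.2.1 < p.2.2.2), (p.1:ℝ)^(2*j) * (p.2.1:ℝ)^(2*(m-j))

lemma gDouble_Co (m j : ℕ) : Co (gDoubleSeries (2*j+1) (2*(m-j)+1))
    (fun n => (((1:ℝ)/((2*j).factorial * (2*(m-j)).factorial) * Dco m j n : ℝ) : ℂ)) := by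
  have h1 := (Co_double (2*j) (2*(m-j))).smul (1/(((2*j).factorial:ℂ) * (2*(m-j)).factorial))
  have e : (-1:ℂ)^(2*j+1+(2*(m-j)+1)) = 1 := Even.neg_one_pow ⟨j+(m-j)+1, by ring⟩
  have h2 : gDoubleSeries (2*j+1) (2*(m-j)+1) = fun q => (1/(((2*j).factorial:ℂ) * (2*(m-j)).factorial)) * ∑' p : ℕ × ℕ × ℕ × ℕ,
      ((p.1 : ℂ) + 1) ^ (2*j) * ((p.2.1 : ℂ) + 1) ^ (2*(m-j)) *
        q ^ ((p.1 + 1) * (p.2.2.1 + 1) + (p.2.1 + 1) * (p.2.2.1 + 1 + p.2.2.2 + 1)) := by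
    funext q
    unfold gDoubleSeries
    rw [e]; rfl
  rw [h2]
  convert h1 using 2 with n
  unfold Dco
  push_cast
  rfl

theorem real_final (m : ℕ) (hm : 1 ≤ m) (x : ℕ → ℝ) (α : ℕ → ℕ → ℝ) (β : ℕ → ℝ)
    (hα : ∑ j ∈ range (m+1), α j (2*m+1) = ∑ j ∈ range (m+1), x j * (1/(2*(2*m+1).factorial)))
    (H : ∀ n, 0 < n → ∑ j ∈ range (m+1), (x j * (1/((2*j).factorial * (2*(m-j)).factorial) * Dco m j n) +
      (∑ h ∈ range (2*m+2), α j h * sg h n + β j * (n * sg (2*m-1) n))) = 0) : ∀ j ≤ m, x j = 0 := by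
  have h1 := partIII m hm (fun j => x j / ((2*j).factorial * (2*(m-j)).factorial)) (fun h => ∑ j ∈ range (m+1), α j h)
    (∑ j ∈ range (m+1), β j) (by
      intro n hn
      rw [← H n hn, SS_of_double]
      simp only [Finset.sum_add_distrib, Finset.sum_mul]
      rw [Finset.sum_comm (s := range (2*m+2)), add_assoc]
      congr 1
      refine Finset.sum_congr rfl fun j _ => ?_
      unfold Dco; ring) (by
      rw [hα]
      refine Finset.sum_congr rfl fun j _ => ?_
      have h1 : ((2*j).factorial : ℝ) ≠ 0 := by positivity
      have h2 : ((2*(m-j)).factorial : ℝ) ≠ 0 := by positivity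
      field_simp)
  intro j hj
  have h2 := h1 j hj
  have h1 : ((2*j).factorial : ℝ) ≠ 0 := by positivity
  have h2' : ((2*(m-j)).factorial : ℝ) ≠ 0 := by positivity
  rcases div_eq_zero_iff.1 h2 with h | h
  · exact h
  · exact absurd h (mul_ne_zero h1 h2')

lemma reindex (m : ℕ) (F : ℕ → ℂ) : ∑ r ∈ Icc 1 (2*m+2-1), (if Odd r ∧ Odd (2*m+2-r) then F r else 0) = ∑ j ∈ range (m+1), F (2*j+1) := by
  rw [← Finset.sum_filter]
  symm
  refine Finset.sum_nbij' (fun j => 2*j+1) (fun r => r/2) ?_ ?_ ?_ ?_ ?_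
  · intro j hj
    simp only [Finset.mem_filter, Finset.mem_Icc, Finset.mem_range, Nat.odd_iff] at *
    omega
  · intro j hj
    simp only [Finset.mem_filter, Finset.mem_Icc, Finset.mem_range, Nat.odd_iff] at *
    omega
  · intro j hj; omega
  · intro j hj
    simp only [Finset.mem_filter, Finset.mem_Icc, Nat.odd_iff] at *
    omega
  · intro j _; rfl

theorem final_aux (m : ℕ) (hm : 1 ≤ m) (c : ℕ → ℂ)
    (h : ∀ q : ℂ, ‖q‖ < 1 → ∑ j ∈ range (m+1), c (2*j+1) * Ghalf (2*j+1) (2*(m-j)+1) q = 0) :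
    ∀ j ≤ m, c (2*j+1) = 0 := by
  have hd : ∀ j : ℕ, ∃ (F : ℂ → ℂ) (e α : ℕ → ℂ) (β : ℂ), j ≤ m → (∀ q, Ghalf (2*j+1) (2*(m-j)+1) q = gDoubleSeries (2*j+1) (2*(m-j)+1) q + F q) ∧
      Co F e ∧ α (2*m+1) = (1/(2*(2*m+1).factorial)) ∧ ∀ n, 0 < n → e n = ∑ h ∈ range (2*m+2), α h * sg h n + β * (n * sg (2*m-1) n) := by
    intro j
    by_cases hj : j ≤ m
    · obtain ⟨F, ⟨e, α, β, h1, h2, h3⟩, h4⟩ := Ghalf_decomp m j hm hj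
      exact ⟨F, e, α, β, fun _ => ⟨h4, h1, h2, h3⟩⟩
    · exact ⟨0, 0, 0, 0, fun h => absurd h hj⟩
  choose F e α β hF using hd
  have hco : Co (fun _ => 0) (fun n => ∑ j ∈ range (m+1), c (2*j+1) * ((((1:ℝ)/((2*j).factorial * (2*(m-j)).factorial) * Dco m j n : ℝ) : ℂ) + e j n)) := by
    have h1 := Co.sum (range (m+1)) (fun j q => c (2*j+1) * (gDoubleSeries (2*j+1) (2*(m-j)+1) q + F j q))
      (fun j n => c (2*j+1) * ((((1:ℝ)/((2*j).factorial * (2*(m-j)).factorial) * Dco m j n : ℝ) : ℂ) + e j n)) (fun j hj =>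
        ((gDouble_Co m j).add (hF j (by rw [Finset.mem_range] at hj; omega)).2.1).smul _)
    intro q hq
    have h2 := h1 q hq
    rw [← h q hq]
    convert h2 using 1
    refine Finset.sum_congr rfl fun j hj => ?_
    rw [(hF j (by rw [Finset.mem_range] at hj; omega)).1 q]
  have hz := hco.zero_unique
  have hz2 : ∀ n, 0 < n → ∑ j ∈ range (m+1), (c (2*j+1) * ((((1:ℝ)/((2*j).factorial * (2*(m-j)).factorial) * Dco m j n : ℝ) : ℂ)) +
      (∑ h ∈ range (2*m+2), c (2*j+1) * α j h * (sg h n : ℂ) + c (2*j+1) * β j * ((n * sg (2*m-1) n : ℝ):ℂ))) = 0 := by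
    intro n hn
    rw [← hz n]
    refine Finset.sum_congr rfl fun j hj => ?_
    rw [(hF j (by rw [Finset.mem_range] at hj; omega)).2.2.2 n hn, mul_add, mul_add, Finset.mul_sum]
    push_cast
    simp only [mul_assoc]
  have hcast : ∀ j ≤ m, α j (2*m+1) = ((1/(2*(2*m+1).factorial) : ℝ) : ℂ) := by
    intro j hj
    rw [(hF j hj).2.2.1]; push_cast; rfl
  intro j hj
  apply Complex.ext
  · refine real_final m hm (fun j => (c (2*j+1)).re) (fun j h => (c (2*j+1) * α j h).re) (fun j => (c (2*j+1) * β j).re) ?_ ?_ j hj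
    · refine Finset.sum_congr rfl fun i hi => ?_
      rw [hcast i (by rw [Finset.mem_range] at hi; omega), Complex.re_mul_ofReal]
    · intro n hn
      have h1 := congrArg Complex.re (hz2 n hn)
      simp only [Complex.re_sum, Complex.add_re, Complex.re_mul_ofReal, Complex.zero_re] at h1
      exact h1
  · refine real_final m hm (fun j => (c (2*j+1)).im) (fun j h => (c (2*j+1) * α j h).im) (fun j => (c (2*j+1) * β j).im) ?_ ?_ j hj
    · refine Finset.sum_congr rfl fun i hi => ?_
      rw [hcast i (by rw [Finset.mem_range] at hi; omega), Complex.im_mul_ofReal]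
    · intro n hn
      have h1 := congrArg Complex.im (hz2 n hn)
      simp only [Complex.im_sum, Complex.add_im, Complex.im_mul_ofReal, Complex.zero_im] at h1
      exact h1

theorem main_final (k : ℕ) (hk : Even k) (hk4 : 4 ≤ k) (c : ℕ → ℂ)
    (h : ∀ q : ℂ, ‖q‖ < 1 →
      ∑ r ∈ Finset.Icc 1 (k - 1),
          (if Odd r ∧ Odd (k - r) then c r * Ghalf r (k - r) q else 0) = 0) :
    ∀ r ∈ Finset.Icc 1 (k - 1), Odd r → c r = 0 := by
  obtain ⟨m, rfl⟩ : ∃ m, k = 2*m+2 := by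
    obtain ⟨i, rfl⟩ := hk
    exact ⟨i-1, by omega⟩
  have h1 := final_aux m (by omega) c (by
    intro q hq
    have h2 := h q hq
    rw [reindex m (fun r => c r * Ghalf r (2*m+2-r) q)] at h2
    rw [← h2]
    refine Finset.sum_congr rfl fun j hj => ?_
    rw [Finset.mem_range] at hj
    rw [show 2*m+2-(2*j+1) = 2*(m-j)+1 by omega])
  intro r hr ho
  obtain ⟨j, rfl⟩ := ho
  rw [Finset.mem_Icc] at hr
  exact h1 j (by omega)

/-- the functions `q ↦ G^{1/2}_{r,s}(q)` with `r + s = k`, `r, s` odd,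
are linearly independent over `ℂ` on the open unit disc. -/
theorem Ghalf_linearIndependent (k : ℕ) (hk : Even k) (hk4 : 4 ≤ k) (c : ℕ → ℂ)
    (h : ∀ q : ℂ, ‖q‖ < 1 →
      ∑ r ∈ Finset.Icc 1 (k - 1),
          (if Odd r ∧ Odd (k - r) then c r * Ghalf r (k - r) q else 0) = 0) :
    ∀ r ∈ Finset.Icc 1 (k - 1), Odd r → c r = 0 := by
  exact main_final k hk hk4 c h
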